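/- arXiv:1902.00962 — 2 statements merged into one kernel-verified Lean document; each statement's English description precedes it below -/
import Mathlib

section
/- Let (X,r) be a square-free solution of finite order |X| = n with cyclic degree p, let G = G(X,r), and let F_p be the subgroup of G generated by {ι(x)^p : x ∈ X}. Then there exists an enumeration x_1, …, x_n of X (i.e., a bijection e : {1,…,n} → X) such that every element u ∈ G has a unique presentation u = ι(x_1)^{a_1} · ι(x_2)^{a_2} ⋯ ι(x_n)^{a_n} · W, where 0 ≤ a_i ≤ p−1 for each i and W ∈ F_p; that is, for every u ∈ G there exists exactly one pair (a, W) with a : {1,…,n} → {0,…,p−1} and W ∈ F_p satisfying this equality. -/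
/-- The left action `σ_x(y)`: first component of `r (x, y)`. -/
def sig {X : Type*} (r : X × X → X × X) (x y : X) : X := (r (x, y)).1

/-- The right action `τ_y(x)`: second component of `r (x, y)`. -/
def tau {X : Type*} (r : X × X → X × X) (y x : X) : X := (r (x, y)).2

/-- `r¹² = r × id`. -/
def r12 {X : Type*} (r : X × X → X × X) : X × X × X → X × X × X :=
  fun t => ((r (t.1, t.2.1)).1, (r (t.1, t.2.1)).2, t.2.2)

/-- `r²³ = id × r`. -/
def r23 {X : Type*} (r : X × X → X × X) : X × X × X → X × X × X :=
  fun t => (t.1, (r (t.2.1, t.2.2)).1, (r (t.2.1, t.2.2)).2)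

/-- The braid relation `r¹² ∘ r²³ ∘ r¹² = r²³ ∘ r¹² ∘ r²³`. -/
def IsBraided {X : Type*} (r : X × X → X × X) : Prop :=
  r12 r ∘ r23 r ∘ r12 r = r23 r ∘ r12 r ∘ r23 r

/-- Nondegeneracy: every `σ_x` and every `τ_y` is bijective. -/
def Nondegenerate {X : Type*} (r : X × X → X × X) : Prop :=
  (∀ x, Function.Bijective (sig r x)) ∧ (∀ y, Function.Bijective (tau r y))

/-- The defining relators of the group `G(X,r)`:
`x · y · (σ_x(y) · τ_y(x))⁻¹` for all `x, y ∈ X`. -/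
def ybRels {X : Type*} (r : X × X → X × X) : Set (FreeGroup X) :=
  { w | ∃ x y : X, w = FreeGroup.of x * FreeGroup.of y *
      (FreeGroup.of (sig r x y) * FreeGroup.of (tau r y x))⁻¹ }

/-- The group `G(X,r)` associated with `(X,r)`, presented by generators `X`
and relations `x y = σ_x(y) τ_y(x)`. -/
abbrev YBGroup {X : Type*} (r : X × X → X × X) := PresentedGroup (ybRels r)

/-- The canonical map `ι : X → G(X,r)`. -/
def ybι {X : Type*} (r : X × X → X × X) : X → YBGroup r := PresentedGroup.of

universe u v

theorem bs_roots_avg {n : ℕ} (hn : 0 < n) (s : Multiset ℂ) (hcard : s.card = n) (k : ℕ) (hk : 0 < k)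
    (hs : ∀ z ∈ s, z ^ k = 1) (hIntg : IsIntegral ℤ (s.sum / (n : ℂ))) :
    s.sum = 0 ∨ ∃ μ : ℂ, ∀ z ∈ s, z = μ := by
  classical
  by_cases h0 : s.sum = 0
  · exact Or.inl h0
  right
  set α : ℂ := s.sum / n with hα
  have hnC : (n : ℂ) ≠ 0 := by exact_mod_cast hn.ne'
  have hα0 : α ≠ 0 := div_ne_zero h0 hnC
  let S : Set ℂ := {z | z ∈ s}
  let K := IntermediateField.adjoin ℚ S
  have hSfin : S.Finite := by
    have : S = ↑s.toFinset := by ext; simp [S]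
    rw [this]; exact Finset.finite_toSet _
  have hzint : ∀ z ∈ s, IsIntegral ℚ z := fun z hz =>
    IsIntegral.of_pow hk (by rw [hs z hz]; exact isIntegral_one)
  have : Finite S := hSfin
  have hfd : FiniteDimensional ℚ K :=
    IntermediateField.finiteDimensional_adjoin (fun z hz => hzint z hz)
  have : NumberField K := { to_charZero := inferInstance, to_finiteDimensional := hfd }
  have hmem : ∀ z ∈ s, z ∈ K := fun z hz => IntermediateField.subset_adjoin ℚ S hz
  let t : Multiset K := s.attach.map (fun z => (⟨z.1, hmem z.1 z.2⟩ : K))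
  have ht : t.map (algebraMap K ℂ) = s := by
    simp only [t, Multiset.map_map, Function.comp_def]
    exact Multiset.attach_map_val s
  have htp : ∀ z ∈ t, z ^ k = 1 := by
    intro z hz
    apply (algebraMap K ℂ).injective
    rw [map_pow, map_one]
    apply hs
    rw [← ht]
    exact Multiset.mem_map_of_mem _ hz
  have htc : t.card = n := by simp [t, hcard]
  let a : K := t.sum / n
  have ha : algebraMap K ℂ a = α := by
    simp only [a, hα, map_div₀, map_natCast]
    rw [map_multiset_sum, ht]
  have ha0 : a ≠ 0 := by
    intro h; rw [h, map_zero] at ha; exact hα0 ha.symm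
  have haint : IsIntegral ℤ a := by
    rw [← isIntegral_algebraMap_iff (algebraMap K ℂ).injective, ha]; exact hIntg
  have hle : ∀ φ : K →+* ℂ, ‖φ a‖ ≤ 1 := by
    intro φ
    simp only [a, map_div₀, map_natCast, norm_div, Complex.norm_natCast]
    rw [div_le_one (by exact_mod_cast hn), map_multiset_sum]
    refine (norm_multiset_sum_le _).trans ?_
    rw [Multiset.map_map]
    have : t.map (norm ∘ φ) = t.map (fun _ => (1:ℝ)) := by
      apply Multiset.map_congr rfl
      intro z hz
      have : (φ z) ^ k = 1 := by rw [← map_pow, htp z hz, map_one]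
      exact Complex.norm_eq_one_of_pow_eq_one this hk.ne'
    rw [this]; simp [htc]
  obtain ⟨m, hm, ham⟩ := NumberField.Embeddings.pow_eq_one_of_norm_le_one K ℂ ha0 haint hle
  have hαm : α ^ m = 1 := by rw [← ha, ← map_pow, ham, map_one]
  have hαn : ‖α‖ = 1 := Complex.norm_eq_one_of_pow_eq_one hαm hm.ne'
  refine ⟨α, fun z hz => ?_⟩
  have hzn : ∀ z ∈ s, ‖z‖ = 1 := fun z hz => Complex.norm_eq_one_of_pow_eq_one (hs z hz) hk.ne'
  -- re (conj α * z) ≤ 1 with sum = n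
  let f : ℂ → ℝ := fun z => ((starRingEnd ℂ) α * z).re
  have hf1 : ∀ z ∈ s, f z ≤ 1 := by
    intro z hz
    refine (Complex.re_le_norm _).trans ?_
    rw [norm_mul, hzn z hz, RCLike.norm_conj, hαn]; norm_num
  have hsum : (s.map (fun z => 1 - f z)).sum = 0 := by
    rw [Multiset.sum_map_sub]
    have h1 : (s.map f).sum = ((starRingEnd ℂ) α * s.sum).re := by
      have h5 : (starRingEnd ℂ) α * s.sum = (s.map (fun z => (starRingEnd ℂ) α * z)).sum := by
        rw [Multiset.sum_map_mul_left, Multiset.map_id']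
      rw [h5, ← Complex.reLm_coe, map_multiset_sum, Multiset.map_map]
      rfl
    rw [h1]
    have h2 : s.sum = α * n := by rw [hα]; field_simp
    rw [h2, ← mul_assoc, ← Complex.normSq_eq_conj_mul_self, Complex.normSq_eq_norm_sq, hαn]
    simp [hcard]
  have hz0 : 1 - f z = 0 := by
    have hnn : ∀ x ∈ s.map (fun z => 1 - f z), 0 ≤ x := by
      intro x hx
      obtain ⟨w, hw, rfl⟩ := Multiset.mem_map.1 hx
      linarith [hf1 w hw]
    exact Multiset.all_zero_of_le_zero_le_of_sum_eq_zero hnn hsum _ (Multiset.mem_map_of_mem _ hz)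
  have hz1 := hzn z hz
  have h3 : Complex.normSq z = 1 := by rw [Complex.normSq_eq_norm_sq, hz1]; norm_num
  have h4 : Complex.normSq α = 1 := by rw [Complex.normSq_eq_norm_sq, hαn]; norm_num
  simp only [Complex.normSq_apply] at h3 h4
  simp only [f, Complex.mul_re, Complex.conj_re, Complex.conj_im] at hz0
  apply Complex.ext <;> nlinarith [sq_nonneg (z.re - α.re), sq_nonneg (z.im - α.im)]

theorem bs_matrix {n : ℕ} (hn : 0 < n) (M : Matrix (Fin n) (Fin n) ℂ) (k : ℕ) (hk : 0 < k) (hM : M ^ k = 1) :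
    IsIntegral ℤ M.trace ∧ (IsIntegral ℤ (M.trace / (n : ℂ)) → M.trace = 0 ∨ ∃ μ : ℂ, M = μ • 1) := by
  have hroots : ∀ z ∈ M.charpoly.roots, z ^ k = 1 := by
    intro z hz
    have h1 : M.charpoly.IsRoot z := Polynomial.isRoot_of_mem_roots hz
    have h2 : z ∈ spectrum ℂ M := Matrix.mem_spectrum_iff_isRoot_charpoly.2 h1
    have h3 : z ^ k ∈ spectrum ℂ (M ^ k) := spectrum.pow_mem_pow M k h2
    rw [hM] at h3
    have : Nonempty (Fin n) := ⟨⟨0, hn⟩⟩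
    rw [spectrum.one_eq] at h3
    simpa using h3
  have htr : M.trace = M.charpoly.roots.sum := Matrix.trace_eq_sum_roots_charpoly M
  have hcard : M.charpoly.roots.card = n := by
    rw [Polynomial.splits_iff_card_roots.1 (IsAlgClosed.splits _), Matrix.charpoly_natDegree_eq_dim]
    simp
  refine ⟨?_, fun hIntg => ?_⟩
  · rw [htr]
    exact IsIntegral.multiset_sum fun z hz => IsIntegral.of_pow hk (by rw [hroots z hz]; exact isIntegral_one)
  rw [htr] at hIntg ⊢
  refine (bs_roots_avg hn _ hcard k hk hroots hIntg).imp_right ?_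
  rintro ⟨μ, hμ⟩
  refine ⟨μ, ?_⟩
  have h1 : M.charpoly = (Polynomial.X - Polynomial.C μ) ^ n := by
    have := (IsAlgClosed.splits M.charpoly).eq_prod_roots_of_monic (Matrix.charpoly_monic M)
    rw [this, Multiset.eq_replicate_of_mem hμ, hcard]
    simp
  have h2 : minpoly ℂ M ∣ (Polynomial.X - Polynomial.C μ) ^ n := h1 ▸ Matrix.minpoly_dvd_charpoly M
  have h3 : minpoly ℂ M ∣ Polynomial.X ^ k - 1 := minpoly.dvd _ _ (by simp [hM])
  have h4 : Squarefree (minpoly ℂ M) := by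
    refine Squarefree.squarefree_of_dvd h3 ?_
    exact (Polynomial.X_pow_sub_one_separable_iff.2 (by exact_mod_cast hk.ne')).squarefree
  have h5 : minpoly ℂ M ∣ (Polynomial.X - Polynomial.C μ) := (h4.dvd_pow_iff_dvd hn.ne').1 h2
  have h6 := (minpoly.dvd_iff).1 h5
  simp only [map_sub, Polynomial.aeval_X, Polynomial.aeval_C, sub_eq_zero] at h6
  rw [h6, Algebra.algebraMap_eq_smul_one]


theorem bs_trace_pi {m : ℕ} (d : Fin m → ℕ)
    (x : Π i, Matrix (Fin (d i)) (Fin (d i)) ℂ) :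
    LinearMap.trace ℂ (Π i, Matrix (Fin (d i)) (Fin (d i)) ℂ) (LinearMap.mulLeft ℂ x) = ∑ i, (d i : ℂ) * (x i).trace := by
  classical
  let b := Pi.basis (fun i => Matrix.stdBasis ℂ (Fin (d i)) (Fin (d i)))
  rw [LinearMap.trace_eq_matrix_trace ℂ b, Matrix.trace, Fintype.sum_sigma]
  refine Finset.sum_congr rfl fun i _ => ?_
  rw [Fintype.sum_prod_type]
  have : ∀ a c, (LinearMap.toMatrix b b (LinearMap.mulLeft ℂ x)).diag ⟨i, (a, c)⟩ = x i a a := by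
    intro a c
    rw [Matrix.diag_apply, LinearMap.toMatrix_apply, LinearMap.mulLeft_apply]
    simp only [b, Pi.basis_repr, Pi.mul_apply, Pi.basis_apply, Pi.single_eq_same, Matrix.stdBasis_eq_single]
    have : ∀ (M : Matrix (Fin (d i)) (Fin (d i)) ℂ), (Matrix.stdBasis ℂ (Fin (d i)) (Fin (d i))).repr M (a,c) = M a c := by
      intro M
      rfl
    rw [this]
    simp
  simp only [this]
  simp [Matrix.trace, Finset.mul_sum]

theorem bs_trace_group {G : Type*} [Group G] [Fintype G] (g : G) (hg : g ≠ 1) :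
    LinearMap.trace ℂ (MonoidAlgebra ℂ G) (LinearMap.mulLeft ℂ (MonoidAlgebra.of ℂ G g)) = 0 := by
  classical
  let b : Module.Basis G ℂ (MonoidAlgebra ℂ G) := MonoidAlgebra.basis G ℂ
  rw [LinearMap.trace_eq_matrix_trace ℂ b, Matrix.trace]
  refine Finset.sum_eq_zero fun h _ => ?_
  rw [Matrix.diag_apply, LinearMap.toMatrix_apply, LinearMap.mulLeft_apply]
  have h1 : b.repr (MonoidAlgebra.of ℂ G g * b h) = Finsupp.single (g * h) 1 := by
    simp only [b, MonoidAlgebra.of_apply, MonoidAlgebra.basis_apply, MonoidAlgebra.single_mul_single, one_mul]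
    rfl
  rw [h1, Finsupp.single_apply, if_neg]
  simpa using hg

/-- the class-sum argument for one irreducible block -/
theorem bs_block {G : Type*} [Group G] [Finite G] {n : ℕ} (hn : 0 < n)
    (φ : MonoidAlgebra ℂ G →ₐ[ℂ] Matrix (Fin n) (Fin n) ℂ) (hφ : Function.Surjective φ)
    (g : G) (hcop : Nat.Coprime n (Nat.card (MulAction.orbit (ConjAct G) g))) :
    (φ (MonoidAlgebra.of ℂ G g)).trace = 0 ∨ ∃ μ : ℂ, φ (MonoidAlgebra.of ℂ G g) = μ • 1 := by
  classical
  have := Fintype.ofFinite G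
  set M := φ (MonoidAlgebra.of ℂ G g) with hMdef
  have hM : M ^ Nat.card G = 1 := by
    rw [hMdef, ← map_pow, ← map_pow, pow_card_eq_one', map_one, map_one]
  refine (bs_matrix hn M _ Nat.card_pos hM).2 ?_
  have htrint := (bs_matrix hn M _ Nat.card_pos hM).1
  let C : Finset G := (MulAction.orbit (ConjAct G) g).toFinset
  let KZ : MonoidAlgebra ℤ G := ∑ c ∈ C, MonoidAlgebra.of ℤ G c
  let K : MonoidAlgebra ℂ G := ∑ c ∈ C, MonoidAlgebra.of ℂ G c
  have hKint : IsIntegral ℤ (φ K) := by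
    have h1 : IsIntegral ℤ KZ := by
      have : Module.Finite ℤ (MonoidAlgebra ℤ G) := Module.Finite.of_basis (MonoidAlgebra.basis G ℤ)
      exact Algebra.IsIntegral.isIntegral KZ
    let f : MonoidAlgebra ℤ G →+* MonoidAlgebra ℂ G := MonoidAlgebra.mapRingHom G (Int.castRingHom ℂ)
    have h2 : f KZ = K := by
      simp only [KZ, K, map_sum]
      refine Finset.sum_congr rfl fun c _ => ?_
      simp [f, MonoidAlgebra.of_apply]
    have h3 := h1.map ((φ.toRingHom.comp f).toIntAlgHom)
    simpa [h2] using h3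
  have hconj : ∀ h : G, MonoidAlgebra.of ℂ G h * K = K * MonoidAlgebra.of ℂ G h := by
    intro h
    simp only [K, Finset.mul_sum, Finset.sum_mul, ← map_mul]
    refine Finset.sum_bij (fun c _ => h * c * h⁻¹) ?_ ?_ ?_ ?_
    · intro c hc
      simp only [C, Set.mem_toFinset] at hc ⊢
      obtain ⟨k, rfl⟩ := hc
      refine ⟨ConjAct.toConjAct h * k, ?_⟩
      simp [ConjAct.smul_def, mul_assoc]
    · intro a _ b _ hab
      simpa using hab
    · intro c hc
      refine ⟨h⁻¹ * c * h, ?_, by group⟩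
      simp only [C, Set.mem_toFinset] at hc ⊢
      obtain ⟨k, rfl⟩ := hc
      refine ⟨ConjAct.toConjAct h⁻¹ * k, ?_⟩
      simp [ConjAct.smul_def, mul_assoc]
    · intro c _
      simp
  have hcent : ∀ a : MonoidAlgebra ℂ G, a * K = K * a := by
    intro a
    induction a using MonoidAlgebra.induction_on with
    | of h => exact hconj h
    | add a b ha hb => rw [add_mul, mul_add, ha, hb]
    | smul r a ha => rw [smul_mul_assoc, mul_smul_comm, ha]
  have hsc : φ K ∈ Set.range (Matrix.scalar (Fin n) (α := ℂ)) := by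
    rw [Matrix.mem_range_scalar_iff_commute_single']
    intro i j
    obtain ⟨a, ha⟩ := hφ (Matrix.single i j 1)
    rw [← ha]
    show _ * _ = _ * _
    rw [← map_mul, ← map_mul, hcent]
  obtain ⟨ω, hω⟩ := hsc
  have hωint : IsIntegral ℤ ω := by
    have : Nonempty (Fin n) := ⟨⟨0, hn⟩⟩
    rw [← hω] at hKint
    have hinj : Function.Injective (algebraMap ℂ (Matrix (Fin n) (Fin n) ℂ)) := (algebraMap ℂ _).injective
    exact (isIntegral_algHom_iff ((Matrix.scalar (Fin n) (α := ℂ)).toIntAlgHom) (fun _ _ h => Matrix.scalar_inj.1 h)).1 hKint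
  have htr : (φ K).trace = (C.card : ℂ) * M.trace := by
    simp only [K, map_sum, Matrix.trace_sum]
    rw [Finset.sum_congr rfl (g := fun _ => M.trace), Finset.sum_const, nsmul_eq_mul]
    intro c hc
    simp only [C, Set.mem_toFinset] at hc
    obtain ⟨k, rfl⟩ := hc
    simp only [ConjAct.smul_def, map_mul, hMdef]
    rw [Matrix.trace_mul_comm, ← mul_assoc, ← map_mul, ← map_mul]
    simp
  have hCcard : C.card = Nat.card (MulAction.orbit (ConjAct G) g) := by
    rw [Nat.card_eq_fintype_card, Set.toFinset_card]
  have hnω : (n : ℂ) * ω = (C.card : ℂ) * M.trace := by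
    rw [← htr, ← hω]; simp [Matrix.trace, mul_comm]
  have hbez := Nat.gcd_eq_gcd_ab n C.card
  rw [hCcard, hcop.gcd_eq_one, ← hCcard] at hbez
  have hbezC : (1 : ℂ) = (n : ℂ) * (Nat.gcdA n C.card : ℤ) + (C.card : ℂ) * (Nat.gcdB n C.card : ℤ) := by
    exact_mod_cast hbez
  have hnC : (n : ℂ) ≠ 0 := by exact_mod_cast hn.ne'
  have : M.trace / n = (Nat.gcdA n C.card : ℤ) * M.trace + (Nat.gcdB n C.card : ℤ) * ω := by
    field_simp
    calc M.trace = 1 * M.trace := (one_mul _).symm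
      _ = _ := by rw [hbezC]; linear_combination -((Nat.gcdB n C.card : ℤ) : ℂ) * hnω
  rw [this]
  exact ((isIntegral_algebraMap (A := ℂ) (R := ℤ)).mul htrint).add ((isIntegral_algebraMap (A := ℂ) (R := ℤ)).mul hωint)

theorem bs_class {G : Type*} [Group G] [Finite G] [IsSimpleGroup G] (g : G) (hg : g ≠ 1)
    (q b : ℕ) (hq : q.Prime) (hcard : Nat.card (MulAction.orbit (ConjAct G) g) = q ^ b) :
    ∀ x y : G, x * y = y * x := by
  classical
  have := Fintype.ofFinite G
  by_contra hnc
  push Not at hnc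
  obtain ⟨x0, y0, hxy⟩ := hnc
  have : NeZero (Nat.card G : ℂ) := ⟨by exact_mod_cast Nat.card_pos.ne'⟩
  have : Module.Finite ℂ (MonoidAlgebra ℂ G) := Module.Finite.of_basis (MonoidAlgebra.basis G ℂ)
  obtain ⟨m, d, hd, ⟨e⟩⟩ := IsSemisimpleRing.exists_algEquiv_pi_matrix_of_isAlgClosed ℂ (MonoidAlgebra ℂ G)
  let φ : ∀ i, MonoidAlgebra ℂ G →ₐ[ℂ] Matrix (Fin (d i)) (Fin (d i)) ℂ := fun i =>
    (Pi.evalAlgHom ℂ (fun i => Matrix (Fin (d i)) (Fin (d i)) ℂ) i).comp e.toAlgHom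
  have hφe : ∀ i a, φ i a = e a i := fun i a => rfl
  have hφ : ∀ i, Function.Surjective (φ i) := by
    intro i M
    refine ⟨e.symm (Pi.single i M), ?_⟩
    rw [hφe, AlgEquiv.apply_symm_apply, Pi.single_eq_same]
  let ρ : ∀ i, G →* Matrix (Fin (d i)) (Fin (d i)) ℂ := fun i => (φ i : _ →* _).comp (MonoidAlgebra.of ℂ G)
  have hρ : ∀ i h, ρ i h = φ i (MonoidAlgebra.of ℂ G h) := fun i h => rfl
  have hdpos : ∀ i, 0 < d i := fun i => Nat.pos_of_ne_zero (hd i).out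
  -- trivial blocks have size one
  have hone : ∀ i, (∀ h, ρ i h = 1) → ∀ a, ∃ c : ℂ, φ i a = c • 1 := by
    intro i hi a
    induction a using MonoidAlgebra.induction_on with
    | of h => exact ⟨1, by rw [← hρ, hi, one_smul]⟩
    | add a b ha hb =>
      obtain ⟨c, hc⟩ := ha
      obtain ⟨c', hc'⟩ := hb
      exact ⟨c + c', by rw [map_add, hc, hc', add_smul]⟩
    | smul r a ha =>
      obtain ⟨c, hc⟩ := ha
      exact ⟨r * c, by rw [map_smul, hc, smul_smul]⟩
  have hd1 : ∀ i, (∀ h, ρ i h = 1) → d i = 1 := by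
    intro i hi
    by_contra hne
    have h2 : 1 < d i := by have := hdpos i; omega
    obtain ⟨a, ha⟩ := hφ i (Matrix.single ⟨0, hdpos i⟩ ⟨1, h2⟩ 1)
    obtain ⟨c, hc⟩ := hone i hi a
    have h3 := congrFun (congrFun (ha.symm.trans hc) ⟨0, hdpos i⟩) ⟨1, h2⟩
    simp at h3
  -- existence of the trivial block
  have hex : ∃ i, ∀ h, ρ i h = 1 := by
    let E : MonoidAlgebra ℂ G := ∑ h : G, MonoidAlgebra.of ℂ G h
    have hE0 : E ≠ 0 := by
      intro h0
      have h1 := congrArg (MonoidAlgebra.lift ℂ ℂ G (1 : G →* ℂ)) h0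
      simp only [E, map_sum, map_zero, MonoidAlgebra.lift_of] at h1
      simp at h1
    have hleft : ∀ h, MonoidAlgebra.of ℂ G h * E = E := by
      intro h
      simp only [E, Finset.mul_sum, ← map_mul]
      exact Fintype.sum_equiv (Equiv.mulLeft h) _ _ (fun _ => rfl)
    have hright : ∀ h, E * MonoidAlgebra.of ℂ G h = E := by
      intro h
      simp only [E, Finset.sum_mul, ← map_mul]
      exact Fintype.sum_equiv (Equiv.mulRight h) _ _ (fun _ => rfl)
    have heE : e E ≠ 0 := by simpa using hE0
    obtain ⟨i, hi⟩ : ∃ i, e E i ≠ 0 := by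
      by_contra hcon
      push Not at hcon
      exact heE (funext hcon)
    refine ⟨i, fun h => ?_⟩
    have hcent : ∀ a : MonoidAlgebra ℂ G, a * E = E * a := by
      intro a
      induction a using MonoidAlgebra.induction_on with
      | of h => rw [hleft, hright]
      | add a b ha hb => rw [add_mul, mul_add, ha, hb]
      | smul r a ha => rw [smul_mul_assoc, mul_smul_comm, ha]
    have hsc : φ i E ∈ Set.range (Matrix.scalar (Fin (d i)) (α := ℂ)) := by
      rw [Matrix.mem_range_scalar_iff_commute_single']
      intro j k
      obtain ⟨a, ha⟩ := hφ i (Matrix.single j k 1)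
      rw [← ha]
      show _ * _ = _ * _
      rw [← map_mul, ← map_mul, hcent]
    obtain ⟨c, hc⟩ := hsc
    have hc' : φ i E = c • 1 := by rw [← hc, Matrix.scalar_apply, Matrix.smul_one_eq_diagonal]
    have hc0 : c ≠ 0 := by
      rintro rfl
      rw [zero_smul] at hc'
      exact hi hc'
    have h1 : ρ i h * φ i E = φ i E := by rw [hρ, ← map_mul, hleft]
    rw [hc', mul_smul_comm, mul_one] at h1
    exact smul_right_injective _ hc0 h1
  obtain ⟨i0, hi0⟩ := hex
  have huniq : ∀ i, (∀ h, ρ i h = 1) → i = i0 := by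
    intro i hi
    by_contra hne
    obtain ⟨a, ha⟩ := e.surjective (Pi.single i 1)
    have h1 : φ i a = 1 := by rw [hφe, ha, Pi.single_eq_same]
    have h2 : φ i0 a = 0 := by rw [hφe, ha, Pi.single_eq_of_ne (Ne.symm hne)]
    have h3 : ∀ a, ∃ c : ℂ, φ i a = c • 1 ∧ φ i0 a = c • 1 := by
      intro a
      induction a using MonoidAlgebra.induction_on with
      | of h => exact ⟨1, by rw [← hρ, hi, one_smul], by rw [← hρ, hi0, one_smul]⟩
      | add a b ha hb =>
        obtain ⟨c, hc, hc2⟩ := ha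
        obtain ⟨c', hc', hc2'⟩ := hb
        exact ⟨c + c', by rw [map_add, hc, hc', add_smul], by rw [map_add, hc2, hc2', add_smul]⟩
      | smul r a ha =>
        obtain ⟨c, hc, hc2⟩ := ha
        exact ⟨r * c, by rw [map_smul, hc, smul_smul], by rw [map_smul, hc2, smul_smul]⟩
    obtain ⟨c, hc, hc2⟩ := h3 a
    have hne1 : Nonempty (Fin (d i)) := ⟨⟨0, hdpos i⟩⟩
    have hne2 : Nonempty (Fin (d i0)) := ⟨⟨0, hdpos i0⟩⟩
    rw [h2] at hc2
    rw [h1] at hc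
    have hc0 : c = 0 := by
      rcases smul_eq_zero.1 hc2.symm with h | h
      · exact h
      · exact absurd h one_ne_zero
    rw [hc0, zero_smul] at hc
    exact one_ne_zero hc
  -- nontrivial blocks
  have hblock : ∀ i, i ≠ i0 → q ∣ d i ∨ (ρ i g).trace = 0 := by
    intro i hi
    by_cases hqd : q ∣ d i
    · exact Or.inl hqd
    right
    have hcop : Nat.Coprime (d i) (Nat.card (MulAction.orbit (ConjAct G) g)) := by
      rw [hcard]
      exact Nat.Coprime.pow_right _ ((hq.coprime_iff_not_dvd.2 hqd).symm)
    rcases bs_block (hdpos i) (φ i) (hφ i) g hcop with h | ⟨μ, hμ⟩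
    · exact h
    exfalso
    apply hi
    apply huniq
    let N : Subgroup G := 
      { carrier := {h | ∃ μ : ℂ, ρ i h = μ • 1}
        one_mem' := ⟨1, by rw [map_one, one_smul]⟩
        mul_mem' := by
          rintro a b ⟨c, hc⟩ ⟨c', hc'⟩
          exact ⟨c * c', by rw [map_mul, hc, hc', smul_mul_smul_comm, one_mul]⟩
        inv_mem' := by
          rintro a ⟨c, hc⟩
          have h1 : ρ i a * ρ i a⁻¹ = 1 := by rw [← map_mul, mul_inv_cancel, map_one]
          have hne1 : Nonempty (Fin (d i)) := ⟨⟨0, hdpos i⟩⟩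
          have hc0 : c ≠ 0 := by
            rintro rfl
            rw [hc, zero_smul, zero_mul] at h1
            exact zero_ne_one h1
          rw [hc, smul_mul_assoc, one_mul] at h1
          exact ⟨c⁻¹, by rw [← h1, smul_smul, inv_mul_cancel₀ hc0, one_smul]⟩ }
    have hN : N.Normal := ⟨by
      rintro a ⟨c, hc⟩ h
      refine ⟨c, ?_⟩
      rw [map_mul, map_mul, hc, mul_smul_comm, mul_one, smul_mul_assoc, ← map_mul, mul_inv_cancel, map_one]⟩
    have hNt : N = ⊤ := by
      rcases hN.eq_bot_or_eq_top with h | h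
      · exfalso
        have : g ∈ N := ⟨μ, hμ⟩
        rw [h, Subgroup.mem_bot] at this
        exact hg this
      · exact h
    have hkt : (ρ i).ker = ⊤ := by
      rcases (inferInstance : (ρ i).ker.Normal).eq_bot_or_eq_top with h | h
      · exfalso
        apply hxy
        have hinj := (MonoidHom.ker_eq_bot_iff (ρ i)).1 h
        apply hinj
        obtain ⟨c, hc⟩ : x0 ∈ N := hNt ▸ Subgroup.mem_top _
        rw [map_mul, map_mul, hc, smul_mul_assoc, mul_smul_comm, one_mul, mul_one]
      · exact h
    intro h
    have : h ∈ (ρ i).ker := hkt ▸ Subgroup.mem_top _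
    exact this
  have hsum : ∑ i, (d i : ℂ) * (ρ i g).trace = 0 := by
    have h1 := bs_trace_pi d (e (MonoidAlgebra.of ℂ G g))
    have h2 := bs_trace_group g hg
    rw [← LinearMap.trace_conj' _ e.toLinearEquiv] at h2
    have h3 : e.toLinearEquiv.conj (LinearMap.mulLeft ℂ (MonoidAlgebra.of ℂ G g))
        = LinearMap.mulLeft ℂ (e (MonoidAlgebra.of ℂ G g)) := by
      refine LinearMap.ext fun x => ?_
      rw [LinearEquiv.conj_apply_apply, LinearMap.mulLeft_apply, LinearMap.mulLeft_apply]
      show e (_ * e.symm x) = _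
      rw [map_mul, AlgEquiv.apply_symm_apply]
    rw [h3, h1] at h2
    exact h2
  have hIntg : ∀ i, IsIntegral ℤ (ρ i g).trace := by
    intro i
    refine (bs_matrix (hdpos i) (ρ i g) (Nat.card G) Nat.card_pos ?_).1
    rw [← map_pow, pow_card_eq_one', map_one]
  have hq0 : (q : ℂ) ≠ 0 := by exact_mod_cast hq.ne_zero
  rw [← Finset.add_sum_erase _ _ (Finset.mem_univ i0)] at hsum
  have h1 : (d i0 : ℂ) * (ρ i0 g).trace = 1 := by
    rw [hi0]; simp [hd1 i0 hi0]
  rw [h1] at hsum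
  have h2 : IsIntegral ℤ ((∑ i ∈ Finset.univ.erase i0, (d i : ℂ) * (ρ i g).trace) / q) := by
    rw [Finset.sum_div]
    refine IsIntegral.sum _ fun i hi => ?_
    rcases hblock i (Finset.ne_of_mem_erase hi) with ⟨k, hk⟩ | h
    · have : (d i : ℂ) * (ρ i g).trace / q = (k : ℤ) * (ρ i g).trace := by
        have hk' : (d i : ℂ) = q * k := by exact_mod_cast hk
        rw [hk']; push_cast; field_simp
      rw [this]
      exact (isIntegral_algebraMap (A := ℂ) (R := ℤ)).mul (hIntg i)
    · rw [h]; simpa using isIntegral_zero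
  have h3 : (∑ i ∈ Finset.univ.erase i0, (d i : ℂ) * (ρ i g).trace) / q = algebraMap ℚ ℂ (-1 / q) := by
    rw [eq_neg_of_add_eq_zero_right hsum]; simp
  rw [h3, isIntegral_algebraMap_iff (algebraMap ℚ ℂ).injective] at h2
  obtain ⟨z, hz⟩ := IsIntegrallyClosed.isIntegral_iff.1 h2
  have hqQ : (q : ℚ) ≠ 0 := by exact_mod_cast hq.ne_zero
  have h4 : (z : ℚ) * q = -1 := by
    have : (z : ℚ) = -1 / q := by simpa using hz
    rw [this]; field_simp
  have h5 : z * q = -1 := by exact_mod_cast h4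
  have h6 : (q : ℤ) ∣ 1 := ⟨-z, by linarith⟩
  have h7 : q ∣ 1 := by exact_mod_cast h6
  exact hq.one_lt.ne' (Nat.dvd_one.1 h7)


theorem bs_paqb (p q : ℕ) (hp : p.Prime) (hq : q.Prime) : ∀ (n : ℕ) (G : Type u) [Group G] [Finite G],
    Nat.card G = n → (∀ l : ℕ, l.Prime → l ∣ Nat.card G → l = p ∨ l = q) → Group.IsSolvable G := by
  intro n
  induction n using Nat.strong_induction_on with
  | _ n ih =>
  intro G _ _ hn hG
  by_cases hs : Subsingleton G
  · infer_instance
  have hnt : Nontrivial G := not_subsingleton_iff_nontrivial.1 hs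
  by_cases hsimp : ∃ N : Subgroup G, N.Normal ∧ N ≠ ⊥ ∧ N ≠ ⊤
  · obtain ⟨N, hN, hb, ht⟩ := hsimp
    have hmul := N.card_mul_index
    have hi : N.index ≠ 1 := fun h => ht (Subgroup.index_eq_one.1 h)
    have hc : Nat.card N ≠ 1 := fun h => hb (Subgroup.card_eq_one.1 h)
    have hc0 : 0 < Nat.card N := Nat.card_pos
    have hi0 : 0 < N.index := Nat.pos_of_ne_zero N.index_ne_zero_of_finite
    have h1 : Group.IsSolvable N := by
      refine ih (Nat.card N) ?_ N rfl fun l hl hd => hG l hl (hd.trans N.card_subgroup_dvd_card)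
      rw [← hn, ← hmul]; nlinarith [show 2 ≤ N.index by omega]
    have h2 : Group.IsSolvable (G ⧸ N) := by
      refine ih (Nat.card (G ⧸ N)) ?_ (G ⧸ N) rfl fun l hl hd => hG l hl (hd.trans N.index_dvd_card)
      show N.index < n
      rw [← hn, ← hmul]; nlinarith [show 2 ≤ Nat.card N by omega]
    exact Group.isSolvable_of_ker_le_range N.subtype (QuotientGroup.mk' N) (by simp)
  · push Not at hsimp
    have hsg : IsSimpleGroup G := ⟨fun N hN => by
      by_cases hb : N = ⊥
      · exact Or.inl hb
      · exact Or.inr (hsimp N hN hb)⟩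
    obtain ⟨l, hl, hld⟩ := Nat.exists_prime_and_dvd (n := Nat.card G) (Finite.one_lt_card.ne')
    obtain ⟨q', hq', hother⟩ : ∃ q' : ℕ, q'.Prime ∧ ∀ r : ℕ, r.Prime → r ∣ Nat.card G → r = l ∨ r = q' := by
      rcases hG l hl hld with rfl | rfl
      · exact ⟨q, hq, hG⟩
      · exact ⟨p, hp, fun r h1 h2 => (hG r h1 h2).symm⟩
    have : Fact l.Prime := ⟨hl⟩
    obtain ⟨P⟩ : Nonempty (Sylow l G) := inferInstance
    have hPnt : Nontrivial P := by
      rw [← Finite.one_lt_card_iff_nontrivial]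
      have := P.dvd_card_of_dvd_card hld
      have h2 := Nat.le_of_dvd Nat.card_pos this
      exact lt_of_lt_of_le hl.one_lt h2
    have hcn : Nontrivial (Subgroup.center P) := P.isPGroup'.center_nontrivial
    obtain ⟨⟨z, hzc⟩, hz1⟩ := exists_ne (1 : Subgroup.center P)
    let P' : Subgroup (ConjAct G) := (P : Subgroup G).map (ConjAct.toConjAct (G := G)).toMonoidHom
    have hle : P' ≤ MulAction.stabilizer (ConjAct G) (z : G) := by
      rintro _ ⟨x, hx, rfl⟩
      rw [MulAction.mem_stabilizer_iff]
      show ConjAct.toConjAct x • (z : G) = z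
      rw [ConjAct.toConjAct_smul]
      have := Subgroup.mem_center_iff.1 hzc ⟨x, hx⟩
      have h2 : x * (z : G) = z * x := congrArg Subtype.val this
      rw [h2]; group
    have hidx : P'.index = (P : Subgroup G).index :=
      Subgroup.index_map_equiv (P : Subgroup G) (ConjAct.toConjAct (G := G))
    have hdvd : Nat.card (MulAction.orbit (ConjAct G) (z : G)) ∣ (P : Subgroup G).index := by
      rw [← hidx, Nat.card_coe_set_eq, ← MulAction.index_stabilizer]
      exact Subgroup.index_dvd_of_le hle
    have hnl : ¬ l ∣ Nat.card (MulAction.orbit (ConjAct G) (z : G)) := fun h =>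
      P.not_dvd_index (h.trans hdvd)
    have hpow : ∃ b, Nat.card (MulAction.orbit (ConjAct G) (z : G)) = q' ^ b := by
      have hne : Nat.card (MulAction.orbit (ConjAct G) (z : G)) ≠ 0 := by
        intro h; rw [h] at hnl; exact hnl (dvd_zero _)
      refine ⟨_, Nat.eq_prime_pow_of_unique_prime_dvd hne fun {d} hd hdd => ?_⟩
      rcases hother d hd (hdd.trans (hdvd.trans (Subgroup.index_dvd_card _))) with rfl | h
      · exact absurd hdd hnl
      · exact h
    obtain ⟨b, hb⟩ := hpow
    have hz1' : (z : G) ≠ 1 := by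
      intro h
      apply hz1
      ext
      exact h
    exact Group.isSolvable_of_comm (bs_class (z : G) hz1' q' b hq' hb)

theorem bs_normal_p (G : Type u) [Group G] [Finite G] [Nontrivial G] [hs : Group.IsSolvable G] :
    ∃ p : ℕ, p.Prime ∧ ∃ N : Subgroup G, N.Normal ∧ N ≠ ⊥ ∧ IsPGroup p N := by
  classical
  have hex : ∃ n, derivedSeries G n = ⊥ := hs.solvable
  let n := Nat.find hex
  have hn : derivedSeries G n = ⊥ := Nat.find_spec hex
  have hn0 : n ≠ 0 := by
    intro h
    rw [h, derivedSeries_zero] at hn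
    exact top_ne_bot hn
  obtain ⟨k, hk⟩ := Nat.exists_eq_succ_of_ne_zero hn0
  let D := derivedSeries G k
  have hD : D ≠ ⊥ := Nat.find_min hex (show k < n by omega)
  have hcomm : ∀ a ∈ D, ∀ b ∈ D, a * b = b * a := by
    rw [hk, derivedSeries_succ, Subgroup.commutator_eq_bot_iff_le_centralizer] at hn
    intro a ha b hb
    exact (Subgroup.mem_centralizer_iff.1 (hn ha) b hb).symm
  obtain ⟨p, hp, hpd⟩ := Nat.exists_prime_and_dvd (n := Nat.card D) (fun h => hD (Subgroup.card_eq_one.1 h))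
  have : Fact p.Prime := ⟨hp⟩
  have hDn : D.Normal := derivedSeries_normal G k
  let N : Subgroup G :=
    { carrier := {x | x ∈ D ∧ x ^ p = 1}
      one_mem' := ⟨D.one_mem, one_pow _⟩
      mul_mem' := by
        rintro a b ⟨ha, ha'⟩ ⟨hb, hb'⟩
        refine ⟨D.mul_mem ha hb, ?_⟩
        rw [Commute.mul_pow (hcomm a ha b hb), ha', hb', one_mul]
      inv_mem' := by
        rintro a ⟨ha, ha'⟩
        exact ⟨D.inv_mem ha, by rw [inv_pow, ha', inv_one]⟩ }
  refine ⟨p, hp, N, ⟨?_⟩, ?_, ?_⟩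
  · rintro a ⟨ha, ha'⟩ g
    exact ⟨hDn.conj_mem a ha g, by rw [conj_pow, ha']; group⟩
  · obtain ⟨x, hx⟩ := exists_prime_orderOf_dvd_card' p hpd
    intro hb
    have hxN : (x : G) ∈ N := ⟨x.2, by
      have := pow_orderOf_eq_one x
      rw [hx] at this
      exact congrArg Subtype.val this⟩
    rw [hb, Subgroup.mem_bot] at hxN
    have : x = 1 := Subtype.ext hxN
    rw [this, orderOf_one] at hx
    exact hp.one_lt.ne hx
  · intro x
    exact ⟨1, by rw [pow_one]; exact Subtype.ext x.2.2⟩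

theorem bs_coprime_relIndex {G : Type u} [Group G] [Finite G] (H K : Subgroup G)
    (h : Nat.Coprime H.index K.index) : K.relIndex H = K.index ∧ ∀ x : G, ∃ a ∈ H, ∃ b ∈ K, x = a * b := by
  have h1 : K.relIndex H * H.index = H.relIndex K * K.index := by
    rw [← Subgroup.inf_relIndex_right, Subgroup.relIndex_mul_index inf_le_right,
      ← Subgroup.inf_relIndex_right H K, Subgroup.relIndex_mul_index inf_le_right, inf_comm]
  have h2 : K.index ∣ K.relIndex H := by
    refine Nat.Coprime.dvd_of_dvd_mul_right h.symm ?_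
    rw [h1]; exact dvd_mul_left _ _
  have h3 : K.relIndex H ≤ K.index := by
    have := Subgroup.relIndex_le_of_le_right (H := K) (K := H) (L := ⊤) le_top (by
      rw [Subgroup.relIndex_top_right]; exact K.index_ne_zero_of_finite)
    rwa [Subgroup.relIndex_top_right] at this
  have h4 : K.relIndex H = K.index :=
    le_antisymm h3 (Nat.le_of_dvd (Nat.pos_of_ne_zero (by
      rw [Subgroup.relIndex]; exact Subgroup.index_ne_zero_of_finite)) h2)
  refine ⟨h4, fun x => ?_⟩
  let f := Subgroup.quotientSubgroupOfEmbeddingOfLE K (le_top : H ≤ ⊤)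
  have hinj : Function.Injective (fun y : H ⧸ K.subgroupOf H =>
      Quotient.liftOn' y (fun a => ((a : G) : G ⧸ K)) (by
        intro a b hab
        rw [QuotientGroup.leftRel_apply] at hab
        exact QuotientGroup.eq.2 hab)) := by
    intro y z
    induction y using QuotientGroup.induction_on with | H a => ?_
    induction z using QuotientGroup.induction_on with | H b => ?_
    intro hab
    change ((a : G) : G ⧸ K) = ((b : G) : G ⧸ K) at hab
    have hab2 := QuotientGroup.eq.1 hab
    apply QuotientGroup.eq.2
    exact hab2
  have hbij := hinj.bijective_of_nat_card_le (by
    show K.index ≤ K.relIndex H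
    exact h4.ge)
  obtain ⟨y, hy⟩ := hbij.2 (x : G ⧸ K)
  induction y using QuotientGroup.induction_on with | H a => ?_
  have := QuotientGroup.eq.1 hy
  exact ⟨a, a.2, _, this, by group⟩

/-- every prime has a Hall complement -/
def bsHall (G : Type u) [Group G] : Prop :=
  ∀ l : ℕ, l.Prime → ∃ H : Subgroup G, ¬ l ∣ Nat.card H ∧ ∃ k, H.index = l ^ k

theorem bsHall.quot {G : Type u} [Group G] [Finite G] (h : bsHall G) (N : Subgroup G) [N.Normal] :
    bsHall (G ⧸ N) := by
  intro l hl
  obtain ⟨H, hH, k, hk⟩ := h l hl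
  refine ⟨H.map (QuotientGroup.mk' N), fun hd => hH (hd.trans ?_), ?_⟩
  · exact Subgroup.card_map_dvd _ _
  · have : (H.map (QuotientGroup.mk' N)).index ∣ l ^ k := by
      rw [← hk]; exact Subgroup.index_map_dvd _ (QuotientGroup.mk'_surjective N)
    obtain ⟨j, -, hj⟩ := (Nat.dvd_prime_pow hl).1 this
    exact ⟨j, hj⟩

theorem bsHall.sub {G : Type u} [Group G] [Finite G] (h : bsHall G) (l : ℕ) (hl : l.Prime)
    (H : Subgroup G) (hH : ¬ l ∣ Nat.card H) (hk : ∃ k, H.index = l ^ k) : bsHall H := by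
  intro q hq
  by_cases hql : q = l
  · subst hql
    exact ⟨⊤, by rwa [Subgroup.card_top], 0, by simp⟩
  obtain ⟨K, hK, j, hj⟩ := h q hq
  obtain ⟨k, hk⟩ := hk
  refine ⟨K.subgroupOf H, fun hd => hK (hd.trans ?_), j, ?_⟩
  · exact Subgroup.card_dvd_of_injective ((H.subtype.subgroupComap K)) (by
      intro a b hab
      have : (a : H) = (b : H) := Subtype.ext (congrArg (fun z : K => (z : G)) hab)
      exact Subtype.ext this)
  · rw [← hj]
    refine (bs_coprime_relIndex H K ?_).1
    rw [hk, hj]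
    exact Nat.Coprime.pow _ _ ((Nat.coprime_primes hl hq).2 (Ne.symm hql))

theorem bs_hall : ∀ (n : ℕ) (G : Type u) [Group G] [Finite G],
    Nat.card G = n → bsHall G → Group.IsSolvable G := by
  intro n
  induction n using Nat.strong_induction_on with
  | _ n ih =>
  intro G _ _ hn hG
  by_cases h3 : ∃ a b c : ℕ, a.Prime ∧ b.Prime ∧ c.Prime ∧ a ≠ b ∧ a ≠ c ∧ b ≠ c ∧
      a ∣ Nat.card G ∧ b ∣ Nat.card G ∧ c ∣ Nat.card G
  swap
  · -- at most two primes
    push Not at h3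
    by_cases h1 : ∃ a, a.Prime ∧ a ∣ Nat.card G
    · obtain ⟨a, ha, had⟩ := h1
      by_cases h2 : ∃ b, b.Prime ∧ b ∣ Nat.card G ∧ a ≠ b
      · obtain ⟨b, hb, hbd, hab⟩ := h2
        refine bs_paqb a b ha hb _ G rfl fun l hl hld => ?_
        by_contra hcon
        push Not at hcon
        exact h3 a b l ha hb hl hab (Ne.symm hcon.1) (Ne.symm hcon.2) had hbd hld
      · push Not at h2
        exact bs_paqb a a ha ha _ G rfl fun l hl hld => Or.inl (h2 l hl hld).symm
    · push Not at h1
      exact bs_paqb 2 2 Nat.prime_two Nat.prime_two _ G rfl fun l hl hld => absurd hld (h1 l hl)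
  obtain ⟨a, b, c, ha, hb, hc, hab, hac, hbc, had, hbd, hcd⟩ := h3
  -- complements are solvable
  have hsolv : ∀ l : ℕ, l.Prime → l ∣ Nat.card G → ∀ H : Subgroup G, ¬ l ∣ Nat.card H →
      (∃ k, H.index = l ^ k) → Group.IsSolvable H := by
    intro l hl hld H hH hk
    refine ih (Nat.card H) ?_ H rfl (hG.sub l hl H hH hk)
    rw [← hn]
    refine lt_of_le_of_ne (Nat.le_of_dvd Nat.card_pos H.card_subgroup_dvd_card) fun h => hH (h ▸ hld)
  obtain ⟨H, hH, ka, hka⟩ := hG a ha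
  have hHs := hsolv a ha had H hH ⟨ka, hka⟩
  have hbH : b ∣ Nat.card H := by
    have h1 : b ∣ Nat.card H * H.index := by rw [H.card_mul_index]; exact hbd
    refine (hb.dvd_mul.1 h1).resolve_right fun h2 => ?_
    rw [hka] at h2
    exact hab ((Nat.prime_dvd_prime_iff_eq hb ha).1 (hb.dvd_of_dvd_pow h2)).symm
  have hHnt : Nontrivial H := by
    rw [← Finite.one_lt_card_iff_nontrivial]
    exact lt_of_lt_of_le hb.one_lt (Nat.le_of_dvd Nat.card_pos hbH)
  obtain ⟨p, hp, M, hMn, hMb, hMp⟩ := bs_normal_p H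
  have : Fact p.Prime := ⟨hp⟩
  obtain ⟨l, hl, hld, hlp, hla⟩ : ∃ l : ℕ, l.Prime ∧ l ∣ Nat.card G ∧ l ≠ p ∧ l ≠ a := by
    by_cases h : b = p
    · exact ⟨c, hc, hcd, fun h' => hbc (h.trans h'.symm), hac.symm⟩
    · exact ⟨b, hb, hbd, h, hab.symm⟩
  obtain ⟨K, hK, k, hk⟩ := hG l hl
  -- M sits in a conjugate of K
  let M' : Subgroup G := M.map H.subtype
  have hM' : IsPGroup p M' := hMp.map _
  obtain ⟨S⟩ : Nonempty (Sylow p K) := inferInstance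
  have hS' : IsPGroup p ((S : Subgroup K).map K.subtype) := S.isPGroup'.map _
  have hSidx : ¬ p ∣ ((S : Subgroup K).map K.subtype).index := by
    rw [Subgroup.index_map_subtype]
    intro h
    rcases hp.dvd_mul.1 h with h | h
    · exact S.not_dvd_index h
    · rw [hk] at h
      exact hlp ((Nat.prime_dvd_prime_iff_eq hp hl).1 (hp.dvd_of_dvd_pow h)).symm
  let S' : Sylow p G := hS'.toSylow hSidx
  have hS'K : (S' : Subgroup G) ≤ K := by
    rintro _ ⟨x, -, rfl⟩
    exact x.2
  obtain ⟨T, hT⟩ := hM'.exists_le_sylow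
  obtain ⟨g, hg⟩ := MulAction.exists_smul_eq G S' T
  let K' : Subgroup G := K.map (MulAut.conj g).toMonoidHom
  have hMK : M' ≤ K' := by
    intro x hx
    have h1 := hT hx
    rw [← hg] at h1
    obtain ⟨y, hy, rfl⟩ := h1
    exact ⟨y, hS'K hy, rfl⟩
  have hK'idx : K'.index = l ^ k := by
    rw [← hk]
    exact Subgroup.index_map_equiv K (MulAut.conj g)
  have hK'card : ¬ l ∣ Nat.card K' := by
    rw [Subgroup.card_map_of_injective (MulAut.conj g).injective]
    exact hK
  have hK's := hsolv l hl hld K' hK'card ⟨k, hK'idx⟩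
  let N := Subgroup.normalClosure (M' : Set G)
  have hNK : N ≤ K' := by
    refine (Subgroup.closure_le _).2 ?_
    intro y hy
    obtain ⟨m, hm, hmy⟩ := Group.mem_conjugatesOfSet_iff.1 hy
    obtain ⟨x, rfl⟩ := isConj_iff.1 hmy
    obtain ⟨u, hu, v, hv, rfl⟩ := (bs_coprime_relIndex K' H (by
      rw [hK'idx, hka]
      exact Nat.Coprime.pow _ _ ((Nat.coprime_primes hl ha).2 hla))).2 x
    obtain ⟨w, hw, rfl⟩ := hm
    have h1 : (v * (w : G) * v⁻¹) ∈ M' := by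
      exact ⟨⟨v, hv⟩ * w * ⟨v, hv⟩⁻¹, hMn.conj_mem w hw _, rfl⟩
    have h2 : u * v * (w : G) * (u * v)⁻¹ = u * (v * (w : G) * v⁻¹) * u⁻¹ := by group
    show u * v * (w : G) * (u * v)⁻¹ ∈ K'
    rw [h2]
    exact K'.mul_mem (K'.mul_mem hu (hMK h1)) (K'.inv_mem hu)
  have hNs : Group.IsSolvable N := Group.isSolvable_of_isSolvable_injective (Subgroup.inclusion_injective hNK)
  have hNn : N.Normal := Subgroup.normalClosure_normal
  have hNb : N ≠ ⊥ := by
    intro h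
    apply hMb
    rw [eq_bot_iff]
    intro x hx
    have h1 : (x : G) ∈ N := Subgroup.subset_normalClosure ⟨x, hx, rfl⟩
    rw [h, Subgroup.mem_bot] at h1
    exact Subgroup.mem_bot.2 (Subtype.ext h1)
  have hQ : Group.IsSolvable (G ⧸ N) := by
    refine ih (Nat.card (G ⧸ N)) ?_ (G ⧸ N) rfl (hG.quot N)
    show N.index < n
    have hmul := N.card_mul_index
    have hcN : Nat.card N ≠ 1 := fun h => hNb (Subgroup.card_eq_one.1 h)
    have hc0 : 0 < Nat.card N := Nat.card_pos
    have hi0 : 0 < N.index := Nat.pos_of_ne_zero N.index_ne_zero_of_finite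
    rw [← hn, ← hmul]; nlinarith [show 2 ≤ Nat.card N by omega]
  exact Group.isSolvable_of_ker_le_range N.subtype (QuotientGroup.mk' N) (by simp)

theorem bs_primepow_index : ∀ (n : ℕ) (G : Type u) [Group G] [Finite G] [Group.IsSolvable G],
    Nat.card G = n → ∀ H : Subgroup G, H ≠ ⊤ → ∃ L : Subgroup G, H ≤ L ∧ L ≠ ⊤ ∧
      ∃ p k : ℕ, p.Prime ∧ L.index = p ^ k := by
  intro n
  induction n using Nat.strong_induction_on with
  | _ n ih =>
  intro G _ _ _ hn H hH
  have hnt : Nontrivial G := by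
    by_contra h
    rw [not_nontrivial_iff_subsingleton] at h
    exact hH (Subsingleton.elim _ _)
  obtain ⟨p, hp, N, hN, hNb, hNp⟩ := bs_normal_p G
  have : Fact p.Prime := ⟨hp⟩
  by_cases hHN : H ⊔ N = ⊤
  · refine ⟨H, le_rfl, hH, ?_⟩
    obtain ⟨k, hk⟩ := IsPGroup.iff_card.1 hNp
    have h1 : H.index ∣ p ^ k := by
      rw [← hk]
      have h2 : H.relIndex N = H.index := by
        have h3 := Subgroup.relIndex_sup_right (K := N) (H := H)
        have h4 : N.relIndex H * H.index = H.relIndex N * N.index := by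
          rw [← Subgroup.inf_relIndex_right, Subgroup.relIndex_mul_index inf_le_right,
            ← Subgroup.inf_relIndex_right H N, Subgroup.relIndex_mul_index inf_le_right, inf_comm]
        rw [hHN, Subgroup.relIndex_top_right] at h3
        rw [← h3, mul_comm] at h4
        exact (Nat.eq_of_mul_eq_mul_right (Nat.pos_of_ne_zero N.index_ne_zero_of_finite) h4).symm
      rw [← h2]
      exact Subgroup.relIndex_dvd_card H N
    obtain ⟨j, -, hj⟩ := (Nat.dvd_prime_pow hp).1 h1
    exact ⟨p, j, hp, hj⟩
  · have hlt : Nat.card (G ⧸ N) < n := by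
      show N.index < n
      have hmul := N.card_mul_index
      have hcN : Nat.card N ≠ 1 := fun h => hNb (Subgroup.card_eq_one.1 h)
      have hc0 : 0 < Nat.card N := Nat.card_pos
      have hi0 : 0 < N.index := Nat.pos_of_ne_zero N.index_ne_zero_of_finite
      rw [← hn, ← hmul]; nlinarith [show 2 ≤ Nat.card N by omega]
    have hcm : (H.map (QuotientGroup.mk' N)).comap (QuotientGroup.mk' N) = H ⊔ N := by
      rw [Subgroup.comap_map_eq, QuotientGroup.ker_mk']
    obtain ⟨L, hL, hLt, q, k, hq, hk⟩ := ih _ hlt (G ⧸ N) rfl (H.map (QuotientGroup.mk' N)) (by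
      intro h
      rw [h, Subgroup.comap_top] at hcm
      exact hHN hcm.symm)
    refine ⟨L.comap (QuotientGroup.mk' N), Subgroup.map_le_iff_le_comap.1 hL, ?_, q, k, hq, ?_⟩
    · intro h
      apply hLt
      have := Subgroup.map_comap_eq_self_of_surjective (QuotientGroup.mk'_surjective N) L
      rw [← this, h, Subgroup.map_top_of_surjective _ (QuotientGroup.mk'_surjective N)]
    · rw [Subgroup.index_comap_of_surjective _ (QuotientGroup.mk'_surjective N), hk]


theorem rp_not_dvd_of_killed {A : Type u} [Group A] [Finite A] (l m : ℕ) (hl : l.Prime) (hm : ¬ l ∣ m)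
    (h : ∀ a : A, a ^ m = 1) : ¬ l ∣ Nat.card A := by
  intro hd
  have : Fact l.Prime := ⟨hl⟩
  obtain ⟨x, hx⟩ := exists_prime_orderOf_dvd_card' l hd
  exact hm (hx ▸ orderOf_dvd_of_pow_eq_one (h x))

theorem rp_split {A : Type u} [CommGroup A] [Finite A] (l : ℕ) (hl : l.Prime) :
    ∃ e m : ℕ, Nat.card A = l ^ e * m ∧ ¬ l ∣ m ∧
      Nat.card (powMonoidHom m : A →* A).range = l ^ e ∧
      Nat.card (powMonoidHom (l ^ e) : A →* A).range = m := by
  have : Fact l.Prime := ⟨hl⟩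
  obtain ⟨e, m, hm, hc⟩ := Nat.exists_eq_pow_mul_and_not_dvd (n := Nat.card A) Nat.card_pos.ne' l hl.ne_one
  have hk : ∀ a : A, a ^ (l ^ e * m) = 1 := fun a => by rw [← hc]; exact pow_card_eq_one'
  have e1 : ∀ k : ℕ, Nat.card (powMonoidHom k : A →* A).ker * Nat.card (powMonoidHom k : A →* A).range = l ^ e * m := by
    intro k
    rw [← hc, ← Subgroup.index_ker, Subgroup.card_mul_index]
  have hpg : ∀ (B : Subgroup A), (∀ b : B, b ^ (l ^ e) = 1) → ∃ j, Nat.card B = l ^ j := by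
    intro B hB
    exact IsPGroup.iff_card.1 fun b => ⟨e, hB b⟩
  have cop : ∀ c : ℕ, ¬ l ∣ c → ∀ j, Nat.Coprime c (l ^ j) := fun c h j =>
    Nat.Coprime.pow_right _ ((Nat.Prime.coprime_iff_not_dvd hl).2 h).symm
  have fin : ∀ c j : ℕ, ¬ l ∣ c → c * l ^ j = l ^ e * m → c = m ∧ l ^ j = l ^ e := by
    intro c j h1 h2
    have d1 : c ∣ m := (cop c h1 e).dvd_of_dvd_mul_left (h2 ▸ dvd_mul_right _ _)
    have d2 : m ∣ c := (cop m hm j).dvd_of_dvd_mul_right (h2 ▸ dvd_mul_left _ _)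
    have h3 := Nat.dvd_antisymm d1 d2
    subst h3
    refine ⟨rfl, ?_⟩
    rw [mul_comm] at h2
    exact Nat.eq_of_mul_eq_mul_right (Nat.pos_of_ne_zero (by rintro rfl; exact h1 (dvd_zero _))) h2
  refine ⟨e, m, hc, hm, ?_, ?_⟩
  · obtain ⟨j, hj⟩ := hpg (powMonoidHom m : A →* A).range (by
      rintro ⟨_, a, rfl⟩
      apply Subtype.ext
      show (a ^ m) ^ (l ^ e) = 1
      rw [← pow_mul, mul_comm, hk])
    have hker := rp_not_dvd_of_killed (A := (powMonoidHom m : A →* A).ker) l m hl hm (by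
      rintro ⟨a, ha⟩
      apply Subtype.ext
      exact ha)
    rw [hj]
    exact (fin _ j hker (hj ▸ e1 m)).2
  · obtain ⟨j, hj⟩ := hpg (powMonoidHom (l ^ e) : A →* A).ker (by
      rintro ⟨a, ha⟩
      apply Subtype.ext
      exact ha)
    have hr := rp_not_dvd_of_killed (A := (powMonoidHom (l ^ e) : A →* A).range) l m hl hm (by
      rintro ⟨_, a, rfl⟩
      apply Subtype.ext
      show (a ^ (l ^ e)) ^ m = 1
      rw [← pow_mul, hk])
    have := e1 (l ^ e)
    rw [hj, mul_comm] at this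
    exact (fin _ j hr this).1

section
variable {G : Type u} [Group G] {X : Type v} [MulAction G X]

/-- the step permutation -/
def rpStep (s : X → G) (h1 : ∀ x, s x • x = x) (y : X) : Equiv.Perm G where
  toFun g := g * s (g⁻¹ • y)
  invFun g := g * (s (g⁻¹ • y))⁻¹
  left_inv g := by
    have : (g * s (g⁻¹ • y))⁻¹ • y = g⁻¹ • y := by
      rw [mul_inv_rev, mul_smul, inv_smul_eq_iff, h1]
    show (g * s (g⁻¹ • y)) * (s ((g * s (g⁻¹ • y))⁻¹ • y))⁻¹ = g
    rw [this, mul_inv_cancel_right]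
  right_inv g := by
    have : (g * (s (g⁻¹ • y))⁻¹)⁻¹ • y = g⁻¹ • y := by
      rw [mul_inv_rev, mul_smul, inv_inv, h1]
    show (g * (s (g⁻¹ • y))⁻¹) * (s ((g * (s (g⁻¹ • y))⁻¹)⁻¹ • y)) = g
    rw [this, inv_mul_cancel_right]

theorem rpStep_pow (s : X → G) (h1 : ∀ x, s x • x = x) (y : X) (k : ℕ) (g : G) :
    (rpStep s h1 y ^ k) g = g * s (g⁻¹ • y) ^ k := by
  induction k generalizing g with
  | zero => simp
  | succ k ih =>
    have : (g * s (g⁻¹ • y))⁻¹ • y = g⁻¹ • y := by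
      rw [mul_inv_rev, mul_smul, inv_smul_eq_iff, h1]
    rw [pow_succ, Equiv.Perm.mul_apply]
    show (rpStep s h1 y ^ k) (g * s (g⁻¹ • y)) = _
    rw [ih, this, pow_succ', mul_assoc]

theorem rpStep_comm (s : X → G) (h1 : ∀ x, s x • x = x)
    (h2 : ∀ x y, s x * s ((s x)⁻¹ • y) = s y * s ((s y)⁻¹ • x)) (x y : X) :
    rpStep s h1 x * rpStep s h1 y = rpStep s h1 y * rpStep s h1 x := by
  ext g
  show (g * s (g⁻¹ • y)) * s ((g * s (g⁻¹ • y))⁻¹ • x) = (g * s (g⁻¹ • x)) * s ((g * s (g⁻¹ • x))⁻¹ • y)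
  rw [mul_inv_rev, mul_inv_rev, mul_smul, mul_smul, mul_assoc, mul_assoc, h2]

theorem rpStep_conj (s : X → G) (h1 : ∀ x, s x • x = x) (h : G) (y : X) :
    Equiv.mulLeft h * rpStep s h1 y * (Equiv.mulLeft h)⁻¹ = rpStep s h1 (h • y) := by
  rw [mul_inv_eq_iff_eq_mul]
  ext g
  show h * (g * s (g⁻¹ • y)) = (h * g) * s ((h * g)⁻¹ • (h • y))
  rw [mul_inv_rev, mul_smul, inv_smul_smul, mul_assoc]

theorem rump_transitive [Finite G] (s : X → G) (h1 : ∀ x, s x • x = x)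
    (h2 : ∀ x y, s x * s ((s x)⁻¹ • y) = s y * s ((s y)⁻¹ • x))
    (hgen : Subgroup.closure (Set.range s) = ⊤)
    (htr : ∀ x y : X, ∃ g : G, g • x = y) : Subsingleton X := by
  classical
  let A := Subgroup.closure (Set.range (rpStep s h1))
  let _ : CommGroup A := Subgroup.closureCommGroupOfComm (by
    rintro _ ⟨x, rfl⟩ _ ⟨y, rfl⟩
    exact rpStep_comm s h1 h2 x y)
  have hstep : ∀ y, rpStep s h1 y ∈ A := fun y => Subgroup.subset_closure ⟨y, rfl⟩
  let ev : A → G := fun t => t.1 1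
  have hsurj : Function.Surjective ev := by
    intro g
    have hg : g ∈ Subgroup.closure (Set.range s) := by rw [hgen]; trivial
    induction hg using Subgroup.closure_induction_right with
    | one => exact ⟨1, rfl⟩
    | mul_right g _ y hy ih =>
      obtain ⟨x, rfl⟩ := hy
      obtain ⟨t, ht⟩ := ih
      refine ⟨⟨_, hstep (g • x)⟩ * t, ?_⟩
      show rpStep s h1 (g • x) (t.1 1) = _
      rw [show t.1 1 = g from ht]
      show g * s (g⁻¹ • g • x) = _
      rw [inv_smul_smul]
    | mul_inv_cancel g _ y hy ih =>
      obtain ⟨x, rfl⟩ := hy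
      obtain ⟨t, ht⟩ := ih
      refine ⟨⟨_, hstep (g • x)⟩⁻¹ * t, ?_⟩
      show (rpStep s h1 (g • x))⁻¹ (t.1 1) = _
      rw [show t.1 1 = g from ht]
      show g * (s (g⁻¹ • g • x))⁻¹ = _
      rw [inv_smul_smul]
  have hinj : Function.Injective ev := by
    intro t t' h
    apply Subtype.ext
    ext g
    obtain ⟨w, rfl⟩ := hsurj g
    have c1 : (t * w).1 1 = (w * t).1 1 := by rw [mul_comm]
    have c2 : (t' * w).1 1 = (w * t').1 1 := by rw [mul_comm]
    show (t * w).1 1 = (t' * w).1 1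
    rw [c1, c2]
    exact congrArg w.1 h
  have hcard : Nat.card A = Nat.card G := Nat.card_congr (Equiv.ofBijective ev ⟨hinj, hsurj⟩)
  have hconj : ∀ (h : G) (t : A), ∃ t' : A, t'.1 = Equiv.mulLeft h * t.1 * (Equiv.mulLeft h)⁻¹ := by
    intro h ⟨t, ht⟩
    suffices H : Equiv.mulLeft h * t * (Equiv.mulLeft h)⁻¹ ∈ A from ⟨⟨_, H⟩, rfl⟩
    induction ht using Subgroup.closure_induction with
    | mem t ht =>
      obtain ⟨y, rfl⟩ := ht
      rw [rpStep_conj]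
      exact hstep _
    | one => rw [mul_one, mul_inv_cancel]; exact A.one_mem
    | mul a b _ _ ha hb =>
      have := A.mul_mem ha hb
      convert this using 1
      group
    | inv a _ ha =>
      have := A.inv_mem ha
      convert this using 1
      group
  have hconjk : ∀ (h : G) (t : A) (k : ℕ), ∃ t' : A, ∀ g, (t' ^ k).1 g = h * (t ^ k).1 (h⁻¹ * g) := by
    intro h t k
    obtain ⟨t', ht'⟩ := hconj h t
    refine ⟨t', fun g => ?_⟩
    have : (t' ^ k).1 = Equiv.mulLeft h * (t ^ k).1 * (Equiv.mulLeft h)⁻¹ := by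
      show t'.1 ^ k = Equiv.mulLeft h * t.1 ^ k * (Equiv.mulLeft h)⁻¹
      rw [ht', conj_pow]
    rw [this]
    rfl
  let U : ℕ → Subgroup G := fun k =>
    { carrier := {g | ∃ t : A, g = (t ^ k).1 1}
      one_mem' := ⟨1, by rw [one_pow]; rfl⟩
      mul_mem' := by
        rintro a b ⟨t, rfl⟩ ⟨t', rfl⟩
        obtain ⟨t'', h⟩ := hconjk ((t ^ k).1 1) t' k
        refine ⟨t'' * t, ?_⟩
        rw [mul_pow]
        show _ = (t'' ^ k).1 ((t ^ k).1 1)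
        rw [h, inv_mul_cancel]
      inv_mem' := by
        rintro a ⟨t, rfl⟩
        obtain ⟨t'', h⟩ := hconjk ((t ^ k).1 1)⁻¹ t⁻¹ k
        refine ⟨t'', ?_⟩
        rw [h, inv_inv, mul_one]
        have : (t⁻¹ ^ k).1 ((t ^ k).1 1) = 1 := by
          show (t⁻¹ ^ k * t ^ k).1 1 = 1
          rw [← mul_pow, inv_mul_cancel, one_pow]; rfl
        rw [this, mul_one] }
  have hUcard : ∀ k, Nat.card (U k) = Nat.card (powMonoidHom k : A →* A).range := by
    intro k
    symm
    refine Nat.card_congr (Equiv.ofBijective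
      (fun t => (⟨ev t.1, by obtain ⟨t, a, rfl⟩ := t; exact ⟨a, rfl⟩⟩ : U k)) ⟨?_, ?_⟩)
    · intro a b hab
      exact Subtype.ext (hinj (congrArg Subtype.val hab))
    · rintro ⟨_, t, rfl⟩
      exact ⟨⟨t ^ k, t, rfl⟩, rfl⟩
  have hUle : ∀ k, U k = Subgroup.closure (Set.range fun x => s x ^ k) := by
    intro k
    apply le_antisymm
    · set K := Subgroup.closure (Set.range fun x => s x ^ k)
      have key : ∀ t (ht : t ∈ A), ∀ g, g⁻¹ * ((⟨t, ht⟩ : A) ^ k).1 g ∈ K := by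
        intro t ht
        induction ht using Subgroup.closure_induction with
        | mem t ht =>
          obtain ⟨y, rfl⟩ := ht
          intro g
          show g⁻¹ * (rpStep s h1 y ^ k) g ∈ K
          rw [rpStep_pow, inv_mul_cancel_left]
          exact Subgroup.subset_closure ⟨_, rfl⟩
        | one =>
          intro g
          have : ((⟨1, A.one_mem⟩ : A) ^ k).1 g = g := by
            show (1 ^ k : Equiv.Perm G) g = g
            rw [one_pow]; rfl
          rw [this, inv_mul_cancel]; exact K.one_mem
        | mul a b ha' hb' ha hb =>
          intro g
          have : ((⟨a * b, A.mul_mem ha' hb'⟩ : A) ^ k).1 g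
              = ((⟨a, ha'⟩ : A) ^ k).1 (((⟨b, hb'⟩ : A) ^ k).1 g) := by
            have : (⟨a * b, A.mul_mem ha' hb'⟩ : A) = ⟨a, ha'⟩ * ⟨b, hb'⟩ := rfl
            rw [this, mul_pow]; rfl
          rw [this]
          have := K.mul_mem (hb g) (ha (((⟨b, hb'⟩ : A) ^ k).1 g))
          convert this using 1
          group
        | inv a ha' ha =>
          intro g
          have e : ((⟨a, ha'⟩ : A) ^ k).1 (((⟨a⁻¹, A.inv_mem ha'⟩ : A) ^ k).1 g) = g := by
            have : (⟨a⁻¹, A.inv_mem ha'⟩ : A) = (⟨a, ha'⟩)⁻¹ := rfl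
            show (((⟨a, ha'⟩ : A) ^ k) * ((⟨a⁻¹, A.inv_mem ha'⟩ : A) ^ k)).1 g = g
            rw [this, ← mul_pow, mul_inv_cancel, one_pow]; rfl
          have := K.inv_mem (ha (((⟨a⁻¹, A.inv_mem ha'⟩ : A) ^ k).1 g))
          rw [e] at this
          convert this using 1
          group
      rintro _ ⟨t, rfl⟩
      have := key t.1 t.2 1
      rwa [inv_one, one_mul] at this
    · rw [Subgroup.closure_le]
      rintro _ ⟨x, rfl⟩
      refine ⟨⟨_, hstep x⟩, ?_⟩
      show s x ^ k = (rpStep s h1 x ^ k) 1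
      rw [rpStep_pow, inv_one, one_smul, one_mul]
  -- solvability
  have hHall : bsHall G := by
    intro l hl
    obtain ⟨e, m, hc, hm, h3, h4⟩ := rp_split (A := A) l hl
    refine ⟨U (l ^ e), ?_, e, ?_⟩
    · rw [hUcard, h4]; exact hm
    · have := (U (l ^ e)).card_mul_index
      rw [hUcard, h4, ← hcard, hc, mul_comm] at this
      exact Nat.eq_of_mul_eq_mul_right (Nat.pos_of_ne_zero (by rintro rfl; exact hm (dvd_zero _))) this
  have hsol : Group.IsSolvable G := bs_hall _ G rfl hHall
  by_contra hsub
  rw [not_subsingleton_iff_nontrivial] at hsub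
  obtain ⟨x, y, hxy⟩ := exists_pair_ne X
  obtain ⟨L, hLx, hLt, l, k, hl, hLi⟩ := bs_primepow_index _ G rfl (MulAction.stabilizer G x) (by
    intro h
    obtain ⟨g, hg⟩ := htr x y
    have : g ∈ MulAction.stabilizer G x := by rw [h]; trivial
    exact hxy ((MulAction.mem_stabilizer_iff.1 this).symm.trans hg))
  have : Fact l.Prime := ⟨hl⟩
  obtain ⟨e, m, hc, hm, h3, h4⟩ := rp_split (A := A) l hl
  have hKc : Nat.card (U m) = l ^ e := by rw [hUcard, h3]
  have hKp : IsPGroup l (U m) := IsPGroup.iff_card.2 ⟨e, hKc⟩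
  have hKi : (U m).index = m := by
    have := (U m).card_mul_index
    rw [hKc, ← hcard, hc] at this
    exact Nat.eq_of_mul_eq_mul_left (pow_pos hl.pos _) this
  have hprod := (bs_coprime_relIndex (U m) L (by
    rw [hKi, hLi]
    exact Nat.Coprime.pow_right _ ((Nat.Prime.coprime_iff_not_dvd hl).2 hm).symm)).2
  have hne : L.subgroupOf (U m) ≠ ⊤ := by
    rw [Ne, Subgroup.subgroupOf_eq_top]
    intro h
    apply hLt
    rw [eq_top_iff]
    intro g _
    obtain ⟨a, ha, b, hb, rfl⟩ := hprod g
    exact L.mul_mem (h ha) hb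
  obtain ⟨M, hM, hLM⟩ := (eq_top_or_exists_le_coatom (L.subgroupOf (U m))).resolve_left hne
  have hnil : Group.IsNilpotent (U m) := hKp.isNilpotent
  have hMn : M.Normal := Subgroup.NormalizerCondition.normal_of_coatom M
    Group.normalizerCondition_of_isNilpotent hM
  have hle : U m ≤ M.map (U m).subtype := by
    conv_lhs => rw [hUle]
    rw [Subgroup.closure_le]
    rintro _ ⟨z, rfl⟩
    obtain ⟨g, rfl⟩ := htr x z
    obtain ⟨a, ha, b, hb, rfl⟩ := hprod g
    have hz : s ((a * b) • x) ^ m ∈ U m := by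
      rw [hUle]; exact Subgroup.subset_closure ⟨_, rfl⟩
    have hst : (a * b)⁻¹ * s ((a * b) • x) ^ m * (a * b) ∈ L := by
      apply hLx
      have h5 : s ((a * b) • x) ^ m ∈ MulAction.stabilizer G ((a * b) • x) :=
        Subgroup.pow_mem _ (h1 _) m
      rw [MulAction.mem_stabilizer_iff] at h5 ⊢
      rw [mul_smul, mul_smul, h5, inv_smul_smul]
    have hst2 : a⁻¹ * s ((a * b) • x) ^ m * a ∈ L := by
      have := L.mul_mem (L.mul_mem hb hst) (L.inv_mem hb)
      convert this using 1
      group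
    have hin : (⟨a, ha⟩⁻¹ * ⟨_, hz⟩ * ⟨a, ha⟩ : U m) ∈ M := hLM hst2
    have := hMn.conj_mem _ hin ⟨a, ha⟩
    refine ⟨_, this, ?_⟩
    show a * (a⁻¹ * s ((a * b) • x) ^ m * a) * a⁻¹ = _
    group
  apply hM.1
  rw [eq_top_iff]
  intro w _
  obtain ⟨w', hw', h⟩ := hle w.2
  have : w' = w := Subtype.ext h
  exact this ▸ hw'
end


theorem yb_apply_inv {X : Type*} (f : Equiv.Perm X) (x : X) : f (f⁻¹ x) = x :=
  Equiv.apply_symm_apply f x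

theorem yb_inv_apply {X : Type*} (f : Equiv.Perm X) (x : X) : f⁻¹ (f x) = x :=
  Equiv.symm_apply_apply f x

theorem yb_split {X : Type*} [Finite X] (σ : X → Equiv.Perm X) (h1 : ∀ x, σ x x = x)
    (h2 : ∀ x y, σ x * σ ((σ x)⁻¹ y) = σ y * σ ((σ y)⁻¹ x)) (S : Finset X)
    (hS : ∀ s ∈ S, ∀ x, σ s x ∈ S ↔ x ∈ S) (hcard : 1 < S.card) :
    ∃ Y : Finset X, Y ⊂ S ∧ Y.Nonempty ∧ ∀ s ∈ S, ∀ x, σ s x ∈ Y ↔ x ∈ Y := by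
  classical
  let σ' : S → Equiv.Perm S := fun s => (σ s).subtypePerm (p := fun x => x ∈ S) (fun x => hS s s.2 x)
  let G := Subgroup.closure (Set.range σ')
  let s : S → G := fun x => ⟨σ' x, Subgroup.subset_closure ⟨x, rfl⟩⟩
  have hinvS : ∀ t ∈ S, ∀ x, (σ t)⁻¹ x ∈ S ↔ x ∈ S := by
    intro t ht x
    have := hS t ht ((σ t)⁻¹ x)
    rwa [yb_apply_inv, iff_comm] at this
  have hinv' : ∀ x y : S, ((σ' x)⁻¹ y : S) = ⟨(σ x)⁻¹ y, (hinvS x x.2 y).2 y.2⟩ := by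
    intro x y
    rw [Equiv.Perm.inv_eq_iff_eq]
    apply Subtype.ext
    show (y : X) = σ x ((σ x)⁻¹ y)
    rw [yb_apply_inv]
  by_cases htr : ∀ x y : S, ∃ g : G, g • x = y
  · exfalso
    have := rump_transitive s (fun x => Subtype.ext (h1 x)) (fun x y => by
      apply Subtype.ext
      show σ' x * σ' ((σ' x)⁻¹ y) = σ' y * σ' ((σ' y)⁻¹ x)
      rw [hinv', hinv']
      ext z
      exact congrArg (fun f : Equiv.Perm X => f z) (h2 x y)) (by
      have := Subgroup.closure_closure_coe_preimage (k := Set.range σ')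
      rw [← this]
      congr 1
      ext z
      constructor
      · rintro ⟨x, rfl⟩; exact ⟨x, rfl⟩
      · rintro ⟨x, hx⟩; exact ⟨x, Subtype.ext hx⟩) htr
    rw [Finset.one_lt_card_iff_nontrivial] at hcard
    obtain ⟨a, ha, b, hb, hab⟩ := hcard
    exact hab (congrArg Subtype.val (Subsingleton.elim (⟨a, ha⟩ : S) ⟨b, hb⟩))
  · push Not at htr
    obtain ⟨x, y, hxy⟩ := htr
    have hmem : ∀ z, z ∈ S.filter (fun z => ∃ g : G, ((g • x : S) : X) = z) ↔
        ∃ g : G, ((g • x : S) : X) = z := by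
      intro z
      rw [Finset.mem_filter]
      refine ⟨fun h => h.2, fun h => ⟨?_, h⟩⟩
      obtain ⟨g, rfl⟩ := h
      exact (g • x).2
    refine ⟨S.filter (fun z => ∃ g : G, ((g • x : S) : X) = z), ?_, ⟨x, (hmem _).2 ⟨1, by rw [one_smul]⟩⟩, ?_⟩
    · rw [Finset.ssubset_iff_of_subset (Finset.filter_subset _ _)]
      refine ⟨y, y.2, fun h => ?_⟩
      obtain ⟨g, hg⟩ := (hmem _).1 h
      exact hxy g (Subtype.ext hg)
    · intro t ht z
      rw [hmem, hmem]
      constructor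
      · rintro ⟨g, hg⟩
        refine ⟨(s ⟨t, ht⟩)⁻¹ * g, ?_⟩
        rw [mul_smul]
        show ((σ' ⟨t, ht⟩)⁻¹ (g • x) : S).1 = z
        rw [hinv']
        show (σ t)⁻¹ _ = z
        rw [hg, yb_inv_apply]
      · rintro ⟨g, hg⟩
        refine ⟨s ⟨t, ht⟩ * g, ?_⟩
        rw [mul_smul]
        show σ t (g • x : S).1 = _
        rw [hg]

section
variable {X : Type*} [Finite X] {G : Type*} [Group G]

theorem yb_list (σ : X → Equiv.Perm X) (h1 : ∀ x, σ x x = x)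
    (h2 : ∀ x y, σ x * σ ((σ x)⁻¹ y) = σ y * σ ((σ y)⁻¹ x))
    (ι : X → G) (hι : ∀ x y, ι x * ι y = ι (σ x y) * ι ((σ (σ x y))⁻¹ x))
    (N : Subgroup G) (hN : N.Normal) (p : ℕ) (hp : 0 < p) (hpN : ∀ x, ι x ^ p ∈ N)
    (lam : G →* Equiv.Perm X) (hlam : ∀ x, lam (ι x) = σ x)
    (c : G → X → ZMod p) (hc : ∀ g h z, c (g * h) z = c g z + c h ((lam g)⁻¹ z))
    (hc1 : ∀ x, c (ι x) x = 1) (hc0 : ∀ x z, z ≠ x → c (ι x) z = 0) :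
    ∀ (n : ℕ) (S : Finset X), S.card = n → (∀ s ∈ S, ∀ x, σ s x ∈ S ↔ x ∈ S) →
    ∃ l : List X, l.Nodup ∧ (∀ x, x ∈ l ↔ x ∈ S) ∧
      (∀ g ∈ Subgroup.closure (ι '' S), ∃ a : X → ℕ, (∀ x, a x < p) ∧ ∃ W ∈ N,
        g = (l.map fun x => ι x ^ a x).prod * W) ∧
      (∀ a b : X → ℕ, (∀ x, a x < p) → (∀ x, b x < p) →
        c (l.map fun x => ι x ^ a x).prod = c (l.map fun x => ι x ^ b x).prod →
        ∀ x ∈ S, a x = b x) := by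
  classical
  have c1 : ∀ z, c 1 z = 0 := by
    intro z
    have := hc 1 1 z
    rw [map_one, inv_one, mul_one, Equiv.Perm.one_apply] at this
    exact left_eq_add.1 this
  have cinv : ∀ g z, c g⁻¹ z = - c g (lam g z) := by
    intro g z
    have := hc g g⁻¹ (lam g z)
    rw [mul_inv_cancel, c1, yb_inv_apply] at this
    exact (neg_eq_of_add_eq_zero_right this.symm).symm
  -- closure elements preserve invariant subsets
  have hpres : ∀ S Y : Finset X, (∀ s ∈ S, ∀ x, σ s x ∈ Y ↔ x ∈ Y) →
      ∀ g ∈ Subgroup.closure (ι '' S), ∀ x, lam g x ∈ Y ↔ x ∈ Y := by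
    intro S Y hY g hg
    induction hg using Subgroup.closure_induction with
    | mem g hg =>
      obtain ⟨s, hs, rfl⟩ := hg
      rw [hlam]
      exact hY s hs
    | one => intro x; rw [map_one]; rfl
    | mul a b _ _ ha hb => intro x; rw [map_mul, Equiv.Perm.mul_apply, ha, hb]
    | inv a _ ha =>
      intro x
      rw [← ha, map_inv, yb_apply_inv]
  have hsupp : ∀ S : Finset X, (∀ s ∈ S, ∀ x, σ s x ∈ S ↔ x ∈ S) →
      ∀ g ∈ Subgroup.closure (ι '' S), ∀ z, z ∉ S → c g z = 0 := by
    intro S hS g hg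
    induction hg using Subgroup.closure_induction with
    | mem g hg =>
      obtain ⟨s, hs, rfl⟩ := hg
      intro z hz
      refine hc0 s z ?_
      rintro rfl
      exact hz hs
    | one => intro z _; exact c1 z
    | mul a b ha' hb' ha hb =>
      intro z hz
      rw [hc, ha z hz, hb, add_zero]
      intro h
      rw [← hpres S S hS a ha', yb_apply_inv] at h
      exact hz h
    | inv a ha' ha =>
      intro z hz
      rw [cinv, ha, neg_zero]
      rwa [hpres S S hS a ha']
  have hprodmem : ∀ (S : Finset X) (l : List X), (∀ x, x ∈ l ↔ x ∈ S) → ∀ a : X → ℕ,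
      (l.map fun x => ι x ^ a x).prod ∈ Subgroup.closure (ι '' S) := by
    intro S l hl a
    apply Subgroup.list_prod_mem
    intro g hg
    obtain ⟨x, hx, rfl⟩ := List.mem_map.1 hg
    exact Subgroup.pow_mem _ (Subgroup.subset_closure
      (Set.mem_image_of_mem ι (Finset.mem_coe.2 ((hl x).1 hx)))) _
  intro n
  induction n using Nat.strong_induction_on with
  | _ n ih =>
  intro S hn hS
  rcases Nat.lt_trichotomy S.card 1 with hlt | heq | hgt
  · have : S = ∅ := Finset.card_eq_zero.1 (by omega)
    subst this
    refine ⟨[], List.nodup_nil, by simp, ?_, by simp⟩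
    intro g hg
    simp only [Finset.coe_empty, Set.image_empty, Subgroup.closure_empty, Subgroup.mem_bot] at hg
    exact ⟨fun _ => 0, fun _ => hp, 1, N.one_mem, by simp [hg]⟩
  · obtain ⟨x, rfl⟩ := Finset.card_eq_one.1 heq
    refine ⟨[x], List.nodup_singleton x, by simp, ?_, ?_⟩
    · intro g hg
      rw [Finset.coe_singleton, Set.image_singleton, Subgroup.mem_closure_singleton] at hg
      obtain ⟨k, rfl⟩ := hg
      have hpz : (p : ℤ) ≠ 0 := by exact_mod_cast hp.ne'
      have hk0 : 0 ≤ k % p := Int.emod_nonneg _ hpz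
      have hk1 : k % p < p := Int.emod_lt_of_pos _ (by exact_mod_cast hp)
      refine ⟨fun _ => (k % p).toNat, fun _ => by show (k % p).toNat < p; omega,
        (ι x ^ p) ^ (k / p), N.zpow_mem (hpN x) _, ?_⟩
      simp only [List.map_cons, List.map_nil, List.prod_cons, List.prod_nil, mul_one]
      rw [← zpow_natCast, ← zpow_natCast, ← zpow_mul, ← zpow_add, Int.toNat_of_nonneg hk0,
        Int.emod_add_mul_ediv]
    · intro a b ha hb hab z hz
      rw [Finset.mem_singleton] at hz
      subst hz
      have hpow : ∀ k : ℕ, c (ι z ^ k) z = k := by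
        intro k
        induction k with
        | zero => rw [pow_zero, c1, Nat.cast_zero]
        | succ k ihk =>
          rw [pow_succ', hc, hc1, hlam]
          have : (σ z)⁻¹ z = z := by rw [Equiv.Perm.inv_eq_iff_eq, h1]
          rw [this, ihk]
          push_cast; ring
      have := congrFun hab z
      simp only [List.map_cons, List.map_nil, List.prod_cons, List.prod_nil, mul_one, hpow] at this
      rw [ZMod.natCast_eq_natCast_iff', Nat.mod_eq_of_lt (ha z), Nat.mod_eq_of_lt (hb z)] at this
      exact this
  · obtain ⟨Y, hYS, hYne, hY⟩ := yb_split σ h1 h2 S hS hgt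
    let Z := S \ Y
    have hYsub := hYS.1
    have hZsub : Z ⊆ S := Finset.sdiff_subset
    have hZ : ∀ s ∈ S, ∀ x, σ s x ∈ Z ↔ x ∈ Z := by
      intro s hs x
      rw [Finset.mem_sdiff, Finset.mem_sdiff, hS s hs, hY s hs]
    have hYZ : ∀ x, x ∈ Y → x ∉ Z := fun x hx h => (Finset.mem_sdiff.1 h).2 hx
    obtain ⟨lY, hYnd, hYl, hYE, hYU⟩ := ih Y.card (hn ▸ Finset.card_lt_card hYS) Y rfl
      (fun s hs => hY s (hYsub hs))
    have hZc : Z.card < n := by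
      rw [← hn]
      refine Finset.card_lt_card ((Finset.ssubset_iff_of_subset hZsub).2 ?_)
      obtain ⟨y, hy⟩ := hYne
      exact ⟨y, hYsub hy, hYZ y hy⟩
    obtain ⟨lZ, hZnd, hZl, hZE, hZU⟩ := ih Z.card hZc Z rfl (fun s hs => hZ s (hZsub hs))
    refine ⟨lY ++ lZ, ?_, ?_, ?_, ?_⟩
    · refine List.Nodup.append hYnd hZnd fun x hx hx' => ?_
      exact hYZ x ((hYl x).1 hx) ((hZl x).1 hx')
    · intro x
      rw [List.mem_append, hYl, hZl, Finset.mem_sdiff]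
      constructor
      · rintro (h | h)
        · exact hYsub h
        · exact h.1
      · intro h
        by_cases hx : x ∈ Y
        · exact Or.inl hx
        · exact Or.inr ⟨h, hx⟩
    · -- existence
      set A := Subgroup.closure (ι '' Y)
      set B := Subgroup.closure (ι '' Z)
      have hinv : ∀ (U : Finset X), (∀ s ∈ S, ∀ x, σ s x ∈ U ↔ x ∈ U) → ∀ s ∈ S, ∀ x ∈ U, (σ s)⁻¹ x ∈ U := by
        intro U hU s hs x hx
        rw [← hU s hs, yb_apply_inv]; exact hx
      have hswap : ∀ b ∈ B, ∀ y ∈ Y, ∃ y' ∈ Y, ∃ b' ∈ B, b * ι y = ι y' * b' := by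
        intro b hb
        induction hb using Subgroup.closure_induction_left with
        | one => intro y hy; exact ⟨y, hy, 1, B.one_mem, by simp⟩
        | mul_left x hx b _ ihb =>
          obtain ⟨z, hz, rfl⟩ := hx
          intro y hy
          obtain ⟨y', hy', b', hb', e⟩ := ihb y hy
          have hzS := hZsub hz
          have hy2 : σ z y' ∈ Y := (hY z hzS y').2 hy'
          refine ⟨σ z y', hy2, ι ((σ (σ z y'))⁻¹ z) * b', B.mul_mem (Subgroup.subset_closure
            ⟨_, hinv Z hZ _ (hYsub hy2) z hz, rfl⟩) hb', ?_⟩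
          rw [mul_assoc, e, ← mul_assoc, hι, mul_assoc]
        | inv_mul_cancel x hx b _ ihb =>
          obtain ⟨z, hz, rfl⟩ := hx
          intro y hy
          obtain ⟨y', hy', b', hb', e⟩ := ihb y hy
          have hzS := hZsub hz
          refine ⟨(σ z)⁻¹ y', hinv Y hY z hzS y' hy', (ι ((σ y')⁻¹ z))⁻¹ * b', B.mul_mem (B.inv_mem
            (Subgroup.subset_closure ⟨_, hinv Z hZ _ (hYsub hy') z hz, rfl⟩)) hb', ?_⟩
          have h3 := hι z ((σ z)⁻¹ y')
          rw [yb_apply_inv] at h3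
          rw [mul_assoc, e, inv_mul_eq_iff_eq_mul, ← mul_assoc, ← mul_assoc, h3,
            mul_inv_cancel_right]
      let Q : G → Prop := fun g => ∃ a ∈ A, ∃ b ∈ B, ∃ W ∈ N, g = a * b * W
      have hQN : ∀ g, Q g → ∀ W ∈ N, Q (g * W) := by
        rintro _ ⟨a, ha, b, hb, W, hW, rfl⟩ W' hW'
        exact ⟨a, ha, b, hb, W * W', N.mul_mem hW hW', by rw [mul_assoc]⟩
      have hQs : ∀ g, Q g → ∀ x ∈ S, Q (g * ι x) := by
        rintro _ ⟨a, ha, b, hb, W, hW, rfl⟩ x hx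
        have hW' : (ι x)⁻¹ * W * ι x ∈ N := by
          have := hN.conj_mem W hW (ι x)⁻¹
          rwa [inv_inv] at this
        have : a * b * W * ι x = a * (b * ι x) * ((ι x)⁻¹ * W * ι x) := by group
        rw [this]
        by_cases hxY : x ∈ Y
        · obtain ⟨y', hy', b', hb', e⟩ := hswap b hb x hxY
          exact ⟨a * ι y', A.mul_mem ha (Subgroup.subset_closure ⟨y', hy', rfl⟩), b', hb', _, hW',
            by rw [e, ← mul_assoc a]⟩
        · exact ⟨a, ha, b * ι x, B.mul_mem hb (Subgroup.subset_closure
            ⟨x, Finset.mem_coe.2 (Finset.mem_sdiff.2 ⟨hx, hxY⟩), rfl⟩), _, hW', rfl⟩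
      have hQpow : ∀ k : ℕ, ∀ g, Q g → ∀ x ∈ S, Q (g * ι x ^ k) := by
        intro k
        induction k with
        | zero => intro g hg x _; rwa [pow_zero, mul_one]
        | succ k ihk =>
          intro g hg x hx
          rw [pow_succ, ← mul_assoc]
          exact hQs _ (ihk g hg x hx) x hx
      have hQall : ∀ g ∈ Subgroup.closure (ι '' S), Q g := by
        intro g hg
        induction hg using Subgroup.closure_induction_right with
        | one => exact ⟨1, A.one_mem, 1, B.one_mem, 1, N.one_mem, by simp⟩
        | mul_right g _ y hy ihg =>
          obtain ⟨x, hx, rfl⟩ := hy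
          exact hQs g ihg x hx
        | mul_inv_cancel g _ y hy ihg =>
          obtain ⟨x, hx, rfl⟩ := hy
          have h3 := hQN _ (hQpow (p - 1) g ihg x hx) _ (N.inv_mem (hpN x))
          convert h3 using 1
          obtain ⟨q, rfl⟩ := Nat.exists_eq_succ_of_ne_zero hp.ne'
          rw [Nat.succ_eq_add_one, Nat.add_sub_cancel, pow_succ' (ι x) q]
          group
      intro g hg
      obtain ⟨a, ha, b, hb, W, hW, rfl⟩ := hQall g hg
      obtain ⟨α, hα, W1, hW1, rfl⟩ := hYE a ha
      obtain ⟨β, hβ, W2, hW2, rfl⟩ := hZE b hb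
      refine ⟨fun x => if x ∈ Y then α x else β x, ?_, ?_⟩
      · intro x
        dsimp only
        split_ifs
        · exact hα x
        · exact hβ x
      have e1 : (lY.map fun x => ι x ^ (if x ∈ Y then α x else β x)) = lY.map fun x => ι x ^ α x := by
        refine List.map_congr_left fun x hx => ?_
        rw [if_pos ((hYl x).1 hx)]
      have e2 : (lZ.map fun x => ι x ^ (if x ∈ Y then α x else β x)) = lZ.map fun x => ι x ^ β x := by
        refine List.map_congr_left fun x hx => ?_
        rw [if_neg (fun h => hYZ x h ((hZl x).1 hx))]
      rw [List.map_append, List.prod_append, e1, e2]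
      generalize (lY.map fun x => ι x ^ α x).prod = P
      generalize (lZ.map fun x => ι x ^ β x).prod = R
      have hW1' : R⁻¹ * W1 * R ∈ N := by
        have := hN.conj_mem W1 hW1 R⁻¹
        rwa [inv_inv] at this
      exact ⟨R⁻¹ * W1 * R * W2 * W, N.mul_mem (N.mul_mem hW1' hW2) hW, by group⟩
    · -- uniqueness
      intro a b ha hb hab
      rw [List.map_append, List.prod_append, List.map_append, List.prod_append] at hab
      have mYa := hprodmem Y lY hYl a
      have mYb := hprodmem Y lY hYl b
      have mZa := hprodmem Z lZ hZl a
      have mZb := hprodmem Z lZ hZl b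
      have key : ∀ P ∈ Subgroup.closure (ι '' Y), ∀ R ∈ Subgroup.closure (ι '' Z), ∀ z ∈ Y,
          c (P * R) z = c P z := by
        intro P hP R hR z hz
        rw [hc, hsupp Z (fun s hs => hZ s (hZsub hs)) R hR, add_zero]
        apply hYZ
        rw [← hpres Y Y (fun s hs => hY s (hYsub hs)) P hP, yb_apply_inv]
        exact hz
      have hYeq : ∀ x ∈ Y, a x = b x := by
        refine hYU a b ha hb ?_
        funext z
        by_cases hz : z ∈ Y
        · rw [← key _ mYa _ mZa z hz, ← key _ mYb _ mZb z hz, hab]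
        · rw [hsupp Y (fun s hs => hY s (hYsub hs)) _ mYa z hz,
            hsupp Y (fun s hs => hY s (hYsub hs)) _ mYb z hz]
      have e1 : (lY.map fun x => ι x ^ a x) = lY.map fun x => ι x ^ b x := by
        refine List.map_congr_left fun x hx => ?_
        rw [hYeq x ((hYl x).1 hx)]
      rw [e1] at hab
      have hZeq : ∀ x ∈ Z, a x = b x := by
        refine hZU a b ha hb ?_
        funext z
        have h3 := congrFun hab (lam (lY.map fun x => ι x ^ b x).prod z)
        rw [hc, hc, yb_inv_apply] at h3
        exact add_left_cancel h3
      intro x hx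
      by_cases hxY : x ∈ Y
      · exact hYeq x hxY
      · exact hZeq x (Finset.mem_sdiff.2 ⟨hx, hxY⟩)
end


theorem yb_main {X : Type*} [Fintype X] (r : X × X → X × X)
    (hnd : Nondegenerate r) (hinv : Function.Involutive r) (hbr : IsBraided r)
    (hsf : ∀ x : X, r (x, x) = (x, x)) (p : ℕ) (hp : 0 < p)
    (hpord : ∀ x : X, (sig r x)^[p] = id) :
    ∃ e : Fin (Fintype.card X) ≃ X, ∀ u : YBGroup r,
      ∃! aW : (Fin (Fintype.card X) → Fin p) ×
          (Subgroup.closure (Set.range fun x : X => ybι r x ^ p)),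
        u = (List.ofFn fun i => ybι r (e i) ^ ((aW.1 i : ℕ))).prod * (aW.2 : YBGroup r) := by
  classical
  let σ : X → Equiv.Perm X := fun x => Equiv.ofBijective (sig r x) (hnd.1 x)
  have hσ : ∀ x y, σ x y = (r (x, y)).1 := fun _ _ => rfl
  have h1 : ∀ x, σ x x = x := fun x => by rw [hσ, hsf]
  have hτ : ∀ x y, (r (x, y)).2 = (σ (σ x y))⁻¹ x := by
    intro x y
    rw [Equiv.Perm.eq_inv_iff_eq]
    rw [hσ, hσ]
    exact congrArg Prod.fst (hinv (x, y))
  have hb : ∀ x y, σ x * σ y = σ (σ x y) * σ ((σ (σ x y))⁻¹ x) := by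
    intro x y
    ext z
    have := congrArg Prod.fst (congrFun hbr (x, y, z))
    rw [← hτ]
    exact this.symm
  have h2 : ∀ x y, σ x * σ ((σ x)⁻¹ y) = σ y * σ ((σ y)⁻¹ x) := by
    intro x y
    have := hb x ((σ x)⁻¹ y)
    rwa [yb_apply_inv] at this
  have hpσ : ∀ x, σ x ^ p = 1 := by
    intro x
    ext z
    rw [← Equiv.Perm.iterate_eq_pow]
    exact congrFun (hpord x) z
  set ι := ybι r with hιdef
  have hι : ∀ x y, ι x * ι y = ι (σ x y) * ι ((σ (σ x y))⁻¹ x) := by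
    intro x y
    rw [← hτ]
    have : (PresentedGroup.mk (ybRels r)) (FreeGroup.of x * FreeGroup.of y *
      (FreeGroup.of (sig r x y) * FreeGroup.of (tau r y x))⁻¹) = 1 :=
      PresentedGroup.one_of_mem ⟨x, y, rfl⟩
    rw [map_mul, map_inv, mul_inv_eq_one, map_mul, map_mul] at this
    exact this
  have hgen : Subgroup.closure (Set.range ι) = ⊤ := PresentedGroup.closure_range_of _
  -- the subgroup is normal
  set N := Subgroup.closure (Set.range fun x : X => ι x ^ p) with hNdef
  have hpN : ∀ x, ι x ^ p ∈ N := fun x => Subgroup.subset_closure ⟨x, rfl⟩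
  have hpowk : ∀ x x' : X, ∀ k : ℕ, ∀ y, σ y x = x' →
      ι y * ι x ^ k = ι x' ^ k * ι (((σ x')⁻¹ ^ k) y) := by
    intro x x' k
    induction k with
    | zero => intro y _; simp
    | succ k ih =>
      intro y hy
      have hcyc : σ ((σ x')⁻¹ y) x = x' := by
        have h3 := congrArg (fun f : Equiv.Perm X => f x) (hb y x)
        simp only [Equiv.Perm.mul_apply] at h3
        rw [h1, hy] at h3
        apply (σ x').injective
        rw [← h3, h1]
      rw [pow_succ', ← mul_assoc, hι, hy, mul_assoc, ih _ hcyc, pow_succ' (ι x'), ← mul_assoc,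
        pow_succ (σ x')⁻¹]
      rfl
  have hconj : ∀ x y, ι y * ι x ^ p = ι (σ y x) ^ p * ι y := by
    intro x y
    rw [hpowk x (σ y x) p y rfl, inv_pow, hpσ, inv_one]
    rfl
  have hN : N.Normal := by
    have step : ∀ g : YBGroup r, (∀ x, g * ι x ^ p * g⁻¹ ∈ N) → ∀ n ∈ N, g * n * g⁻¹ ∈ N := by
      intro g hg n hn
      induction hn using Subgroup.closure_induction with
      | mem n hn => obtain ⟨x, rfl⟩ := hn; exact hg x
      | one => rw [mul_one, mul_inv_cancel]; exact N.one_mem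
      | mul a b _ _ ha hb =>
        have := N.mul_mem ha hb
        convert this using 1
        group
      | inv a _ ha =>
        have := N.inv_mem ha
        convert this using 1
        group
    refine ⟨fun n hn g => ?_⟩
    have hg : g ∈ Subgroup.closure (Set.range ι) := by rw [hgen]; trivial
    induction hg using Subgroup.closure_induction_left with
    | one => rw [one_mul, inv_one, mul_one]; exact hn
    | mul_left y hy g _ ih =>
      obtain ⟨y, rfl⟩ := hy
      have := step (ι y) (fun x => by rw [hconj, mul_inv_cancel_right]; exact hpN _) _ ih
      convert this using 1
      group
    | inv_mul_cancel y hy g _ ih =>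
      obtain ⟨y, rfl⟩ := hy
      have := step (ι y)⁻¹ (fun x => by
        have h3 := hconj ((σ y)⁻¹ x) y
        rw [yb_apply_inv] at h3
        rw [inv_inv, mul_assoc, ← h3, inv_mul_cancel_left]
        exact hpN _) _ ih
      convert this using 1
      group
  -- the action homomorphism
  have hlift1 : ∀ w ∈ ybRels r, FreeGroup.lift σ w = 1 := by
    rintro _ ⟨x, y, rfl⟩
    rw [map_mul, map_inv, mul_inv_eq_one, map_mul, map_mul]
    simp only [FreeGroup.lift_apply_of]
    have := hb x y
    rw [← hτ] at this
    exact this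
  let lam : YBGroup r →* Equiv.Perm X := PresentedGroup.toGroup hlift1
  have hlam : ∀ x, lam (ι x) = σ x := fun x => PresentedGroup.toGroup.of hlift1
  -- the affine representation
  let aff : X → Equiv.Perm (X → ZMod p) := fun x =>
    { toFun := fun f z => (Pi.single x 1 : X → ZMod p) z + f ((σ x)⁻¹ z)
      invFun := fun f z => f (σ x z) - (Pi.single x 1 : X → ZMod p) (σ x z)
      left_inv := fun f => by
        funext z
        dsimp only
        rw [yb_inv_apply, add_sub_cancel_left]
      right_inv := fun f => by
        funext z
        dsimp only
        rw [yb_apply_inv, add_sub_cancel] }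
  have haff : ∀ x f z, aff x f z = (Pi.single x 1 : X → ZMod p) z + f ((σ x)⁻¹ z) := fun _ _ _ => rfl
  have hsing : ∀ (s : Equiv.Perm X) (y z : X),
      (Pi.single y 1 : X → ZMod p) (s⁻¹ z) = (Pi.single (s y) 1 : X → ZMod p) z := by
    intro s y z
    rw [Pi.single_apply, Pi.single_apply]
    congr 1
    rw [Equiv.Perm.inv_eq_iff_eq, eq_iff_iff]
  have hlift2 : ∀ w ∈ ybRels r, FreeGroup.lift aff w = 1 := by
    rintro _ ⟨x, y, rfl⟩
    rw [map_mul, map_inv, mul_inv_eq_one, map_mul, map_mul]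
    simp only [FreeGroup.lift_apply_of]
    show aff x * aff y = aff (σ x y) * aff (r (x, y)).2
    rw [hτ]
    ext f z
    simp only [Equiv.Perm.mul_apply, haff]
    rw [hsing, hsing, yb_apply_inv]
    have h3 : (σ y)⁻¹ ((σ x)⁻¹ z) = (σ ((σ (σ x y))⁻¹ x))⁻¹ ((σ (σ x y))⁻¹ z) := by
      have := congrArg (fun f : Equiv.Perm X => f⁻¹ z) (hb x y)
      simpa only [mul_inv_rev, Equiv.Perm.mul_apply] using this
    rw [h3]
    ring
  let Φ : YBGroup r →* Equiv.Perm (X → ZMod p) := PresentedGroup.toGroup hlift2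
  have hΦι : ∀ x, Φ (ι x) = aff x := fun x => PresentedGroup.toGroup.of hlift2
  have hΦ : ∀ (g : YBGroup r) f z, Φ g f z = Φ g 0 z + f ((lam g)⁻¹ z) := by
    intro g
    have hg : g ∈ Subgroup.closure (Set.range ι) := by rw [hgen]; trivial
    induction hg using Subgroup.closure_induction with
    | mem g hg =>
      obtain ⟨x, rfl⟩ := hg
      intro f z
      rw [hΦι, hlam, haff, haff]
      simp
    | one => intro f z; simp
    | mul a b _ _ ha hb =>
      intro f z
      rw [map_mul, map_mul, Equiv.Perm.mul_apply, Equiv.Perm.mul_apply, ha, ha (Φ b 0), hb, mul_inv_rev,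
        Equiv.Perm.mul_apply, add_assoc]
    | inv a _ ha =>
      intro f z
      have e1 : ∀ f, Φ a (Φ a⁻¹ f) = f := fun f => by
        rw [← Equiv.Perm.mul_apply, ← map_mul, mul_inv_cancel, map_one]; rfl
      have h3 := ha (Φ a⁻¹ f) (lam a z)
      have h4 := ha (Φ a⁻¹ 0) (lam a z)
      rw [e1, yb_inv_apply] at h3 h4
      rw [map_inv lam, inv_inv, h3]
      have : Φ a⁻¹ 0 z = - Φ a 0 (lam a z) := by
        rw [Pi.zero_apply] at h4
        exact (neg_eq_of_add_eq_zero_right h4.symm).symm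
      rw [this]
      ring
  let c : YBGroup r → X → ZMod p := fun g => Φ g 0
  have hc : ∀ g h z, c (g * h) z = c g z + c h ((lam g)⁻¹ z) := by
    intro g h z
    show Φ (g * h) 0 z = _
    rw [map_mul, Equiv.Perm.mul_apply, hΦ]
  have hcι : ∀ x z, c (ι x) z = (Pi.single x 1 : X → ZMod p) z := by
    intro x z
    show Φ (ι x) 0 z = _
    rw [hΦι, haff]
    simp
  have hNΦ : ∀ w ∈ N, c w = 0 := by
    have hle : N ≤ Φ.ker := by
      rw [hNdef, Subgroup.closure_le]
      rintro _ ⟨x, rfl⟩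
      show Φ (ι x ^ p) = 1
      rw [map_pow, hΦι]
      have hk : ∀ (k : ℕ) f z, (aff x ^ k) f z = k * (Pi.single x 1 : X → ZMod p) z + f (((σ x)⁻¹ ^ k) z) := by
        intro k
        induction k with
        | zero => intro f z; simp
        | succ k ih =>
          intro f z
          rw [pow_succ', Equiv.Perm.mul_apply, haff, ih, hsing, h1, pow_succ (σ x)⁻¹, Equiv.Perm.mul_apply]
          push_cast
          ring
      ext f z
      rw [hk, inv_pow, hpσ, inv_one]
      simp
    intro w hw
    show Φ w 0 = 0
    rw [MonoidHom.mem_ker.1 (hle hw)]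
    rfl
  obtain ⟨l, hnd, hmem, hE, hU⟩ := yb_list σ h1 h2 ι hι N hN p hp hpN lam hlam c hc
    (fun x => by rw [hcι, Pi.single_eq_same]) (fun x z h => by rw [hcι, Pi.single_eq_of_ne h])
    _ Finset.univ rfl (fun _ _ _ => by simp)
  have hlen : l.length = Fintype.card X := by
    rw [← List.toFinset_card_of_nodup hnd, ← Finset.card_univ]
    congr 1
    ext x
    rw [List.mem_toFinset, hmem]
  obtain ⟨e, he⟩ : ∃ e : Fin (Fintype.card X) ≃ X, List.ofFn e = l := by
    have : ∀ n, l.length = n → ∃ e : Fin n ≃ X, List.ofFn e = l := by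
      rintro _ rfl
      exact ⟨List.Nodup.getEquivOfForallMemList l hnd (fun x => (hmem x).2 (Finset.mem_univ x)),
        List.ofFn_get l⟩
    exact this _ hlen
  have hprod : ∀ a : X → ℕ, (List.ofFn fun i => ι (e i) ^ a (e i)) = l.map fun x => ι x ^ a x := by
    intro a
    rw [← he, List.map_ofFn]
    rfl
  refine ⟨e, fun u => ?_⟩
  have huniv : u ∈ Subgroup.closure (ι '' ((Finset.univ : Finset X) : Set X)) := by
    rw [Finset.coe_univ, Set.image_univ, hgen]; trivial
  obtain ⟨a, ha, W, hW, hu⟩ := hE u huniv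
  refine ⟨(fun i => ⟨a (e i), ha _⟩, ⟨W, hW⟩), ?_, ?_⟩
  · show u = (List.ofFn fun i => ι (e i) ^ a (e i)).prod * W
    rw [hprod]; exact hu
  · rintro ⟨b, V, hV⟩ hbV
    have hbV : u = (List.ofFn fun i => ι (e i) ^ (b i : ℕ)).prod * V := hbV
    have hb' := hprod (fun x => (b (e.symm x) : ℕ))
    simp only [Equiv.symm_apply_apply] at hb'
    rw [hb'] at hbV
    have hcW : ∀ g, ∀ w ∈ N, c (g * w) = c g := by
      intro g w hw
      funext z
      rw [hc, hNΦ w hw]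
      simp
    have hab := hU _ a (fun x => (b (e.symm x)).2) ha (by
      rw [← hcW _ V hV, ← hbV, hu, hcW _ W hW])
    have hbe : b = fun i => ⟨a (e i), ha _⟩ := by
      funext i
      apply Fin.ext
      have := hab (e i) (Finset.mem_univ _)
      rwa [Equiv.symm_apply_apply] at this
    have hpe : (l.map fun x => ι x ^ ((b (e.symm x) : ℕ))) = l.map fun x => ι x ^ a x :=
      List.map_congr_left fun x _ => by rw [hab x (Finset.mem_univ _)]
    rw [hpe, hu] at hbV
    have hVW := mul_left_cancel hbV
    subst hVW
    rw [hbe]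

/-- For a finite square-free solution `(X,r)` of order `n`
with cyclic degree `p`, there is an enumeration `x_1, …, x_n` of `X` such that
every `u ∈ G(X,r)` has a unique presentation
`u = ι(x_1)^{a_1} ⋯ ι(x_n)^{a_n} · W` with `0 ≤ a_i ≤ p-1` and
`W ∈ F_p = ⟨ι(x)^p : x ∈ X⟩`. -/
theorem unique_normal_form_G {X : Type*} [Fintype X] (r : X × X → X × X)
    (hnd : Nondegenerate r) (hinv : Function.Involutive r) (hbr : IsBraided r)
    (hsf : ∀ x : X, r (x, x) = (x, x)) (p : ℕ) (hp : 0 < p)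
    (hpord : ∀ x : X, (sig r x)^[p] = id)
    (hpmin : ∀ q : ℕ, 0 < q → (∀ x : X, (sig r x)^[q] = id) → p ≤ q) :
    ∃ e : Fin (Fintype.card X) ≃ X, ∀ u : YBGroup r,
      ∃! aW : (Fin (Fintype.card X) → Fin p) ×
          (Subgroup.closure (Set.range fun x : X => ybι r x ^ p)),
        u = (List.ofFn fun i => ybι r (e i) ^ ((aW.1 i : ℕ))).prod * (aW.2 : YBGroup r) := by
  exact yb_main r hnd hinv hbr hsf p hp hpord
end

section
/- Let (X,r) be a nondegenerate involutive braided set of finite order, let G = G(X,r), and let K be a field. Then the group algebra K[G] is a domain (it has no zero divisors). -/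
namespace YBDom
set_option linter.unusedSectionVars false
open Equiv

section general
variable {K : Type*} {X : Type*} {M : Type*} [Field K] [Fintype X] [DecidableEq X]
  [AddCommGroup M] [Module K M]

/-- permutation of the standard basis of `X → K`. -/
def pm (K : Type*) {X : Type*} [Field K] (u : Perm X) : (X → K) →ₗ[K] (X → K) :=
  LinearMap.funLeft K K (u⁻¹ : Perm X)

/-- standard basis vector. -/
def bv (K : Type*) {X : Type*} [Field K] [DecidableEq X] (x : X) : X → K := Pi.single x 1

lemma pm_bv (u : Perm X) (x : X) : pm K u (bv K x) = bv K (u x) := by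
  ext y
  simp only [pm, bv, LinearMap.funLeft_apply, Pi.single_apply, Perm.inv_eq_iff_eq]

lemma pm_mul (u v : Perm X) (m : X → K) : pm K u (pm K v m) = pm K (u * v) m := by
  ext y
  simp [pm, LinearMap.funLeft_apply]

lemma pm_one (m : X → K) : pm K (1 : Perm X) m = m := by
  ext y
  simp [pm, LinearMap.funLeft_apply]

lemma alt_sum_apply {ι : Type*} (s : Finset ι) {n : ℕ}
    (z : ι → (X → K) [⋀^Fin n]→ₗ[K] M) (v : Fin n → X → K) :
    (∑ k ∈ s, z k) v = ∑ k ∈ s, z k v := by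
  classical
  induction s using Finset.induction_on with
  | empty => simp
  | insert a s ha ih => rw [Finset.sum_insert ha, Finset.sum_insert ha, AlternatingMap.add_apply, ih]

/-- Twisted Koszul differential. -/
noncomputable def kd (σ : X → Perm X) (T : X → M →ₗ[K] M) (n : ℕ)
    (f : (X → K) [⋀^Fin (n+1)]→ₗ[K] M) : (X → K) [⋀^Fin n]→ₗ[K] M :=
  ∑ x, (T x).compAlternatingMap ((f.compLinearMap (pm K (σ x)⁻¹)).curryLeft (bv K x))

lemma kd_apply (σ : X → Perm X) (T : X → M →ₗ[K] M) (n : ℕ)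
    (f : (X → K) [⋀^Fin (n+1)]→ₗ[K] M) (v : Fin n → X → K) :
    kd σ T n f v = ∑ x, T x (f (Fin.cons (pm K (σ x)⁻¹ (bv K x)) (fun i => pm K (σ x)⁻¹ (v i)))) := by
  simp only [kd, alt_sum_apply]
  refine Finset.sum_congr rfl fun x _ => ?_
  simp only [LinearMap.compAlternatingMap_apply, AlternatingMap.curryLeft_apply_apply,
    AlternatingMap.compLinearMap_apply]
  congr 2
  ext i : 1
  refine Fin.cases ?_ (fun i => ?_) i <;> simp [Matrix.vecCons]

lemma kd_add (σ : X → Perm X) (T : X → M →ₗ[K] M) (n : ℕ)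
    (f g : (X → K) [⋀^Fin (n+1)]→ₗ[K] M) : kd σ T n (f + g) = kd σ T n f + kd σ T n g := by
  ext v
  simp [kd_apply, Finset.sum_add_distrib]

lemma kd_sub (σ : X → Perm X) (T : X → M →ₗ[K] M) (n : ℕ)
    (f g : (X → K) [⋀^Fin (n+1)]→ₗ[K] M) : kd σ T n (f - g) = kd σ T n f - kd σ T n g := by
  ext v
  simp [kd_apply]

lemma kd_zero (σ : X → Perm X) (T : X → M →ₗ[K] M) (n : ℕ) :
    kd σ T n (0 : (X → K) [⋀^Fin (n+1)]→ₗ[K] M) = 0 := by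
  ext v
  simp [kd_apply]

lemma kd_comp {M' : Type*} [AddCommGroup M'] [Module K M']
    (σ : X → Perm X) (T : X → M →ₗ[K] M) (T' : X → M' →ₗ[K] M') (F : M →ₗ[K] M')
    (hF : ∀ x m, F (T x m) = T' x (F m)) (n : ℕ) (f : (X → K) [⋀^Fin (n+1)]→ₗ[K] M) :
    kd σ T' n (F.compAlternatingMap f) = F.compAlternatingMap (kd σ T n f) := by
  ext v
  simp [kd_apply, hF]

lemma kd_kd (σ : X → Perm X) (T : X → M →ₗ[K] M)
    (hσ : ∀ x y, σ x * σ y = σ (σ x y) * σ ((σ (σ x y))⁻¹ x))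
    (hT : ∀ x y m, T x (T y m) = T (σ x y) (T ((σ (σ x y))⁻¹ x) m)) (n : ℕ)
    (f : (X → K) [⋀^Fin (n+2)]→ₗ[K] M) : kd σ T n (kd σ T (n+1) f) = 0 := by
  ext v
  set Ψ : X × X → M := fun p => T p.1 (T p.2 (f (fun i => pm K (σ p.1 * σ p.2)⁻¹
    ((Fin.cons (bv K (σ p.1 p.2)) (Fin.cons (bv K p.1) v) : Fin (n+2) → X → K) i)))) with hΨ
  have h1 : kd σ T n (kd σ T (n+1) f) v = ∑ p : X × X, Ψ p := by
    rw [Fintype.sum_prod_type, kd_apply]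
    refine Finset.sum_congr rfl fun x _ => ?_
    rw [kd_apply, map_sum]
    refine Finset.sum_congr rfl fun y _ => ?_
    simp only [hΨ]
    congr 3
    ext i : 1
    refine Fin.cases ?_ (fun i => ?_) i
    · simp [pm_bv]
    · refine Fin.cases ?_ (fun i => ?_) i
      · simp [pm_bv]
      · simp [pm_mul]
  rw [h1, AlternatingMap.zero_apply]
  refine Finset.sum_involution (fun p _ => (σ p.1 p.2, (σ (σ p.1 p.2))⁻¹ p.1)) ?_ ?_ ?_ ?_
  · rintro ⟨x, y⟩ -
    simp only [hΨ]
    rw [← hT, ← hσ, ← map_add, ← map_add]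
    have : (fun i => pm K (σ x * σ y)⁻¹
      ((Fin.cons (bv K (σ (σ x y) ((σ (σ x y))⁻¹ x))) (Fin.cons (bv K (σ x y)) v) :
        Fin (n+2) → X → K) i)) = (fun i => pm K (σ x * σ y)⁻¹
      ((Fin.cons (bv K (σ x y)) (Fin.cons (bv K x) v) : Fin (n+2) → X → K) i)) ∘
        Equiv.swap 0 1 := by
      ext i : 1
      refine Fin.cases ?_ (fun i => ?_) i
      · simp
      · refine Fin.cases ?_ (fun i => ?_) i
        · simp
        · rw [Function.comp_apply, Equiv.swap_apply_of_ne_of_ne]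
          · simp
          · exact Fin.succ_ne_zero _
          · intro h
            exact Fin.succ_ne_zero i (Fin.succ_injective _ h)
    rw [this, AlternatingMap.map_swap _ _ (by simp)]
    simp
  · rintro ⟨x, y⟩ - h0 heq
    apply h0
    simp only [hΨ]
    have hx : σ x y = x := congrArg Prod.fst heq
    rw [f.map_eq_zero_of_eq (i := 0) (j := 1) _ _ (by simp)]
    · simp
    · simp [hx]
  · intros; simp
  · rintro ⟨x, y⟩ -
    simp

end general

section std
variable {K : Type*} {X : Type*} {M : Type*} [Field K] [Fintype X] [DecidableEq X]
  [AddCommGroup M] [Module K M]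

/-- wedge with the dual basis vector `j`. -/
noncomputable def wedge (j : X) {n : ℕ} (z : (X → K) [⋀^Fin n]→ₗ[K] M) :
    (X → K) [⋀^Fin (n+1)]→ₗ[K] M :=
  AlternatingMap.alternatizeUncurryFin ((LinearMap.proj j : (X → K) →ₗ[K] K).smulRight z)

lemma wedge_apply (j : X) {n : ℕ} (z : (X → K) [⋀^Fin n]→ₗ[K] M) (v : Fin (n+1) → X → K) :
    wedge j z v = ∑ i : Fin (n+1), (-1 : ℤ)^(i : ℕ) • v i j • z (i.removeNth v) := by
  simp [wedge, AlternatingMap.alternatizeUncurryFin_apply]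

lemma wedge_comp {M' : Type*} [AddCommGroup M'] [Module K M'] (F : M →ₗ[K] M')
    (j : X) {n : ℕ} (z : (X → K) [⋀^Fin n]→ₗ[K] M) :
    F.compAlternatingMap (wedge j z) = wedge j (F.compAlternatingMap z) := by
  ext v
  simp [wedge_apply]

lemma wedge_add (j : X) {n : ℕ} (z w : (X → K) [⋀^Fin n]→ₗ[K] M) :
    wedge j (z + w) = wedge j z + wedge j w := by
  ext v
  simp [wedge_apply, Finset.sum_add_distrib]

lemma wedge_zero (j : X) {n : ℕ} :
    wedge j (0 : (X → K) [⋀^Fin n]→ₗ[K] M) = 0 := by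
  ext v
  simp [wedge_apply]

lemma wedge_sum {ι : Type*} (s : Finset ι) (j : X) {n : ℕ} (z : ι → (X → K) [⋀^Fin n]→ₗ[K] M) :
    wedge j (∑ k ∈ s, z k) = ∑ k ∈ s, wedge j (z k) := by
  classical
  induction s using Finset.induction_on with
  | empty => simp [wedge_zero]
  | insert a s ha ih => rw [Finset.sum_insert ha, Finset.sum_insert ha, wedge_add, ih]

lemma wedge_curry (j : X) {n : ℕ} (z : (X → K) [⋀^Fin (n+1)]→ₗ[K] M) (m : X → K) :
    (wedge j z).curryLeft m = m j • z - wedge j (z.curryLeft m) := by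
  ext v
  rw [AlternatingMap.curryLeft_apply_apply, wedge_apply, Fin.sum_univ_succ,
    AlternatingMap.sub_apply, wedge_apply, sub_eq_add_neg, ← Finset.sum_neg_distrib]
  refine congrArg₂ (· + ·) (by simp) (Finset.sum_congr rfl fun i _ => ?_)
  rw [AlternatingMap.curryLeft_apply_apply]
  simp only [Matrix.cons_val_succ, Fin.val_succ, pow_succ, mul_neg, mul_one, neg_smul]
  congr 4
  ext k : 1
  refine Fin.cases ?_ (fun k => ?_) k
  · simp [Fin.removeNth]
  · simp [Fin.removeNth]

lemma wedge_curry0 (j : X) (z : (X → K) [⋀^Fin 0]→ₗ[K] M) (m : X → K) :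
    (wedge j z).curryLeft m = m j • z := by
  ext v
  rw [AlternatingMap.curryLeft_apply_apply, wedge_apply]
  simp

end std
end YBDom

namespace YBDom
open Equiv MvPolynomial
set_option linter.unusedSectionVars false
set_option linter.unusedSimpArgs false

section std2
variable {K : Type*} {X : Type*} [Field K] [Fintype X] [DecidableEq X]

/-- multiplication by the variable. -/
noncomputable def mX (x : X) : MvPolynomial X K →ₗ[K] MvPolynomial X K :=
  LinearMap.mulLeft K (MvPolynomial.X x)

/-- division by the variable. -/
noncomputable def dX (x : X) : MvPolynomial X K →ₗ[K] MvPolynomial X K where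
  toFun p := p.divMonomial (Finsupp.single x 1)
  map_add' p q := add_divMonomial _ _ _
  map_smul' c p := by
    ext a
    simp [coeff_divMonomial]

lemma dX_mX (x : X) (p : MvPolynomial X K) : dX x (mX x p) = p := by
  simp [dX, mX]

lemma dX_mX_ne {x y : X} (h : y ≠ x) (p : MvPolynomial X K) : dX x (mX y p) = mX y (dX x p) := by
  ext a
  simp only [dX, mX, LinearMap.coe_mk, AddHom.coe_mk, LinearMap.mulLeft_apply, coeff_divMonomial,
    coeff_X_mul', Finsupp.mem_support_iff, Finsupp.add_apply, Finsupp.single_eq_of_ne h, zero_add]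
  split_ifs with h1
  · congr 1
    have : Finsupp.single y 1 ≤ a := by
      rw [Finsupp.single_le_iff]; omega
    rw [add_tsub_assoc_of_le this]
  · rfl

/-- standard Koszul differential. -/
noncomputable def sd (n : ℕ) (f : (X → K) [⋀^Fin (n+1)]→ₗ[K] MvPolynomial X K) :
    (X → K) [⋀^Fin n]→ₗ[K] MvPolynomial X K :=
  kd (fun _ => 1) (fun x => mX x) n f

lemma sd_eq (n : ℕ) (f : (X → K) [⋀^Fin (n+1)]→ₗ[K] MvPolynomial X K) :
    sd n f = ∑ x, (mX x).compAlternatingMap (f.curryLeft (bv K x)) := by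
  ext1 v
  simp only [sd, kd_apply, alt_sum_apply, inv_one, pm_one, LinearMap.compAlternatingMap_apply,
    AlternatingMap.curryLeft_apply_apply]
  rfl

lemma sd_sd (n : ℕ) (f : (X → K) [⋀^Fin (n+2)]→ₗ[K] MvPolynomial X K) :
    sd n (sd (n+1) f) = 0 := by
  refine kd_kd _ _ (fun x y => by simp) (fun x y m => ?_) n f
  simp [mX]
  ring

lemma curry_swap {M : Type*} [AddCommGroup M] [Module K M] (n : ℕ)
    (f : (X → K) [⋀^Fin (n+2)]→ₗ[K] M) (a b : X → K) :
    (f.curryLeft a).curryLeft b = - (f.curryLeft b).curryLeft a := by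
  have := AlternatingMap.curryLeft_same f (a + b)
  simp only [map_add, AlternatingMap.curryLeft_add, LinearMap.add_apply,
    AlternatingMap.curryLeft_same, zero_add, add_zero] at this
  exact eq_neg_of_add_eq_zero_right this

lemma sd_homotopy (n : ℕ) (y : (X → K) [⋀^Fin (n+1)]→ₗ[K] MvPolynomial X K) (hy : sd n y = 0)
    (j : X) :
    sd (n+1) (wedge j ((dX j).compAlternatingMap y)) =
      (mX j).compAlternatingMap ((dX j).compAlternatingMap y) +
      wedge j ((LinearMap.id - mX j ∘ₗ dX j).compAlternatingMap (y.curryLeft (bv K j))) := by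
  have h0 : wedge j ((dX j).compAlternatingMap (sd n y)) = 0 := by
    rw [hy]; ext1 v; simp [wedge_apply]
  rw [sd_eq]
  have h1 : wedge j ((dX j).compAlternatingMap (sd n y)) =
      ∑ k, wedge j ((dX j ∘ₗ mX k).compAlternatingMap (y.curryLeft (bv K k))) := by
    rw [← wedge_sum]
    congr 1
    ext1 v
    simp [sd_eq, alt_sum_apply]
  rw [h0] at h1
  rw [← add_zero (∑ x, (mX x).compAlternatingMap _), h1, ← Finset.sum_add_distrib]
  rw [Finset.sum_eq_single j]
  · rw [wedge_curry]
    ext1 v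
    simp only [AlternatingMap.add_apply, LinearMap.compAlternatingMap_apply,
      AlternatingMap.sub_apply, AlternatingMap.smul_apply, wedge_apply, bv, Pi.single_eq_same,
      one_smul, map_sub, add_assoc, sub_add]
    simp only [sub_eq_add_neg, add_right_inj, map_sum, ← Finset.sum_neg_distrib, neg_add, neg_neg,
      ← Finset.sum_add_distrib]
    refine Finset.sum_congr rfl fun i _ => ?_
    simp only [AlternatingMap.curryLeft_apply_apply, LinearMap.comp_apply, dX_mX, map_zsmul,
      map_smul, LinearMap.compAlternatingMap_apply, LinearMap.add_apply, LinearMap.neg_apply,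
      LinearMap.id_apply, smul_add, smul_neg]
    abel
  · intro k _ hk
    have hb : bv K k j = 0 := Pi.single_eq_of_ne hk.symm _
    rw [wedge_curry, hb, zero_smul, zero_sub, AlternatingMap.curryLeft_compAlternatingMap]
    ext1 v
    simp [wedge_apply, dX_mX_ne hk, -zsmul_eq_mul]
  · simp

lemma sd_step (n : ℕ) (y : (X → K) [⋀^Fin (n+1)]→ₗ[K] MvPolynomial X K) (hy : sd n y = 0)
    (j k : X) (hk : k = j ∨ y.curryLeft (bv K k) = 0) :
    (y - sd (n+1) (wedge j ((dX j).compAlternatingMap y))).curryLeft (bv K k) = 0 := by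
  rw [sd_homotopy n y hy]
  set ε : MvPolynomial X K →ₗ[K] MvPolynomial X K := LinearMap.id - mX j ∘ₗ dX j with hε
  have h1 : y - ((mX j).compAlternatingMap ((dX j).compAlternatingMap y) +
      wedge j (ε.compAlternatingMap (y.curryLeft (bv K j)))) = ε.compAlternatingMap
        y - wedge j (ε.compAlternatingMap (y.curryLeft (bv K j))) := by
    ext1 v
    simp [hε]
    abel
  rw [h1]
  have h2 : ∀ a b : (X → K) [⋀^Fin (n+1)]→ₗ[K] MvPolynomial X K, (a - b).curryLeft (bv K k) =
     a.curryLeft (bv K k) - b.curryLeft (bv K k) := fun a b => by ext1 v; simp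
  rw [h2, AlternatingMap.curryLeft_compAlternatingMap]
  cases n with
  | zero =>
    rw [wedge_curry0]
    rcases eq_or_ne k j with rfl | h
    · simp [bv]
    · rw [hk.resolve_left h]
      ext1 v
      simp [bv, Pi.single_eq_of_ne h.symm]
  | succ n =>
    rw [wedge_curry, AlternatingMap.curryLeft_compAlternatingMap]
    rcases eq_or_ne k j with rfl | h
    · rw [AlternatingMap.curryLeft_same]
      ext1 v
      simp [bv, wedge_apply]
    · rw [curry_swap, hk.resolve_left h]
      ext1 v
      simp [bv, Pi.single_eq_of_ne h.symm, wedge_apply]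

lemma sd_red (n : ℕ) (g : (X → K) [⋀^Fin (n+1)]→ₗ[K] MvPolynomial X K) (hg : sd n g = 0)
    (J : Finset X) : ∃ (h : (X → K) [⋀^Fin (n+2)]→ₗ[K] MvPolynomial X K)
      (y : (X → K) [⋀^Fin (n+1)]→ₗ[K] MvPolynomial X K), g = sd (n+1) h + y ∧ sd n y = 0 ∧
      ∀ j ∈ J, y.curryLeft (bv K j) = 0 := by
  induction J using Finset.induction_on with
  | empty => exact ⟨0, g, by simp [sd, kd_zero], hg, by simp⟩
  | insert j J hj ih =>
    obtain ⟨h, y, h1, h2, h3⟩ := ih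
    refine ⟨h + wedge j ((dX j).compAlternatingMap y), 
      y - sd (n+1) (wedge j ((dX j).compAlternatingMap y)), ?_, ?_, ?_⟩
    · rw [h1, sd, sd, kd_add, sd]; abel
    · rw [sd, kd_sub]
      change sd n y - sd n _ = 0
      rw [h2, sd_sd, sub_zero]
    · intro k hk
      rw [Finset.mem_insert] at hk
      exact sd_step n y h2 j k (hk.imp id (h3 k))

lemma alt_eq_zero {M : Type*} [AddCommGroup M] [Module K M] (n : ℕ)
    (y : (X → K) [⋀^Fin (n+1)]→ₗ[K] M) (h : ∀ j, y.curryLeft (bv K j) = 0) : y = 0 := by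
  have h1 : y.curryLeft = 0 := by
    apply (Pi.basisFun K X).ext
    intro j
    have := h j
    simpa [bv] using this
  ext1 v
  have h2 := AlternatingMap.curryLeft_apply_apply y (v 0) (Fin.tail v)
  rw [h1] at h2
  rw [show v = Matrix.vecCons (v 0) (Fin.tail v) from (Fin.cons_self_tail v).symm, ← h2]
  rfl

/-- Exactness of the standard Koszul complex in positive degrees. -/
lemma sd_exact (n : ℕ) (g : (X → K) [⋀^Fin (n+1)]→ₗ[K] MvPolynomial X K) (hg : sd n g = 0) :
    ∃ h : (X → K) [⋀^Fin (n+2)]→ₗ[K] MvPolynomial X K, sd (n+1) h = g := by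
  obtain ⟨h, y, h1, h2, h3⟩ := sd_red n g hg Finset.univ
  refine ⟨h, ?_⟩
  rw [h1, alt_eq_zero n y (fun j => h3 j (Finset.mem_univ _)), add_zero]

end std2
end YBDom

namespace YBDom
open Equiv MvPolynomial
set_option linter.unusedSectionVars false
set_option linter.unusedSimpArgs false

/-- The data of a monoid of I-type on `X →₀ ℕ`, with a period `N`. -/
structure IData (X : Type*) where
  φ : (X →₀ ℕ) → Perm X
  zero : φ 0 = 1
  mul : ∀ a b, φ (a + Finsupp.mapDomain (φ a) b) = φ a * φ b
  N : ℕ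
  Npos : 0 < N
  hN : ∀ a, φ (N • a) = 1

section act
variable {X : Type*}

lemma perm_app_inv (u : Perm X) (x : X) : u (u⁻¹ x) = x := by simp

lemma md_one (a : X →₀ ℕ) : Finsupp.mapDomain (1 : Perm X) a = a := Finsupp.mapDomain_id

lemma md_mul (u v : Perm X) (a : X →₀ ℕ) :
    Finsupp.mapDomain u (Finsupp.mapDomain v a) = Finsupp.mapDomain (u * v : Perm X) a := by
  rw [← Finsupp.mapDomain_comp]; rfl

end act

namespace IData
variable {X : Type*} (D : IData X)

lemma add_N (a b : X →₀ ℕ) : D.φ (D.N • a + b) = D.φ b := by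
  have := D.mul (D.N • a) b
  rwa [D.hN, md_one, one_mul] at this

/-- inverse data. -/
noncomputable def ψ (b : X →₀ ℕ) : Perm X := (D.φ ((D.N - 1) • b))⁻¹

lemma N_split (b : X →₀ ℕ) : (D.N - 1) • b + b = D.N • b := by
  have := D.Npos
  conv_lhs => rw [← succ_nsmul]
  congr 1
  omega

lemma psi_iff (u : Perm X) (b : X →₀ ℕ) : D.φ (Finsupp.mapDomain u b) = u ↔ D.ψ b = u := by
  constructor
  · intro h
    have := D.mul (Finsupp.mapDomain u b) ((D.N - 1) • b)
    rw [h, ← Finsupp.mapDomain_add, add_comm b, N_split,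
      Finsupp.mapDomain_smul, D.hN] at this
    rw [ψ, inv_eq_iff_eq_inv]
    exact eq_inv_of_mul_eq_one_right this.symm
  · rintro rfl
    have := D.mul ((D.N - 1) • b) (Finsupp.mapDomain (D.ψ b) b)
    rw [md_mul, ψ, mul_inv_cancel, md_one, N_split, D.hN] at this
    rw [ψ]
    exact eq_inv_of_mul_eq_one_right this.symm

/-- σ -/
noncomputable def σ (x : X) : Perm X := D.φ (Finsupp.single x 1)

lemma σ_rel (x y : X) : D.σ x * D.σ y = D.σ (D.σ x y) * D.σ ((D.σ (D.σ x y))⁻¹ x) := by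
  have h1 := D.mul (Finsupp.single x 1) (Finsupp.single y 1)
  have h2 := D.mul (Finsupp.single (D.σ x y) 1) (Finsupp.single ((D.σ (D.σ x y))⁻¹ x) 1)
  rw [Finsupp.mapDomain_single] at h1 h2
  change D.φ (_ + Finsupp.single (D.σ x y) 1) = _ at h1
  change D.φ (_ + Finsupp.single (D.σ (D.σ x y) ((D.σ (D.σ x y))⁻¹ x)) 1) = _ at h2
  rw [perm_app_inv] at h2
  change _ = D.φ _ * D.φ _
  rw [← h2, add_comm, h1]
  rfl

variable (K : Type*) [Field K]

/-- The action of the monoid on polynomials. -/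
noncomputable def S (a : X →₀ ℕ) : MvPolynomial X K →ₗ[K] MvPolynomial X K :=
  LinearMap.mulLeft K (monomial a 1) ∘ₗ (rename (D.φ a)).toLinearMap

lemma S_apply (a : X →₀ ℕ) (p : MvPolynomial X K) :
    D.S K a p = monomial a 1 * rename (D.φ a) p := rfl

lemma S_S (a b : X →₀ ℕ) (p : MvPolynomial X K) :
    D.S K a (D.S K b p) = D.S K (a + Finsupp.mapDomain (D.φ a) b) p := by
  simp only [S_apply, map_mul, rename_monomial, rename_rename, D.mul, ← mul_assoc, monomial_mul,
    mul_one]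
  rfl

/-- The action of the generators. -/
noncomputable def T (x : X) : MvPolynomial X K →ₗ[K] MvPolynomial X K := D.S K (Finsupp.single x 1)

lemma T_T (x y : X) (p : MvPolynomial X K) :
    D.T K x (D.T K y p) = D.T K (D.σ x y) (D.T K ((D.σ (D.σ x y))⁻¹ x) p) := by
  simp only [T, S_S, Finsupp.mapDomain_single]
  change D.S K (_ + Finsupp.single (D.σ x y) 1) _ =
    D.S K (_ + Finsupp.single (D.σ (D.σ x y) ((D.σ (D.σ x y))⁻¹ x)) 1) _
  rw [perm_app_inv, add_comm]

variable {K}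

end IData

section proj
variable {X : Type*} {K : Type*} [Field K]
open Classical in
/-- projections -/
noncomputable def prj (f : (X →₀ ℕ) → Perm X) (u : Perm X) :
    MvPolynomial X K →ₗ[K] MvPolynomial X K :=
  (basisMonomials X K).constr K (fun a => if f a = u then monomial a 1 else 0)

open Classical in
lemma prj_monomial (f : (X →₀ ℕ) → Perm X) (u : Perm X) (a : X →₀ ℕ) :
    prj f u (monomial a (1 : K)) = if f a = u then monomial a 1 else 0 := by
  have := (basisMonomials X K).constr_basis K (fun a => if f a = u then monomial a (1:K) else 0) a
  rwa [coe_basisMonomials] at this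

lemma lin_ext {M : Type*} [AddCommGroup M] [Module K M] {f g : MvPolynomial X K →ₗ[K] M}
    (h : ∀ a, f (monomial a 1) = g (monomial a 1)) : f = g := by
  apply (basisMonomials X K).ext
  simpa using h

open Classical in
lemma prj_prj (f : (X →₀ ℕ) → Perm X) (u w : Perm X) (p : MvPolynomial X K) :
    prj f u (prj f w p) = if u = w then prj f w p else 0 := by
  have : prj f u ∘ₗ prj f w = if u = w then prj f w else (0 : MvPolynomial X K →ₗ[K] _) := by
    apply lin_ext
    intro a
    by_cases h1 : f a = w <;> by_cases h2 : u = w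
    · subst h2; simp [prj_monomial, h1]
    · simp [prj_monomial, h1, h2, Ne.symm h2]
    · subst h2; simp [prj_monomial, h1]
    · simp [prj_monomial, h1, h2]
  have h := LinearMap.congr_fun this p
  rw [LinearMap.comp_apply] at h
  rw [h]
  split_ifs <;> rfl

lemma prj_sum [Fintype X] [DecidableEq X] (f : (X →₀ ℕ) → Perm X) (p : MvPolynomial X K) :
    ∑ u, prj f u p = p := by
  have : ∑ u, prj f u = (LinearMap.id : MvPolynomial X K →ₗ[K] _) := by
    apply lin_ext
    intro a
    rw [LinearMap.sum_apply, Finset.sum_eq_single (f a)]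
    · simp [prj_monomial]
    · intro b _ hb
      rw [prj_monomial, if_neg hb.symm]
    · simp
  simpa [LinearMap.sum_apply] using LinearMap.congr_fun this p

lemma prj_rename (D : IData X) (u : Perm X) (p : MvPolynomial X K) :
    prj D.φ u (rename u p) = rename u (prj D.ψ u p) := by
  have : prj D.φ u ∘ₗ (rename u).toLinearMap =
    (rename u).toLinearMap ∘ₗ (prj D.ψ u : MvPolynomial X K →ₗ[K] _) := by
    apply lin_ext
    intro a
    by_cases h : D.ψ a = u
    · simp [prj_monomial, rename_monomial, h, (D.psi_iff u a).2 h]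
    · simp [prj_monomial, rename_monomial, h, (D.psi_iff u a).not.2 h]
  exact LinearMap.congr_fun this p

lemma T_prj (D : IData X) (u : Perm X) (x : X) (p : MvPolynomial X K) :
    D.T K x (prj D.φ u p) = prj D.φ (D.σ x * u) (D.T K x p) := by
  have : D.T K x ∘ₗ prj D.φ u =
    prj D.φ (D.σ x * u) ∘ₗ (D.T K x : MvPolynomial X K →ₗ[K] _) := by
    apply lin_ext
    intro a
    have h1 := D.mul (Finsupp.single x 1) a
    have h2 : D.φ (Finsupp.single x 1) = D.σ x := rfl
    by_cases h : D.φ a = u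
    · simp [prj_monomial, rename_monomial, h, IData.T, IData.S_apply, monomial_mul, h1]
      simp [h2]
    · simp [prj_monomial, rename_monomial, h, IData.T, IData.S_apply, monomial_mul, h1]
      simp [h2, h]
  exact LinearMap.congr_fun this p

variable [Fintype X] [DecidableEq X]

/-- transport from standard to twisted -/
noncomputable def Th (D : IData X) {n : ℕ} (g : (X → K) [⋀^Fin n]→ₗ[K] MvPolynomial X K) :
    (X → K) [⋀^Fin n]→ₗ[K] MvPolynomial X K :=
  ∑ u : Perm X, (prj D.φ u ∘ₗ (rename u).toLinearMap).compAlternatingMap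
    (g.compLinearMap (pm K u⁻¹))

/-- transport from twisted to standard -/
noncomputable def Th' (D : IData X) {n : ℕ} (g : (X → K) [⋀^Fin n]→ₗ[K] MvPolynomial X K) :
    (X → K) [⋀^Fin n]→ₗ[K] MvPolynomial X K :=
  ∑ u : Perm X, ((rename (u⁻¹ : Perm X)).toLinearMap ∘ₗ prj D.φ u).compAlternatingMap
    (g.compLinearMap (pm K u))

lemma Th_apply (D : IData X) {n : ℕ} (g : (X → K) [⋀^Fin n]→ₗ[K] MvPolynomial X K)
    (v : Fin n → X → K) : Th D g v = ∑ u : Perm X, prj D.φ u (rename u (g fun i => pm K u⁻¹ (v i))) := by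
  simp only [Th, alt_sum_apply]
  rfl

lemma Th'_apply (D : IData X) {n : ℕ} (g : (X → K) [⋀^Fin n]→ₗ[K] MvPolynomial X K)
    (v : Fin n → X → K) : Th' D g v =
      ∑ u : Perm X, rename (u⁻¹ : Perm X) (prj D.φ u (g fun i => pm K u (v i))) := by
  simp only [Th', alt_sum_apply]
  rfl

lemma rename_inv_rename (u : Perm X) (p : MvPolynomial X K) :
    rename (u⁻¹ : Perm X) (rename u p) = p := by
  rw [rename_rename]
  have : (⇑(u⁻¹ : Perm X) ∘ ⇑u) = id := by ext x; simp
  rw [this, rename_id]; rfl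

lemma rename_rename_inv (u : Perm X) (p : MvPolynomial X K) :
    rename u (rename (u⁻¹ : Perm X) p) = p := by
  rw [rename_rename]
  have : (⇑u ∘ ⇑(u⁻¹ : Perm X)) = id := by ext x; simp
  rw [this, rename_id]; rfl

lemma Th'_Th (D : IData X) {n : ℕ} (g : (X → K) [⋀^Fin n]→ₗ[K] MvPolynomial X K) :
    Th' D (Th D g) = g := by
  ext1 v
  rw [Th'_apply, ← prj_sum D.ψ (g v)]
  refine Finset.sum_congr rfl fun u _ => ?_
  rw [Th_apply, map_sum, Finset.sum_eq_single u]
  · rw [prj_prj, if_pos rfl, prj_rename, rename_inv_rename]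
    simp [pm_mul, pm_one]
  · intro w _ hw
    rw [prj_prj, if_neg hw.symm]
  · simp

lemma Th_Th' (D : IData X) {n : ℕ} (g : (X → K) [⋀^Fin n]→ₗ[K] MvPolynomial X K) :
    Th D (Th' D g) = g := by
  ext1 v
  rw [Th_apply, ← prj_sum D.φ (g v)]
  refine Finset.sum_congr rfl fun u _ => ?_
  rw [prj_rename, Th'_apply, map_sum, Finset.sum_eq_single u]
  · rw [← prj_rename, rename_rename_inv, prj_prj, if_pos rfl]
    simp [pm_mul, pm_one]
  · intro w _ hw
    have : ∀ q : MvPolynomial X K, rename (w⁻¹ : Perm X) (prj D.φ w q) =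
        prj D.ψ w (rename (w⁻¹ : Perm X) q) := fun q => by
      conv_lhs => rw [← rename_rename_inv w q]
      rw [prj_rename, rename_inv_rename]
    rw [this, prj_prj, if_neg hw.symm]
  · simp

lemma kd_Th (D : IData X) (n : ℕ) (g : (X → K) [⋀^Fin (n+1)]→ₗ[K] MvPolynomial X K) :
    kd D.σ (D.T K) n (Th D g) = Th D (sd n g) := by
  ext1 v
  rw [kd_apply, Th_apply]
  have h1 : ∀ x : X, D.T K x (Th D g (Fin.cons (pm K (D.σ x)⁻¹ (bv K x))
      (fun i => pm K (D.σ x)⁻¹ (v i)))) = ∑ u : Perm X, prj D.φ u (rename u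
        (mX (u⁻¹ x) (g (Fin.cons (bv K (u⁻¹ x)) (fun i => pm K u⁻¹ (v i)))))) := by
    intro x
    rw [Th_apply, map_sum]
    refine Fintype.sum_equiv (Equiv.mulLeft (D.σ x)) _ _ fun u => ?_
    rw [T_prj]
    simp only [Equiv.coe_mulLeft]
    congr 1
    rw [IData.T, IData.S_apply, mX, LinearMap.mulLeft_apply, map_mul, rename_X, rename_rename]
    rw [perm_app_inv]
    congr 2
    congr 1
    ext i : 1
    refine Fin.cases ?_ (fun i => ?_) i
    · simp [pm_bv]
    · simp [pm_mul]
  simp only [h1]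
  rw [Finset.sum_comm]
  refine Finset.sum_congr rfl fun u _ => ?_
  rw [← map_sum, ← map_sum]
  congr 2
  rw [sd_eq, alt_sum_apply]
  refine Fintype.sum_equiv (u⁻¹ : Perm X) _ _ fun x => ?_
  rfl

lemma tw_exact (D : IData X) (n : ℕ) (f : (X → K) [⋀^Fin (n+1)]→ₗ[K] MvPolynomial X K)
    (hf : kd D.σ (D.T K) n f = 0) : ∃ h, kd D.σ (D.T K) (n+1) h = f := by
  have h1 : sd n (Th' D f) = 0 := by
    rw [← Th'_Th D (sd n (Th' D f)), ← kd_Th, Th_Th', hf]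
    ext1 v
    simp [Th'_apply]
  obtain ⟨h, hh⟩ := sd_exact n _ h1
  exact ⟨Th D h, by rw [kd_Th, hh, Th_Th']⟩

end proj
end YBDom

namespace YBDom
open Equiv MvPolynomial
set_option linter.unusedSectionVars false
set_option linter.unusedSimpArgs false

section act
variable {X : Type*} (D : IData X) (K : Type*) [Field K]

/-- the central-type subalgebra -/
noncomputable def Cs : Subalgebra K (MvPolynomial X K) :=
  (expand D.N : MvPolynomial X K →ₐ[K] MvPolynomial X K).range

/-- twisted multiplication -/
noncomputable def Act : MvPolynomial X K →ₗ[K] MvPolynomial X K →ₗ[K] MvPolynomial X K :=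
  (basisMonomials X K).constr K (fun a => D.S K a)

lemma Act_monomial (a : X →₀ ℕ) : Act D K (monomial a 1) = D.S K a := by
  have := (basisMonomials X K).constr_basis K (fun a => D.S K a) a
  rwa [coe_basisMonomials] at this

lemma S_monomial (a b : X →₀ ℕ) :
    D.S K a (monomial b 1) = monomial (a + Finsupp.mapDomain (D.φ a) b) 1 := by
  rw [IData.S_apply, rename_monomial, monomial_mul, one_mul]

lemma Act_S (b : X →₀ ℕ) (p q : MvPolynomial X K) :
    Act D K (D.S K b p) q = D.S K b (Act D K p q) := by
  have : (Act D K).flip q ∘ₗ D.S K b = D.S K b ∘ₗ (Act D K).flip q := by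
    apply lin_ext
    intro a
    simp only [LinearMap.comp_apply, LinearMap.flip_apply, S_monomial, Act_monomial]
    rw [IData.S_S]
  exact LinearMap.congr_fun this p

lemma S_zero (p : MvPolynomial X K) : D.S K 0 p = p := by
  rw [IData.S_apply, D.zero, Perm.coe_one, rename_id]
  simp

lemma Act_one (q : MvPolynomial X K) : Act D K 1 q = q := by
  have : Act D K (monomial 0 1) q = q := by rw [Act_monomial, S_zero]
  exact this

lemma Act_C (k : K) (q : MvPolynomial X K) : Act D K (C k) q = k • q := by
  rw [show (C k : MvPolynomial X K) = k • 1 from by rw [smul_eq_C_mul, mul_one], map_smul,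
    LinearMap.smul_apply, Act_one]

lemma expand_mono (a : X →₀ ℕ) :
    expand D.N (monomial a (1:K)) = monomial (D.N • a) 1 := by
  rw [expand_monomial]

lemma S_N (a b : X →₀ ℕ) (q : MvPolynomial X K) :
    D.S K (D.N • a + b) q = monomial (D.N • a) 1 * D.S K b q := by
  rw [IData.S_apply, IData.S_apply, D.add_N, ← mul_assoc, monomial_mul, one_mul]

lemma Act_expand (c p q : MvPolynomial X K) :
    Act D K (expand D.N c * p) q = expand D.N c * Act D K p q := by
  have : LinearMap.compr₂ ((LinearMap.mul K (MvPolynomial X K)).comp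
      (expand D.N : MvPolynomial X K →ₐ[K] _).toLinearMap) ((Act D K).flip q) =
    ((LinearMap.mul K (MvPolynomial X K)).comp
      (expand D.N : MvPolynomial X K →ₐ[K] _).toLinearMap).compl₂ ((Act D K).flip q) := by
    apply lin_ext
    intro a
    apply lin_ext
    intro b
    simp only [LinearMap.compr₂_apply, LinearMap.comp_apply, LinearMap.compl₂_apply,
      AlgHom.toLinearMap_apply, LinearMap.mul_apply', LinearMap.flip_apply]
    rw [expand_mono, monomial_mul, one_mul, Act_monomial, Act_monomial, S_N]
  exact LinearMap.congr_fun₂ this c p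

lemma Act_Cs (c : Cs D K) (p q : MvPolynomial X K) :
    Act D K (c • p) q = c • Act D K p q := by
  obtain ⟨c, c', rfl⟩ := c
  exact Act_expand D K c' p q

lemma Act_Cs_one (c : Cs D K) (q : MvPolynomial X K) : Act D K (c : MvPolynomial X K) q = c • q := by
  have := Act_Cs D K c 1 q
  rw [Act_one] at this
  rw [← this, Subalgebra.smul_def, smul_eq_mul, mul_one]

lemma degree_mapDomain (u : Perm X) (a : X →₀ ℕ) : (Finsupp.mapDomain u a).degree = a.degree := by
  exact Finsupp.degree_mapDomain (⇑u) a

open Classical in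
lemma HC_monomial (m : ℕ) (a : X →₀ ℕ) :
    homogeneousComponent m (monomial a (1:K)) = if a.degree = m then monomial a 1 else 0 := by
  ext b
  rw [coeff_homogeneousComponent]
  by_cases h : a = b
  · subst h; split_ifs <;> simp
  · split_ifs <;> simp [coeff_monomial, h]

open Classical in
lemma HC_S (m : ℕ) (a : X →₀ ℕ) (q : MvPolynomial X K) :
    homogeneousComponent m (D.S K a q) =
      if a.degree ≤ m then D.S K a (homogeneousComponent (m - a.degree) q) else 0 := by
  have : homogeneousComponent m ∘ₗ D.S K a =
    if a.degree ≤ m then D.S K a ∘ₗ (homogeneousComponent (m - a.degree)) else 0 := by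
    apply lin_ext
    intro b
    rw [LinearMap.comp_apply, S_monomial, HC_monomial, map_add, degree_mapDomain]
    by_cases h : a.degree ≤ m
    · rw [if_pos h, LinearMap.comp_apply, HC_monomial]
      by_cases h' : b.degree = m - a.degree
      · rw [if_pos h', if_pos (by omega), S_monomial]
      · rw [if_neg h', if_neg (by omega), map_zero]
    · rw [if_neg h, if_neg (by omega)]; rfl
  have h := LinearMap.congr_fun this q
  rw [LinearMap.comp_apply] at h
  rw [h]
  split_ifs <;> rfl

open Classical in
lemma HC_HC (m n : ℕ) (q : MvPolynomial X K) :
    homogeneousComponent m (homogeneousComponent n q) =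
      if m = n then homogeneousComponent n q else 0 := by
  ext a
  rw [coeff_homogeneousComponent]
  split_ifs with h1 h2 h2
  · rfl
  · rw [coeff_homogeneousComponent, if_neg (by omega), coeff_zero]
  · subst h2; rw [coeff_homogeneousComponent, if_neg h1]
  · rfl

open Classical in
/-- grading for homogeneous right factor -/
lemma HC_Act (m e : ℕ) (p q : MvPolynomial X K) (hq : homogeneousComponent e q = q) :
    homogeneousComponent m (Act D K p q) =
      if e ≤ m then Act D K (homogeneousComponent (m - e) p) q else 0 := by
  have : homogeneousComponent m ∘ₗ (Act D K).flip q =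
    if e ≤ m then (Act D K).flip q ∘ₗ (homogeneousComponent (m - e)) else 0 := by
    apply lin_ext
    intro a
    rw [LinearMap.comp_apply, LinearMap.flip_apply, Act_monomial, HC_S, ← hq, HC_HC]
    by_cases h : e ≤ m
    · rw [if_pos h, LinearMap.comp_apply, HC_monomial]
      by_cases h' : a.degree = m - e
      · rw [if_pos h', if_pos (by omega), if_pos (by omega), LinearMap.flip_apply, Act_monomial, hq]
      · rw [if_neg h', map_zero]
        split_ifs with h1 h2
        · omega
        · simp
        · rfl
    · rw [if_neg h]
      split_ifs with h1 h2
      · omega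
      · simp
      · rfl
  have h := LinearMap.congr_fun this p
  rw [LinearMap.comp_apply] at h
  rw [LinearMap.flip_apply] at h
  rw [h]
  split_ifs <;> rfl

lemma HC_zero_of_gt (m : ℕ) (q : MvPolynomial X K) (h : q.totalDegree < m) :
    homogeneousComponent m q = 0 := homogeneousComponent_eq_zero _ _ h

lemma HC_top (p q : MvPolynomial X K) :
    homogeneousComponent (p.totalDegree + q.totalDegree) (Act D K p q) =
      Act D K (homogeneousComponent p.totalDegree p) (homogeneousComponent q.totalDegree q) := by
  classical
  obtain ⟨M, hM⟩ : ∃ M, M = q.totalDegree := ⟨_, rfl⟩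
  have hq : q = ∑ i ∈ Finset.range (M + 1), homogeneousComponent i q := by
    rw [hM]; exact (sum_homogeneousComponent q).symm
  rw [← hM]
  conv_lhs => rw [hq, map_sum, map_sum]
  rw [Finset.sum_range_succ, HC_Act D K _ M, Finset.sum_eq_zero, zero_add, if_pos (by omega)]
  · rw [Nat.add_sub_cancel]
  · intro j hj
    rw [Finset.mem_range] at hj
    rw [HC_Act D K _ j, if_pos (by omega), HC_zero_of_gt K _ p (by omega)]
    · simp
    · rw [HC_HC, if_pos rfl]
  · rw [HC_HC, if_pos rfl]

lemma HC_top_ne (p : MvPolynomial X K) (hp : p ≠ 0) : homogeneousComponent p.totalDegree p ≠ 0 := by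
  obtain ⟨a, ha, h⟩ := p.support.exists_mem_eq_sup (by simpa using hp) (fun s => s.sum fun _ e => e)
  intro h0
  have := congrArg (coeff a) h0
  rw [coeff_homogeneousComponent, if_pos, coeff_zero] at this
  · exact (mem_support_iff.1 ha) this
  · rw [totalDegree, h]; rfl

end act
end YBDom

namespace YBDom
open Equiv MvPolynomial
set_option linter.unusedSectionVars false
set_option linter.unusedSimpArgs false

section mods
variable {X : Type*} [Fintype X] [DecidableEq X] (D : IData X) (K : Type*) [Field K]

/-- coordinatewise action -/
noncomputable def SF (k : ℕ) (a : X →₀ ℕ) :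
    (Fin k → MvPolynomial X K) →ₗ[K] (Fin k → MvPolynomial X K) := (D.S K a).compLeft (Fin k)

lemma SF_apply (k : ℕ) (a : X →₀ ℕ) (v : Fin k → MvPolynomial X K) (j : Fin k) :
    SF D K k a v j = D.S K a (v j) := rfl

/-- coordinatewise action of generators -/
noncomputable def TF (k : ℕ) (x : X) :
    (Fin k → MvPolynomial X K) →ₗ[K] (Fin k → MvPolynomial X K) := SF D K k (Finsupp.single x 1)

lemma TF_apply (k : ℕ) (x : X) (v : Fin k → MvPolynomial X K) (j : Fin k) :
    TF D K k x v j = D.T K x (v j) := rfl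

lemma TF_TF (k : ℕ) (x y : X) (p : Fin k → MvPolynomial X K) :
    TF D K k x (TF D K k y p) = TF D K k (D.σ x y) (TF D K k ((D.σ (D.σ x y))⁻¹ x) p) := by
  ext1 j
  simp only [TF_apply]
  exact D.T_T K x y _

/-- Exactness in degree `i+1` of the twisted Koszul complex of `N`. -/
def Ex {k : ℕ} (N : Submodule (Cs D K) (Fin k → MvPolynomial X K)) (i : ℕ) : Prop :=
  ∀ f : (X → K) [⋀^Fin (i+1)]→ₗ[K] (Fin k → MvPolynomial X K), (∀ v, f v ∈ N) →
    kd D.σ (TF D K k) i f = 0 →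
    ∃ g : (X → K) [⋀^Fin (i+2)]→ₗ[K] (Fin k → MvPolynomial X K), (∀ v, g v ∈ N) ∧
      kd D.σ (TF D K k) (i+1) g = f

lemma F_exact (k i : ℕ) (f : (X → K) [⋀^Fin (i+1)]→ₗ[K] (Fin k → MvPolynomial X K))
    (hf : kd D.σ (TF D K k) i f = 0) :
    ∃ g : (X → K) [⋀^Fin (i+2)]→ₗ[K] (Fin k → MvPolynomial X K),
      kd D.σ (TF D K k) (i+1) g = f := by
  have h : ∀ j : Fin k, ∃ h, kd D.σ (D.T K) (i+1) h =
      (LinearMap.proj j : (Fin k → MvPolynomial X K) →ₗ[K] _).compAlternatingMap f := by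
    intro j
    apply tw_exact
    rw [kd_comp D.σ (TF D K k) (D.T K) (LinearMap.proj j) (fun x m => rfl), hf]
    ext1 v
    simp
  choose h hh using h
  refine ⟨AlternatingMap.pi h, ?_⟩
  ext1 v
  ext1 j
  have := congrArg (fun z => z v) (hh j)
  simp only [LinearMap.compAlternatingMap_apply, LinearMap.proj_apply] at this
  rw [← this, kd_apply, kd_apply, Finset.sum_apply]
  rfl

variable {D K}

lemma lift_alt {k k' : ℕ} (f : (Fin k' → MvPolynomial X K) →ₗ[Cs D K] (Fin k → MvPolynomial X K))
    {n : ℕ} (w : (X → K) [⋀^Fin n]→ₗ[K] (Fin k → MvPolynomial X K))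
    (hw : ∀ v, w v ∈ LinearMap.range f) :
    ∃ w' : (X → K) [⋀^Fin n]→ₗ[K] (Fin k' → MvPolynomial X K), 
      (f.restrictScalars K).compAlternatingMap w' = w := by
  obtain ⟨s, hs⟩ := LinearMap.exists_rightInverse_of_surjective (f.restrictScalars K).rangeRestrict
    (LinearMap.range_rangeRestrict _)
  obtain ⟨t, ht⟩ := LinearMap.exists_extend s
  refine ⟨t.compAlternatingMap w, ?_⟩
  ext1 v
  have h1 : t (w v) = s ⟨w v, hw v⟩ := LinearMap.congr_fun ht ⟨w v, hw v⟩
  have h2 := LinearMap.congr_fun hs ⟨w v, hw v⟩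
  simp only [LinearMap.compAlternatingMap_apply, h1]
  exact congrArg Subtype.val h2

lemma Ex_chase {k k' : ℕ} (f : (Fin k' → MvPolynomial X K) →ₗ[Cs D K] (Fin k → MvPolynomial X K))
    (hf : ∀ x v, f (TF D K k' x v) = TF D K k x (f v)) (i : ℕ) (hE : Ex D K (LinearMap.range f) i)
    (y : (X → K) [⋀^Fin (i+1)]→ₗ[K] (Fin k' → MvPolynomial X K))
    (hy : ∀ v, kd D.σ (TF D K k') i y v ∈ LinearMap.ker f) :
    ∃ y' : (X → K) [⋀^Fin (i+1)]→ₗ[K] (Fin k' → MvPolynomial X K),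
      (∀ v, y' v ∈ LinearMap.ker f) ∧ kd D.σ (TF D K k') i y' = kd D.σ (TF D K k') i y := by
  obtain ⟨w', hw', hw2⟩ := hE ((f.restrictScalars K).compAlternatingMap y) (fun v => ⟨_, rfl⟩) (by
    rw [kd_comp D.σ (TF D K k') (TF D K k) (f.restrictScalars K) hf]
    ext1 v
    exact hy v)
  obtain ⟨w, hw⟩ := lift_alt f w' hw'
  refine ⟨y - kd D.σ (TF D K k') (i+1) w, ?_, ?_⟩
  · intro v
    rw [← hw, kd_comp D.σ (TF D K k') (TF D K k) (f.restrictScalars K) hf] at hw2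
    have := congrArg (fun z => z v) hw2
    simp only [LinearMap.compAlternatingMap_apply, LinearMap.restrictScalars_apply] at this
    rw [LinearMap.mem_ker, AlternatingMap.sub_apply, map_sub, this, sub_self]
  · rw [kd_sub, kd_kd _ _ D.σ_rel (TF_TF D K k'), sub_zero]

lemma Ex_ker {k k' : ℕ} (f : (Fin k' → MvPolynomial X K) →ₗ[Cs D K] (Fin k → MvPolynomial X K))
    (hf : ∀ x v, f (TF D K k' x v) = TF D K k x (f v)) (i : ℕ)
    (hE : Ex D K (LinearMap.range f) (i+1)) : Ex D K (LinearMap.ker f) i := by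
  intro z hz hkz
  obtain ⟨y, hy⟩ := F_exact D K k' i z hkz
  obtain ⟨y', h1, h2⟩ := Ex_chase f hf (i+1) hE y (by rw [hy]; exact hz)
  exact ⟨y', h1, h2.trans hy⟩

variable (D K)

lemma q_inj : Function.Injective (fun x => (D.σ x)⁻¹ x) := by
  have h : ∀ x, D.ψ (Finsupp.single ((D.σ x)⁻¹ x) 1) = D.σ x := by
    intro x
    rw [← D.psi_iff, Finsupp.mapDomain_single, perm_app_inv]
    rfl
  intro x y hxy
  have hxy' : (D.σ x)⁻¹ x = (D.σ y)⁻¹ y := hxy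
  have h1 := h x
  rw [hxy', h y] at h1
  rw [h1] at hxy'
  exact (D.σ x)⁻¹.injective hxy'

lemma one_form {k : ℕ} (m : X → Fin k → MvPolynomial X K) :
    ∃ y : (X → K) [⋀^Fin 1]→ₗ[K] (Fin k → MvPolynomial X K), ∀ v,
      kd D.σ (TF D K k) 0 y v = ∑ x, TF D K k x (m x) := by
  refine ⟨AlternatingMap.ofSubsingleton K (X → K) _ 0
    (∑ x : X, (LinearMap.proj ((D.σ x)⁻¹ x) : (X → K) →ₗ[K] K).smulRight (m x)), ?_⟩
  intro v
  rw [kd_apply]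
  refine Finset.sum_congr rfl fun x _ => ?_
  congr 1
  simp only [AlternatingMap.ofSubsingleton_apply_apply, Fin.cons_zero, pm_bv, LinearMap.sum_apply,
    LinearMap.smulRight_apply, LinearMap.proj_apply]
  simp only [bv]
  rw [Finset.sum_eq_single x]
  · simp
  · intro b _ hb
    rw [Pi.single_eq_of_ne, zero_smul]
    exact fun h => hb (q_inj D h)
  · simp

lemma const_zero (p : MvPolynomial X K) (hp : constantCoeff p = 0) :
    ∃ h : X → MvPolynomial X K, p = ∑ x, D.T K x (h x) := by
  have h1 : p ∈ Ideal.span (Set.range (MvPolynomial.X : X → MvPolynomial X K)) := by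
    rw [← Set.image_univ, mem_ideal_span_X_image]
    intro m hm
    by_contra hcon
    push Not at hcon
    have : m = 0 := by ext x; simpa using hcon x (Set.mem_univ _)
    subst this
    exact (mem_support_iff.1 hm) hp
  rw [Ideal.mem_span_range_iff_exists_fun] at h1
  obtain ⟨c, hc⟩ := h1
  refine ⟨fun x => rename ((D.σ x)⁻¹ : Perm X) (c x), ?_⟩
  rw [← hc]
  refine Finset.sum_congr rfl fun x _ => ?_
  rw [IData.T, IData.S_apply, mul_comm]
  congr 1
  exact (rename_rename_inv (D.σ x) (c x)).symm

variable {D K}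

lemma Ex_zero {k k' : ℕ} (f : (Fin k' → MvPolynomial X K) →ₗ[Cs D K] (Fin k → MvPolynomial X K))
    (hf : ∀ x v, f (TF D K k' x v) = TF D K k x (f v)) (hE : Ex D K (LinearMap.range f) 0)
    (hc : ∀ z ∈ LinearMap.ker f, ∀ j, constantCoeff (z j) = 0) : LinearMap.ker f = ⊥ := by
  have h1 : ∀ z ∈ LinearMap.ker f, ∃ m : X → Fin k' → MvPolynomial X K,
      (∀ x, m x ∈ LinearMap.ker f) ∧ z = ∑ x, TF D K k' x (m x) := by
    intro z hz
    have h2 : ∀ j, ∃ h : X → MvPolynomial X K, z j = ∑ x, D.T K x (h x) :=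
      fun j => const_zero D K _ (hc z hz j)
    choose h hh using h2
    obtain ⟨y, hy⟩ := one_form D K (fun x j => h j x)
    have h3 : ∑ x, TF D K k' x (fun j => h j x) = z := by
      ext1 j
      rw [hh, Finset.sum_apply]
      rfl
    obtain ⟨y', hy1, hy2⟩ := Ex_chase f hf 0 hE y (fun v => by rw [hy, h3]; exact hz)
    refine ⟨fun x => y' (Fin.cons (pm K (D.σ x)⁻¹ (bv K x)) (fun i => 0)), fun x => hy1 _, ?_⟩
    rw [← h3, ← hy 0, ← hy2, kd_apply]
    refine Finset.sum_congr rfl fun x _ => ?_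
    congr 3
  have h2 : ∀ m : ℕ, ∀ z ∈ LinearMap.ker f, ∀ j, homogeneousComponent m (z j) = 0 := by
    intro m
    induction m with
    | zero =>
      intro z hz j
      obtain ⟨w, hw, rfl⟩ := h1 z hz
      rw [Finset.sum_apply, map_sum]
      refine Finset.sum_eq_zero fun x _ => ?_
      rw [TF_apply, IData.T, HC_S, if_neg (by simp)]
    | succ m ih =>
      intro z hz j
      obtain ⟨w, hw, rfl⟩ := h1 z hz
      rw [Finset.sum_apply, map_sum]
      refine Finset.sum_eq_zero fun x _ => ?_
      rw [TF_apply, IData.T, HC_S, if_pos (by simp), Finsupp.degree_single, Nat.add_sub_cancel,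
        ih _ (hw x), map_zero]
  rw [eq_bot_iff]
  intro z hz
  rw [Submodule.mem_bot]
  ext1 j
  rw [← sum_homogeneousComponent (z j)]
  exact Finset.sum_eq_zero fun m _ => h2 m z hz j

lemma Ex_big {k : ℕ} (N : Submodule (Cs D K) (Fin k → MvPolynomial X K)) :
    Ex D K N (Fintype.card X) := by
  intro f _ _
  refine ⟨0, fun v => N.zero_mem, ?_⟩
  rw [kd_zero]
  symm
  apply (Pi.basisFun K X).ext_alternating
  intro v hv
  exact absurd (Fintype.card_le_of_injective v hv) (by simp)

end mods
end YBDom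

namespace YBDom
open Equiv MvPolynomial
set_option linter.unusedSectionVars false
set_option linter.unusedSimpArgs false

section gens
variable {X : Type*} [Fintype X] [DecidableEq X] (D : IData X) (K : Type*) [Field K]

/-- the map from a free module given by a family of elements. -/
noncomputable def actF {k k' : ℕ} (n : Fin k' → Fin k → MvPolynomial X K) :
    (Fin k' → MvPolynomial X K) →ₗ[Cs D K] (Fin k → MvPolynomial X K) where
  toFun p j := ∑ i, Act D K (p i) (n i j)
  map_add' p q := by
    ext1 j
    simp [Finset.sum_add_distrib]
  map_smul' c p := by
    ext1 j
    simp only [Pi.smul_apply, Act_Cs, Finset.smul_sum, RingHom.id_apply]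

lemma actF_apply {k k' : ℕ} (n : Fin k' → Fin k → MvPolynomial X K) (p : Fin k' → MvPolynomial X K)
    (j : Fin k) : actF D K n p j = ∑ i, Act D K (p i) (n i j) := rfl

lemma actF_SF {k k' : ℕ} (n : Fin k' → Fin k → MvPolynomial X K) (a : X →₀ ℕ)
    (p : Fin k' → MvPolynomial X K) : actF D K n (SF D K k' a p) = SF D K k a (actF D K n p) := by
  ext1 j
  simp only [actF_apply, SF_apply, Act_S, map_sum]

/-- graded projections -/
noncomputable def pr {k : ℕ} (d : Fin k → ℕ) (m : ℕ) :
    (Fin k → MvPolynomial X K) →ₗ[K] (Fin k → MvPolynomial X K) :=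
  LinearMap.pi fun i => if d i ≤ m then homogeneousComponent (m - d i) ∘ₗ LinearMap.proj i else 0

lemma pr_apply {k : ℕ} (d : Fin k → ℕ) (m : ℕ) (v : Fin k → MvPolynomial X K) (i : Fin k) :
    pr K d m v i = if d i ≤ m then homogeneousComponent (m - d i) (v i) else 0 := by
  simp only [pr, LinearMap.pi_apply]
  split_ifs <;> rfl

lemma pr_pr {k : ℕ} (d : Fin k → ℕ) (m l : ℕ) (v : Fin k → MvPolynomial X K) :
    pr K d m (pr K d l v) = if m = l then pr K d l v else 0 := by
  classical
  ext1 i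
  by_cases h : m = l
  · subst h
    rw [if_pos rfl, pr_apply, pr_apply]
    split_ifs
    · rw [HC_HC, if_pos rfl]
    · rfl
  · rw [if_neg h, pr_apply, pr_apply, Pi.zero_apply]
    split_ifs
    · rw [HC_HC, if_neg (by omega)]
    · simp
    · rfl

lemma pr_sum {k : ℕ} (d : Fin k → ℕ) (v : Fin k → MvPolynomial X K) :
    ∃ M, ∀ M' ≥ M, ∑ m ∈ Finset.range M', pr K d m v = v := by
  refine ⟨Finset.univ.sup (fun i => d i + (v i).totalDegree + 1), fun M' hM' => ?_⟩
  ext1 i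
  have hi : d i + (v i).totalDegree + 1 ≤ M' :=
    (Finset.le_sup (f := fun i => d i + (v i).totalDegree + 1) (Finset.mem_univ i)).trans hM'
  rw [Finset.sum_apply]
  obtain ⟨c, rfl⟩ : ∃ c, M' = d i + ((v i).totalDegree + 1) + c := ⟨M' - (d i + (v i).totalDegree + 1), by omega⟩
  rw [Finset.sum_range_add, Finset.sum_range_add, Finset.sum_eq_zero, zero_add, ]
  · rw [Finset.sum_eq_zero (s := Finset.range c), add_zero]
    · conv_rhs => rw [← sum_homogeneousComponent (v i)]
      refine Finset.sum_congr rfl fun m _ => ?_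
      rw [pr_apply, if_pos (by omega), Nat.add_sub_cancel_left]
    · intro m _
      rw [pr_apply]
      split_ifs
      · exact HC_zero_of_gt K _ _ (by omega)
      · rfl
  · intro m hm
    rw [Finset.mem_range] at hm
    rw [pr_apply, if_neg (by omega)]

/-- stable homogeneous submodules. -/
structure HSt {k : ℕ} (d : Fin k → ℕ) (N : Submodule (Cs D K) (Fin k → MvPolynomial X K)) : Prop where
  st : ∀ a, ∀ v ∈ N, SF D K k a v ∈ N
  ho : ∀ m, ∀ v ∈ N, pr K d m v ∈ N

/-- homogeneous family -/
def HFam {k k' : ℕ} (d : Fin k → ℕ) (d' : Fin k' → ℕ) (n : Fin k' → Fin k → MvPolynomial X K) : Prop :=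
  ∀ i, pr K d (d' i) (n i) = n i

lemma pr_actF {k k' : ℕ} (d : Fin k → ℕ) (d' : Fin k' → ℕ) (n : Fin k' → Fin k → MvPolynomial X K)
    (hn : HFam K d d' n) (m : ℕ) (p : Fin k' → MvPolynomial X K) :
    pr K d m (actF D K n p) = actF D K n (pr K d' m p) := by
  classical
  ext1 j
  rw [pr_apply, actF_apply, actF_apply]
  by_cases hj : d j ≤ m
  · rw [if_pos hj, map_sum]
    refine Finset.sum_congr rfl fun i _ => ?_
    have h := congrFun (hn i) j
    rw [pr_apply] at h
    split_ifs at h with h1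
    · rw [HC_Act D K _ _ _ _ h, pr_apply]
      by_cases h2 : d' i ≤ m
      · rw [if_pos h2, if_pos (by omega)]
        rw [show m - d j - (d' i - d j) = m - d' i by omega]
      · rw [if_neg h2, if_neg (by omega)]
        simp
    · rw [← h]; simp
  · rw [if_neg hj]
    symm
    refine Finset.sum_eq_zero fun i _ => ?_
    have h := congrFun (hn i) j
    rw [pr_apply] at h
    split_ifs at h with h1
    · rw [pr_apply, if_neg (by omega)]
      simp
    · rw [← h]; simp

lemma ker_HSt {k k' : ℕ} (d : Fin k → ℕ) (d' : Fin k' → ℕ) (n : Fin k' → Fin k → MvPolynomial X K)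
    (hn : HFam K d d' n) : HSt D K d' (LinearMap.ker (actF D K n)) where
  st a v hv := by
    rw [LinearMap.mem_ker] at *
    rw [actF_SF, hv, map_zero]
  ho m v hv := by
    rw [LinearMap.mem_ker] at *
    rw [← pr_actF D K d d' n hn, hv, map_zero]

lemma range_HSt {k k' : ℕ} (d : Fin k → ℕ) (d' : Fin k' → ℕ) (n : Fin k' → Fin k → MvPolynomial X K)
    (hn : HFam K d d' n) : HSt D K d (LinearMap.range (actF D K n)) where
  st a v hv := by
    obtain ⟨v, rfl⟩ := hv
    exact ⟨_, actF_SF D K n a v⟩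
  ho m v hv := by
    obtain ⟨v, rfl⟩ := hv
    exact ⟨_, (pr_actF D K d d' n hn m v).symm⟩

lemma Act_mem {k : ℕ} (N : Submodule (Cs D K) (Fin k → MvPolynomial X K))
    (hN : ∀ a, ∀ v ∈ N, SF D K k a v ∈ N) (p : MvPolynomial X K) (v : Fin k → MvPolynomial X K)
    (hv : v ∈ N) : (fun j => Act D K p (v j)) ∈ N := by
  induction p using MvPolynomial.induction_on' with
  | monomial a c =>
    have : (fun j => Act D K (monomial a c) (v j)) = c • SF D K k a v := by
      ext1 j
      rw [Pi.smul_apply, SF_apply, ← Act_monomial, ← LinearMap.smul_apply, ← map_smul,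
        smul_monomial, smul_eq_mul, mul_one]
    rw [this]
    exact Submodule.smul_of_tower_mem N c (hN a v hv)
  | add p q hp hq =>
    have := N.add_mem hp hq
    convert this using 1
    ext1 j
    simp

lemma range_le {k k' : ℕ} (N : Submodule (Cs D K) (Fin k → MvPolynomial X K))
    (hN : ∀ a, ∀ v ∈ N, SF D K k a v ∈ N) (n : Fin k' → Fin k → MvPolynomial X K)
    (hn : ∀ i, n i ∈ N) : LinearMap.range (actF D K n) ≤ N := by
  rintro _ ⟨p, rfl⟩
  have : actF D K n p = ∑ i, fun j => Act D K (p i) (n i j) := by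
    ext1 j
    rw [actF_apply, Finset.sum_apply]
  rw [this]
  exact N.sum_mem fun i _ => Act_mem D K N hN _ _ (hn i)

lemma gen_mem {k k' : ℕ} (n : Fin k' → Fin k → MvPolynomial X K) (i : Fin k') :
    n i ∈ LinearMap.range (actF D K n) := by
  refine ⟨Pi.single i 1, ?_⟩
  ext1 j
  rw [actF_apply, Finset.sum_eq_single i]
  · simp [Act_one]
  · intro b _ hb
    simp [Pi.single_eq_of_ne hb]
  · simp

/-- finite generation -/
def Gen {k : ℕ} (d : Fin k → ℕ) (N : Submodule (Cs D K) (Fin k → MvPolynomial X K)) (k' : ℕ) : Prop :=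
  ∃ (d' : Fin k' → ℕ) (n : Fin k' → Fin k → MvPolynomial X K), HFam K d d' n ∧
    LinearMap.range (actF D K n) = N

lemma exists_gen {k : ℕ} (d : Fin k → ℕ) (N : Submodule (Cs D K) (Fin k → MvPolynomial X K))
    (hN : HSt D K d N) (hfg : N.FG) : ∃ k', Gen D K d N k' := by
  classical
  obtain ⟨s, hs⟩ := hfg
  choose M hM using pr_sum (X := X) K d
  set B := s.sup M with hB
  let I := s × Fin B
  let e : I ≃ Fin (Fintype.card I) := Fintype.equivFin I
  refine ⟨Fintype.card I, fun i => ((e.symm i).2 : ℕ), fun i => pr K d (e.symm i).2 (e.symm i).1.1, ?_, ?_⟩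
  · intro i
    rw [pr_pr, if_pos rfl]
  · apply le_antisymm
    · apply range_le D K N hN.st
      intro i
      apply hN.ho
      rw [← hs]
      exact Submodule.subset_span (e.symm i).1.2
    · conv_lhs => rw [← hs]
      rw [Submodule.span_le]
      intro v hv
      rw [SetLike.mem_coe, ← hM v B (Finset.le_sup hv)]
      refine Submodule.sum_mem _ fun m hm => ?_
      have := gen_mem D K (fun i => pr K d (e.symm i).2 (e.symm i).1.1) (e (⟨v, hv⟩, ⟨m, Finset.mem_range.1 hm⟩))
      simpa using this

lemma exists_min_gen {k : ℕ} (d : Fin k → ℕ) (N : Submodule (Cs D K) (Fin k → MvPolynomial X K))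
    (hN : HSt D K d N) (hfg : N.FG) : ∃ (k' : ℕ) (d' : Fin k' → ℕ)
      (n : Fin k' → Fin k → MvPolynomial X K), HFam K d d' n ∧
    LinearMap.range (actF D K n) = N ∧
    ∀ z ∈ LinearMap.ker (actF D K n), ∀ i, constantCoeff (z i) = 0 := by
  classical
  have hex := exists_gen D K d N hN hfg
  obtain ⟨d', n, hn, hr⟩ := Nat.find_spec hex
  have hmin : ∀ l, Gen D K d N l → Nat.find hex ≤ l := fun l hl => Nat.find_min' hex hl
  generalize Nat.find hex = k' at *
  refine ⟨k', d', n, hn, hr, ?_⟩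
  intro z hz i
  by_contra hc
  obtain _ | k'' := k'
  · exact i.elim0
  have hz2 := (ker_HSt D K d d' n hn).ho (d' i) z hz
  set w := pr K d' (d' i) z with hw
  have hwi : w i = C (constantCoeff (z i)) := by
    rw [hw, pr_apply, if_pos le_rfl, Nat.sub_self, homogeneousComponent_zero]
    rfl
  set n' : Fin k'' → Fin k → MvPolynomial X K := fun l => n (i.succAbove l) with hn'
  have hn'H : HFam K d (fun l => d' (i.succAbove l)) n' := fun l => hn _
  have hi : n i ∈ LinearMap.range (actF D K n') := by
    refine ⟨(-(constantCoeff (z i))⁻¹) • fun l => w (i.succAbove l), ?_⟩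
    ext1 j
    have h := congrFun (LinearMap.mem_ker.1 hz2) j
    rw [actF_apply, Fin.sum_univ_succAbove _ i, hwi, Act_C, Pi.zero_apply] at h
    rw [actF_apply]
    simp only [Pi.smul_apply, map_smul, LinearMap.smul_apply]
    rw [← Finset.smul_sum, eq_neg_of_add_eq_zero_right h, smul_neg, neg_smul, neg_neg, smul_smul,
      inv_mul_cancel₀ hc, one_smul]
  have : Gen D K d N k'' := by
    refine ⟨_, n', hn'H, le_antisymm ?_ ?_⟩
    · apply range_le D K N hN.st
      intro l
      rw [← hr]
      exact gen_mem D K n _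
    · rw [← hr]
      apply range_le D K _ (range_HSt D K _ _ n' hn'H).st
      intro l
      by_cases hl : l = i
      · rw [hl]; exact hi
      · obtain ⟨l', rfl⟩ := Fin.exists_succAbove_eq hl
        exact gen_mem D K n' l'
  have := hmin _ this
  omega

end gens
end YBDom

namespace YBDom
open Equiv MvPolynomial
set_option linter.unusedSectionVars false
set_option linter.unusedSimpArgs false

section generic
variable {R M M' : Type*} [CommRing R] [IsDomain R] [IsNoetherianRing R] [AddCommGroup M] [Module R M]
  [AddCommGroup M'] [Module R M']

/-- rank of a submodule -/
noncomputable def rk (N : Submodule R M) : ℕ := Module.finrank R N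

lemma rk_range_add_ker [Module.Finite R M] (f : M →ₗ[R] M') :
    rk (LinearMap.range f) + rk (LinearMap.ker f) = Module.finrank R M := by
  rw [rk, rk, ← Submodule.finrank_quotient_add_finrank (LinearMap.ker f),
    LinearEquiv.finrank_eq f.quotKerEquivRange]

lemma rk_bot : rk (⊥ : Submodule R M) = 0 := by
  rw [rk, finrank_bot]

lemma rk_pos [Module.Finite R M] [Module.IsTorsionFree R M] (N : Submodule R M) (hN : N ≠ ⊥) :
    0 < rk N := by
  have : Nontrivial N := Submodule.nontrivial_iff_ne_bot.2 hN
  have : Module.Finite R N := Module.IsNoetherian.finite R N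
  exact Module.finrank_pos

lemma rk_pi [Module.Finite R M] (k : ℕ) : Module.finrank R (Fin k → M) = k * Module.finrank R M := by
  induction k with
  | zero => rw [zero_mul]; exact Module.finrank_zero_of_subsingleton
  | succ k ih =>
    let f : (Fin (k+1) → M) →ₗ[R] (Fin k → M) := LinearMap.pi fun i => LinearMap.proj i.succ
    let g : M →ₗ[R] (Fin (k+1) → M) := LinearMap.single R (fun _ => M) 0
    have hf : LinearMap.range f = ⊤ := by
      rw [LinearMap.range_eq_top]
      intro v
      exact ⟨Fin.cons 0 v, by ext1 i; simp [f]⟩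
    have hg : LinearMap.range g = LinearMap.ker f := by
      ext v
      rw [LinearMap.mem_ker]
      constructor
      · rintro ⟨p, rfl⟩
        ext1 i
        simp [f, g]
      · intro h
        refine ⟨v 0, ?_⟩
        ext1 i
        refine Fin.cases ?_ (fun i => ?_) i
        · simp [g]
        · have := congrFun h i
          simp [f] at this
          simp [g, this]
    have h1 := rk_range_add_ker f
    have hgi : Function.Injective g := by
      intro a b hab
      simpa [g] using congrFun hab 0
    rw [rk, rk, hf, ← hg, LinearMap.finrank_range_of_inj hgi, finrank_top, ih] at h1
    rw [← h1]; ring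

end generic

section ranks
variable {X : Type*} [Fintype X] [DecidableEq X] (D : IData X) (K : Type*) [Field K]

lemma Cs_noeth : IsNoetherianRing (Cs D K) :=
  isNoetherianRing_of_surjective (MvPolynomial X K) (Cs D K)
    (expand D.N : MvPolynomial X K →ₐ[K] MvPolynomial X K).rangeRestrict.toRingHom
    (AlgHom.rangeRestrict_surjective (expand D.N : MvPolynomial X K →ₐ[K] MvPolynomial X K))

lemma A_fin : Module.Finite (Cs D K) (MvPolynomial X K) := by
  have h1 : Algebra.FiniteType (Cs D K) (MvPolynomial X K) :=
    Algebra.FiniteType.of_restrictScalars_finiteType K (Cs D K) (MvPolynomial X K)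
  have h2 : Algebra.IsIntegral (Cs D K) (MvPolynomial X K) := by
    refine ⟨fun p => ?_⟩
    induction p using MvPolynomial.induction_on with
    | C a =>
      have : (C a : MvPolynomial X K) = algebraMap (Cs D K) (MvPolynomial X K) (algebraMap K _ a) := rfl
      rw [this]
      exact isIntegral_algebraMap
    | add p q hp hq => exact hp.add hq
    | mul_X p x hp =>
      refine hp.mul ?_
      refine IsIntegral.of_pow D.Npos ?_
      have : (MvPolynomial.X x : MvPolynomial X K) ^ D.N =
        algebraMap (Cs D K) (MvPolynomial X K) ⟨_, ⟨MvPolynomial.X x, rfl⟩⟩ := by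
        change _ = expand D.N (MvPolynomial.X x)
        rw [expand_X]
      rw [this]
      exact isIntegral_algebraMap
  exact Algebra.IsIntegral.finite

lemma finrank_F (k : ℕ) : Module.finrank (Cs D K) (Fin k → MvPolynomial X K) =
    k * Module.finrank (Cs D K) (MvPolynomial X K) := by
  have := Cs_noeth D K
  have := A_fin D K
  exact rk_pi k

theorem dvd_rank (i : ℕ) : ∀ (k : ℕ) (d : Fin k → ℕ)
    (N : Submodule (Cs D K) (Fin k → MvPolynomial X K)), HSt D K d N → Ex D K N i →
    Module.finrank (Cs D K) (MvPolynomial X K) ∣ rk N := by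
  have := Cs_noeth D K
  have := A_fin D K
  induction i with
  | zero =>
    intro k d N hN hE
    obtain ⟨k', d', n, hn, hr, hc⟩ := exists_min_gen D K d N hN (IsNoetherian.noetherian N)
    have hb := Ex_zero (actF D K n) (fun x v => actF_SF D K n _ v) (by rw [hr]; exact hE) hc
    have h1 := rk_range_add_ker (actF D K n)
    rw [hb, hr, rk_bot, finrank_F, add_zero] at h1
    exact ⟨k', by rw [h1, mul_comm]⟩
  | succ i ih =>
    intro k d N hN hE
    obtain ⟨k', d', n, hn, hr, hc⟩ := exists_min_gen D K d N hN (IsNoetherian.noetherian N)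
    have hb := Ex_ker (actF D K n) (fun x v => actF_SF D K n _ v) i (by rw [hr]; exact hE)
    have h1 := rk_range_add_ker (actF D K n)
    have h2 := ih k' d' _ (ker_HSt D K d d' n hn) hb
    rw [hr, finrank_F] at h1
    exact (Nat.dvd_add_left h2).1 (h1 ▸ dvd_mul_left _ _)

theorem Act_homog_ne (e : ℕ) (p q : MvPolynomial X K) (hp : p ≠ 0) (hq : q ≠ 0)
    (he : homogeneousComponent e q = q) : Act D K p q ≠ 0 := by
  have := Cs_noeth D K
  have := A_fin D K
  intro h0
  let n : Fin 1 → Fin 1 → MvPolynomial X K := fun _ _ => q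
  have hn : HFam K (fun _ => 0) (fun _ => e) n := by
    intro i
    ext1 j
    rw [pr_apply, if_pos (Nat.zero_le _), Nat.sub_zero]
    exact he
  have h1 := dvd_rank D K _ 1 _ _ (range_HSt D K _ _ n hn) (Ex_big _)
  have h2 := rk_range_add_ker (actF D K n)
  have h3 := rk_pos (LinearMap.range (actF D K n)) (by
    intro h
    have h4 := gen_mem D K n 0
    rw [h, Submodule.mem_bot] at h4
    exact hq (congrFun h4 0))
  have h5 := rk_pos (LinearMap.ker (actF D K n)) (by
    intro h
    have h4 : (fun _ => p : Fin 1 → MvPolynomial X K) ∈ LinearMap.ker (actF D K n) := by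
      rw [LinearMap.mem_ker]
      ext1 j
      rw [actF_apply]
      simpa [n] using h0
    rw [h, Submodule.mem_bot] at h4
    exact hp (congrFun h4 0))
  rw [finrank_F, one_mul] at h2
  have h6 := Nat.le_of_dvd h3 h1
  omega

theorem Act_ne (p q : MvPolynomial X K) (hp : p ≠ 0) (hq : q ≠ 0) : Act D K p q ≠ 0 := by
  classical
  intro h
  have h1 := HC_top D K p q
  rw [h, map_zero] at h1
  exact Act_homog_ne D K q.totalDegree _ _ (HC_top_ne K p hp) (HC_top_ne K q hq)
    (by rw [HC_HC, if_pos rfl]) h1.symm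

end ranks
end YBDom

namespace YBDom
open Equiv MvPolynomial
set_option linter.unusedSectionVars false
set_option linter.unusedSimpArgs false

section period
variable {X : Type*} [Fintype X] [DecidableEq X]

lemma exists_period (φ : (X →₀ ℕ) → Perm X) (zero : φ 0 = 1)
    (mul : ∀ a b, φ (a + Finsupp.mapDomain (φ a) b) = φ a * φ b) :
    ∃ N : ℕ, 0 < N ∧ ∀ a, φ (N • a) = 1 := by
  have hz1 : ∀ a b, φ a = 1 → φ (a + b) = φ b := by
    intro a b ha
    have := mul a b
    rwa [ha, md_one, one_mul] at this
  let Z : AddSubmonoid (X →₀ ℕ) :=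
    { carrier := {a | φ a = 1}
      zero_mem' := zero
      add_mem' := fun {a b} ha hb => (hz1 a b ha).trans hb }
  have hinv : ∀ c, ∃ c', φ c' = (φ c)⁻¹ := by
    intro c
    have : ∀ n : ℕ, ∃ c', φ c' = φ c ^ n := by
      intro n
      induction n with
      | zero => exact ⟨0, by simpa using zero⟩
      | succ n ih =>
        obtain ⟨c', hc'⟩ := ih
        exact ⟨c + Finsupp.mapDomain (φ c) c', by rw [mul, hc', pow_succ']⟩
    obtain ⟨c', hc'⟩ := this (orderOf (φ c) - 1)
    refine ⟨c', ?_⟩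
    rw [hc', eq_inv_iff_mul_eq_one, ← pow_succ, Nat.sub_add_cancel (orderOf_pos _), pow_orderOf_eq_one]
  have hconj : ∀ c a, φ a = 1 → φ (Finsupp.mapDomain (φ c) a) = 1 := by
    intro c a ha
    obtain ⟨c', hc'⟩ := hinv c
    have h1 := mul c c'
    rw [hc', mul_inv_cancel] at h1
    have h2 := mul c (a + c')
    rw [hz1 a c' ha, hc', mul_inv_cancel, Finsupp.mapDomain_add, add_left_comm, add_comm, hz1 _ _ h1] at h2
    exact h2
  have hx : ∀ x : X, ∃ n : ℕ, 0 < n ∧ φ (n • Finsupp.single x 1) = 1 := by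
    intro x
    have key : ∀ k l : ℕ, k < l → φ (k • Finsupp.single x 1) = φ (l • Finsupp.single x 1) →
        φ ((l - k) • Finsupp.single x 1) = 1 := by
      intro k l hkl he
      set u := φ (k • Finsupp.single x 1) with hu
      have h1 := mul (k • Finsupp.single x 1) (Finsupp.mapDomain (u⁻¹ : Perm X) ((l - k) • Finsupp.single x 1))
      rw [← hu, md_mul, mul_inv_cancel, md_one, ← add_nsmul, Nat.add_sub_cancel' hkl.le, ← he] at h1
      have h2 := hconj (k • Finsupp.single x 1) _ (left_eq_mul.1 h1)
      rwa [← hu, md_mul, mul_inv_cancel, md_one] at h2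
    obtain ⟨k, l, hkl, he⟩ := Finite.exists_ne_map_eq_of_infinite
      (fun k : ℕ => φ (k • Finsupp.single x 1))
    rcases lt_or_gt_of_ne hkl with h | h
    · exact ⟨l - k, by omega, key k l h he⟩
    · exact ⟨k - l, by omega, key l k h he.symm⟩
  choose n hn0 hn using hx
  refine ⟨∏ x, n x, Finset.prod_pos fun x _ => hn0 x, fun a => ?_⟩
  change (∏ x, n x) • a ∈ Z
  induction a using Finsupp.induction_linear with
  | zero => rw [smul_zero]; exact Z.zero_mem
  | add f g hf hg => rw [smul_add]; exact Z.add_mem hf hg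
  | single x b =>
    obtain ⟨c, hc⟩ := Finset.dvd_prod_of_mem n (Finset.mem_univ x)
    have : (∏ x, n x) • Finsupp.single x b = (c * b) • (n x • Finsupp.single x 1) := by
      rw [hc]
      simp only [Finsupp.smul_single, smul_eq_mul, mul_one]
      congr 1
      ring
    rw [this]
    exact Z.nsmul_mem (hn x) _

end period

section rep
variable {X : Type*} [Fintype X] [DecidableEq X] {G : Type*} [Group G]
  (σ : X → Perm X) (ι : X → G)

/-- representation of vectors by positive elements of the group -/
inductive Rep : (X →₀ ℕ) → G → Prop
  | zero : Rep 0 1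
  | cons (x : X) (b : X →₀ ℕ) (g : G) : Rep b g →
      Rep (Finsupp.single x 1 + Finsupp.mapDomain (σ x) b) (ι x * g)

lemma split_at (x : X) (a : X →₀ ℕ) (h : a x ≠ 0) :
    ∃ b, a = Finsupp.single x 1 + Finsupp.mapDomain (σ x) b := by
  refine ⟨Finsupp.mapDomain ((σ x)⁻¹ : Perm X) (a - Finsupp.single x 1), ?_⟩
  rw [md_mul, mul_inv_cancel, md_one, add_tsub_cancel_of_le]
  rw [Finsupp.single_le_iff]
  omega

lemma deg_cons (x : X) (b : X →₀ ℕ) :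
    (Finsupp.single x 1 + Finsupp.mapDomain (σ x) b).degree = b.degree + 1 := by
  rw [map_add, degree_mapDomain, Finsupp.degree_single, add_comm]

lemma Rep_exists (a : X →₀ ℕ) : ∃ g, Rep σ ι a g := by
  obtain ⟨n, hn⟩ : ∃ n, n = a.degree := ⟨_, rfl⟩
  induction n generalizing a with
  | zero =>
    have : a = 0 := (Finsupp.degree_eq_zero_iff a).1 hn.symm
    subst this
    exact ⟨1, Rep.zero⟩
  | succ n ih =>
    have : a ≠ 0 := by rintro rfl; simp at hn
    obtain ⟨x, hx⟩ := Finsupp.ne_iff.1 this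
    obtain ⟨b, rfl⟩ := split_at σ x a hx
    rw [deg_cons] at hn
    obtain ⟨g, hg⟩ := ih b (by omega)
    exact ⟨_, Rep.cons x b g hg⟩

variable {σ ι}

lemma Rep_inv {a : X →₀ ℕ} {g : G} (h : Rep σ ι a g) : (a = 0 ∧ g = 1) ∨
    ∃ x b g', a = Finsupp.single x 1 + Finsupp.mapDomain (σ x) b ∧ g = ι x * g' ∧ Rep σ ι b g' := by
  cases h with
  | zero => exact Or.inl ⟨rfl, rfl⟩
  | cons x b g h => exact Or.inr ⟨x, b, g, rfl, rfl, h⟩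

lemma md_inj (u : Perm X) {a b : X →₀ ℕ} (h : Finsupp.mapDomain u a = Finsupp.mapDomain u b) : a = b :=
  Finsupp.mapDomain_injective u.injective h

lemma cons_swap (hσ : ∀ x y, σ x * σ y = σ (σ x y) * σ ((σ (σ x y))⁻¹ x)) (x z : X) (b : X →₀ ℕ) :
    Finsupp.single x 1 + Finsupp.mapDomain (σ x) (Finsupp.single z 1 + Finsupp.mapDomain (σ z) b) =
    Finsupp.single (σ x z) 1 + Finsupp.mapDomain (σ (σ x z))
      (Finsupp.single ((σ (σ x z))⁻¹ x) 1 + Finsupp.mapDomain (σ ((σ (σ x z))⁻¹ x)) b) := by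
  rw [Finsupp.mapDomain_add, Finsupp.mapDomain_add, md_mul, md_mul, ← hσ, Finsupp.mapDomain_single,
    Finsupp.mapDomain_single, perm_app_inv, add_left_comm]

lemma Rep_unique (hσ : ∀ x y, σ x * σ y = σ (σ x y) * σ ((σ (σ x y))⁻¹ x))
    (hι : ∀ x y, ι x * ι y = ι (σ x y) * ι ((σ (σ x y))⁻¹ x)) (n : ℕ) :
    ∀ (a : X →₀ ℕ) (g h : G), a.degree = n → Rep σ ι a g → Rep σ ι a h → g = h := by
  induction n with
  | zero =>
    intro a g h ha hg hh
    rcases Rep_inv hg with ⟨-, rfl⟩ | ⟨x, b, g', rfl, -, -⟩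
    · rcases Rep_inv hh with ⟨-, rfl⟩ | ⟨x, b, g', rfl, -, -⟩
      · rfl
      · rw [deg_cons] at ha; omega
    · rw [deg_cons] at ha; omega
  | succ n ih =>
    intro a g h ha hg hh
    rcases Rep_inv hg with ⟨rfl, rfl⟩ | ⟨x, b, g', rfl, rfl, hg'⟩
    · simp at ha
    rcases Rep_inv hh with ⟨h0, rfl⟩ | ⟨y, c, h', hbc, rfl, hh'⟩
    · rw [h0] at ha; simp at ha
    have hb : b.degree = n := by rw [deg_cons] at ha; omega
    have hc : c.degree = n := by rw [hbc, deg_cons] at ha; omega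
    by_cases hxy : x = y
    · subst hxy
      have : b = c := md_inj (σ x) (add_left_cancel hbc)
      subst this
      rw [ih b g' h' hb hg' hh']
    · obtain ⟨z, hz⟩ : ∃ z, σ x z = y := (σ x).surjective y
      have hbz : b z ≠ 0 := by
        have := DFunLike.congr_fun hbc y
        rw [Finsupp.add_apply, Finsupp.add_apply, Finsupp.single_eq_same, ← hz,
          Finsupp.mapDomain_apply (σ x).injective, hz, Finsupp.single_eq_of_ne (by tauto)] at this
        omega
      obtain ⟨d, rfl⟩ := split_at σ z b hbz
      obtain ⟨k, hk⟩ := Rep_exists σ ι d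
      have e1 := ih _ g' (ι z * k) hb hg' (Rep.cons z d k hk)
      rw [cons_swap hσ, hz] at hbc
      have hcd := md_inj (σ y) (add_left_cancel hbc)
      have e2 := ih c h' (ι ((σ y)⁻¹ x) * k) hc hh' (by
        rw [← hcd]; exact Rep.cons _ _ _ hk)
      rw [e1, e2, ← mul_assoc, ← mul_assoc, hι, hz]

lemma Rep_mul (Φ : G →* Perm X) (hΦ : ∀ x, Φ (ι x) = σ x) {a b : X →₀ ℕ} {g h : G}
    (hg : Rep σ ι a g) (hh : Rep σ ι b h) : Rep σ ι (a + Finsupp.mapDomain (Φ g) b) (g * h) := by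
  induction hg with
  | zero => rw [map_one, md_one, zero_add, one_mul]; exact hh
  | cons x c g hg ih =>
    have := Rep.cons x _ _ ih
    rwa [Finsupp.mapDomain_add, md_mul, ← hΦ, ← map_mul, ← add_assoc, ← mul_assoc, hΦ] at this

lemma Rep_aff (Ψ : G →* Perm (X → ℤ))
    (hΨ : ∀ x v y, Ψ (ι x) v y = (Finsupp.single x 1 : X →₀ ℕ) y + v ((σ x)⁻¹ y))
    {a : X →₀ ℕ} {g : G}
    (hg : Rep σ ι a g) : ∀ y, Ψ g 0 y = a y := by
  induction hg with
  | zero => simp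
  | cons x c g hg ih =>
    intro y
    rw [map_mul, Perm.mul_apply, hΨ, ih, Finsupp.add_apply]
    push_cast
    congr 2
    conv_rhs => rw [← perm_app_inv (σ x) y]
    rw [Finsupp.mapDomain_apply (σ x).injective]

end rep
end YBDom

namespace YBDom
open Equiv MvPolynomial
set_option linter.unusedSectionVars false
set_option linter.unusedSimpArgs false

section final
variable {X : Type*} [Fintype X] [DecidableEq X] {G : Type*} [Group G]

/-- linear map from polynomials to the group algebra -/
noncomputable def hat (K : Type*) [Field K] (s : (X →₀ ℕ) → G) :
    MvPolynomial X K →ₗ[K] MonoidAlgebra K G :=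
  (basisMonomials X K).constr K (fun a => MonoidAlgebra.single (s a) 1)

lemma hat_monomial (K : Type*) [Field K] (s : (X →₀ ℕ) → G) (a : X →₀ ℕ) :
    hat K s (monomial a 1) = MonoidAlgebra.single (s a) 1 := by
  have := (basisMonomials X K).constr_basis K
    (fun a => (MonoidAlgebra.single (s a) 1 : MonoidAlgebra K G)) a
  rwa [coe_basisMonomials] at this

lemma hat_mul (K : Type*) [Field K] (s : (X →₀ ℕ) → G) (D : IData X)
    (hs : ∀ a b, s a * s b = s (a + Finsupp.mapDomain (D.φ a) b)) (p q : MvPolynomial X K) :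
    hat K s p * hat K s q = hat K s (Act D K p q) := by
  have : ((LinearMap.mul K (MonoidAlgebra K G)).comp (hat K s)).compl₂ (hat K s) =
      (Act D K).compr₂ (hat K s) := by
    apply lin_ext
    intro a
    apply lin_ext
    intro b
    simp only [LinearMap.compr₂_apply, LinearMap.comp_apply, LinearMap.compl₂_apply,
      LinearMap.mul_apply', hat_monomial, Act_monomial, S_monomial]
    rw [MonoidAlgebra.single_mul_single, hs, one_mul]
  exact LinearMap.congr_fun₂ this p q

lemma hat_coeff (K : Type*) [Field K] (s : (X →₀ ℕ) → G) (hs : Function.Injective s)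
    (p : MvPolynomial X K) (a : X →₀ ℕ) : (hat K s p).coeff (s a) = coeff a p := by
  classical
  induction p using MvPolynomial.induction_on' with
  | monomial b c =>
    rw [show monomial b c = c • monomial b (1:K) by rw [smul_monomial, smul_eq_mul, mul_one],
      map_smul, hat_monomial, MonoidAlgebra.smul_single, MonoidAlgebra.coeff_single,
      Finsupp.single_apply, coeff_smul, coeff_monomial, hs.eq_iff]
    simp
  | add p q hp hq => rw [map_add, MonoidAlgebra.coeff_add, Finsupp.add_apply, hp, hq, coeff_add]

theorem abstract_domain (K : Type*) [Field K] (σ : X → Perm X) (ι : X → G)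
    (hσ : ∀ x y, σ x * σ y = σ (σ x y) * σ ((σ (σ x y))⁻¹ x))
    (hι : ∀ x y, ι x * ι y = ι (σ x y) * ι ((σ (σ x y))⁻¹ x))
    (Φ : G →* Perm X) (hΦ : ∀ x, Φ (ι x) = σ x)
    (Ψ : G →* Perm (X → ℤ))
    (hΨ : ∀ x v y, Ψ (ι x) v y = (Finsupp.single x 1 : X →₀ ℕ) y + v ((σ x)⁻¹ y))
    (hgen : Subgroup.closure (Set.range ι) = ⊤) (α β : MonoidAlgebra K G)
    (hα : α ≠ 0) (hβ : β ≠ 0) : α * β ≠ 0 := by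
  choose s hs using Rep_exists σ ι
  have hu : ∀ {a g}, Rep σ ι a g → g = s a := fun {a g} h => Rep_unique hσ hι _ a _ _ rfl h (hs a)
  have hmul : ∀ a b, s a * s b = s (a + Finsupp.mapDomain (Φ (s a)) b) := fun a b =>
    hu (Rep_mul Φ hΦ (hs a) (hs b))
  have hs0 : s 0 = 1 := (hu Rep.zero).symm
  have hφm : ∀ a b, Φ (s (a + Finsupp.mapDomain (Φ (s a)) b)) = Φ (s a) * Φ (s b) := fun a b => by
    rw [← hmul, map_mul]
  have hφ0 : Φ (s 0) = 1 := by rw [hs0, map_one]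
  obtain ⟨N, hN0, hN⟩ := exists_period (fun a => Φ (s a)) hφ0 hφm
  let D : IData X := ⟨fun a => Φ (s a), hφ0, hφm, N, hN0, hN⟩
  have hcons : ∀ x b, ι x * s b = s (Finsupp.single x 1 + Finsupp.mapDomain (σ x) b) := fun x b =>
    hu (Rep.cons x b _ (hs b))
  -- the constant vector
  let e : X →₀ ℕ := Finsupp.equivFunOnFinite.symm (fun _ => N)
  have he : ∀ (m : ℕ) (w : Perm X), Finsupp.mapDomain w (m • e) = m • e := by
    intro m w
    ext y
    rw [← perm_app_inv w y, Finsupp.mapDomain_apply w.injective]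
    simp [e]
  have heN : ∀ m : ℕ, Φ (s (m • e)) = 1 := by
    intro m
    have : m • e = N • (m • Finsupp.equivFunOnFinite.symm (fun _ : X => 1)) := by
      ext y
      simp [e, mul_comm]
    rw [this]
    exact hN _
  have hr : ∀ a m, s a * s (m • e) = s (a + m • e) := fun a m => by rw [hmul, he]
  have hl : ∀ a m, s (m • e) * s a = s (a + m • e) := fun a m => by
    rw [hmul, heN, md_one, add_comm]
  have hιs : ∀ x, ι x = s (Finsupp.single x 1) := fun x => by
    have := hcons x 0
    rwa [hs0, mul_one, Finsupp.mapDomain_zero, add_zero] at this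
  have hcomm : ∀ (m : ℕ) (g : G), s (m • e) * g = g * s (m • e) := by
    intro m g
    have hg : g ∈ Subgroup.closure (Set.range ι) := by rw [hgen]; trivial
    induction hg using Subgroup.closure_induction_left with
    | one => simp
    | mul_left x hx y _ ih =>
      obtain ⟨x, rfl⟩ := hx
      rw [← mul_assoc, hιs, hl, ← hr, mul_assoc, ih, mul_assoc]
    | inv_mul_cancel x hx y _ ih =>
      obtain ⟨x, rfl⟩ := hx
      have h1 : s (m • e) * ι x = ι x * s (m • e) := by rw [hιs, hl, hr]
      have h2 : s (m • e) * (ι x)⁻¹ = (ι x)⁻¹ * s (m • e) := by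
        rw [eq_inv_mul_iff_mul_eq, ← mul_assoc, ← h1, mul_inv_cancel_right]
      rw [← mul_assoc, h2, mul_assoc, ih, mul_assoc]
  have hfrac : ∀ g : G, ∃ m : ℕ, ∀ m' ≥ m, ∃ a, g * s (m' • e) = s a := by
    intro g
    have hg : g ∈ Subgroup.closure (Set.range ι) := by rw [hgen]; trivial
    induction hg using Subgroup.closure_induction_left with
    | one => exact ⟨0, fun m' _ => ⟨_, one_mul _⟩⟩
    | mul_left x hx y _ ih =>
      obtain ⟨x, rfl⟩ := hx
      obtain ⟨m, hm⟩ := ih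
      refine ⟨m, fun m' hm' => ?_⟩
      obtain ⟨a, ha⟩ := hm m' hm'
      exact ⟨_, by rw [mul_assoc, ha, hcons]⟩
    | inv_mul_cancel x hx y _ ih =>
      obtain ⟨x, rfl⟩ := hx
      obtain ⟨m, hm⟩ := ih
      refine ⟨m + 1, fun m' hm' => ?_⟩
      obtain ⟨m', rfl⟩ : ∃ c, m' = c + 1 := ⟨m' - 1, by omega⟩
      obtain ⟨a, ha⟩ := hm m' (by omega)
      obtain ⟨b, hb⟩ := split_at σ x (a + 1 • e) (by
        have : e x = N := rfl
        rw [one_smul, Finsupp.add_apply, this]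
        omega)
      refine ⟨b, ?_⟩
      rw [mul_assoc, inv_mul_eq_iff_eq_mul, hcons, ← hb, ← hr, ← ha, add_smul, mul_assoc, hr]
  have hfracA : ∀ γ : MonoidAlgebra K G, ∃ m : ℕ, ∀ m' ≥ m, ∃ p,
      γ * MonoidAlgebra.single (s (m' • e)) 1 = hat K s p := by
    intro γ
    induction γ using MonoidAlgebra.induction_linear with
    | zero => exact ⟨0, fun m' _ => ⟨0, by rw [zero_mul, map_zero]⟩⟩
    | add x y hx hy =>
      obtain ⟨m, hm⟩ := hx
      obtain ⟨l, hl⟩ := hy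
      refine ⟨max m l, fun m' hm' => ?_⟩
      obtain ⟨p, hp⟩ := hm m' (le_of_max_le_left hm')
      obtain ⟨q, hq⟩ := hl m' (le_of_max_le_right hm')
      exact ⟨p + q, by rw [add_mul, hp, hq, map_add]⟩
    | single g c =>
      obtain ⟨m, hm⟩ := hfrac g
      refine ⟨m, fun m' hm' => ?_⟩
      obtain ⟨a, ha⟩ := hm m' hm'
      refine ⟨c • monomial a 1, ?_⟩
      rw [MonoidAlgebra.single_mul_single, ha, map_smul, hat_monomial, MonoidAlgebra.smul_single,
        smul_eq_mul]
  obtain ⟨m, hm⟩ := hfracA α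
  obtain ⟨l, hl'⟩ := hfracA β
  obtain ⟨p, hp⟩ := hm (max m l) (le_max_left _ _)
  obtain ⟨q, hq⟩ := hl' (max m l) (le_max_right _ _)
  set u : MonoidAlgebra K G := MonoidAlgebra.single (s ((max m l) • e)) 1 with hudef
  set u' : MonoidAlgebra K G := MonoidAlgebra.single (s ((max m l) • e))⁻¹ 1 with hudef'
  have huu : u * u' = 1 := by
    rw [hudef, hudef', MonoidAlgebra.single_mul_single, mul_inv_cancel, one_mul]
    rfl
  have huc : ∀ γ : MonoidAlgebra K G, u * γ = γ * u := by
    intro γ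
    induction γ using MonoidAlgebra.induction_linear with
    | zero => simp
    | add x y hx hy => rw [mul_add, add_mul, hx, hy]
    | single g c => rw [hudef, MonoidAlgebra.single_mul_single, MonoidAlgebra.single_mul_single,
        hcomm, one_mul, mul_one]
  have hne : ∀ γ p, γ ≠ 0 → γ * u = hat K s p → p ≠ 0 := by
    rintro γ p hγ h rfl
    apply hγ
    rw [← mul_one γ, ← huu, ← mul_assoc, h, map_zero, zero_mul]
  intro h0
  have h1 : hat K s (Act D K p q) = 0 := by
    rw [← hat_mul K s D hmul, ← hp, ← hq, mul_assoc, ← mul_assoc u, huc, mul_assoc β,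
      ← mul_assoc α, h0, zero_mul]
  have hinj : Function.Injective s := by
    intro a b hab
    ext y
    have h2 := Rep_aff Ψ hΨ (hs a) y
    have h3 := Rep_aff Ψ hΨ (hs b) y
    rw [hab, h3] at h2
    exact_mod_cast h2.symm
  apply Act_ne D K p q (hne α p hα hp) (hne β q hβ hq)
  ext a
  rw [← hat_coeff K s hinj, h1]
  simp

end final
end YBDom

namespace YBDom
open Equiv

section concrete
variable {X : Type*} (r : X × X → X × X)

/-- the permutation `σ_x` -/
noncomputable def sp (hnd : Nondegenerate r) (x : X) : Perm X := Equiv.ofBijective _ (hnd.1 x)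

lemma sp_apply (hnd : Nondegenerate r) (x y : X) : sp r hnd x y = sig r x y := rfl

lemma sig_tau (hinv : Function.Involutive r) (x y : X) : sig r (sig r x y) (tau r y x) = x :=
  congrArg Prod.fst (hinv (x, y))

lemma sp_inv (hnd : Nondegenerate r) (hinv : Function.Involutive r) (x y : X) :
    (sp r hnd (sp r hnd x y))⁻¹ x = tau r y x := by
  rw [Perm.inv_eq_iff_eq]
  exact (sig_tau r hinv x y).symm

lemma sig_rel (hbr : IsBraided r) (x y z : X) :
    sig r x (sig r y z) = sig r (sig r x y) (sig r (tau r y x) z) := by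
  have := congrFun hbr (x, y, z)
  exact (congrArg Prod.fst this).symm

lemma sp_rel (hnd : Nondegenerate r) (hinv : Function.Involutive r) (hbr : IsBraided r) (x y : X) :
    sp r hnd x * sp r hnd y =
      sp r hnd (sp r hnd x y) * sp r hnd ((sp r hnd (sp r hnd x y))⁻¹ x) := by
  rw [sp_inv r hnd hinv]
  ext z
  exact sig_rel r hbr x y z

lemma of_rel (x y : X) : ybι r x * ybι r y = ybι r (sig r x y) * ybι r (tau r y x) := by
  have h : PresentedGroup.mk (ybRels r) (FreeGroup.of x * FreeGroup.of y *
      (FreeGroup.of (sig r x y) * FreeGroup.of (tau r y x))⁻¹) = 1 :=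
    PresentedGroup.one_of_mem ⟨x, y, rfl⟩
  rw [map_mul, map_inv, mul_inv_eq_one, map_mul, map_mul] at h
  exact h

lemma lift_ok {H : Type*} [Group H] (f : X → H)
    (hf : ∀ x y, f x * f y = f (sig r x y) * f (tau r y x)) :
    ∀ w ∈ ybRels r, FreeGroup.lift f w = 1 := by
  rintro w ⟨x, y, rfl⟩
  simp only [map_mul, map_inv, FreeGroup.lift_apply_of]
  rw [hf, mul_inv_cancel]

/-- affine permutations -/
noncomputable def aff [DecidableEq X] (u : Perm X) (x : X) : Perm (X → ℤ) where
  toFun v y := (Finsupp.single x 1 : X →₀ ℕ) y + v (u⁻¹ y)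
  invFun v y := v (u y) - (Finsupp.single x 1 : X →₀ ℕ) (u y)
  left_inv v := by ext y; simp
  right_inv v := by ext y; simp

lemma aff_apply [DecidableEq X] (u : Perm X) (x : X) (v : X → ℤ) (y : X) :
    aff u x v y = (Finsupp.single x 1 : X →₀ ℕ) y + v (u⁻¹ y) := rfl

end concrete
end YBDom

/-- For a finite nondegenerate involutive braided set
`(X,r)` and a field `K`, the group algebra `K[G(X,r)]` is a domain. -/
theorem groupAlgebra_isDomain {X : Type*} [Fintype X] (r : X × X → X × X)
    (hnd : Nondegenerate r) (hinv : Function.Involutive r) (hbr : IsBraided r)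
    (K : Type*) [Field K] :
    IsDomain (MonoidAlgebra K (YBGroup r)) := by
  classical
  have hσ := YBDom.sp_rel r hnd hinv hbr
  let Φ : YBGroup r →* Equiv.Perm X := PresentedGroup.toGroup (f := YBDom.sp r hnd)
    (YBDom.lift_ok r _ (fun x y => by
      rw [hσ, YBDom.sp_inv r hnd hinv]
      rfl))
  let Ψ : YBGroup r →* Equiv.Perm (X → ℤ) :=
    PresentedGroup.toGroup (f := fun x => YBDom.aff (YBDom.sp r hnd x) x)
    (YBDom.lift_ok r _ (fun x y => by
      ext v z
      have h1 : YBDom.sp r hnd (sig r x y) (tau r y x) = x := YBDom.sig_tau r hinv x y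
      have h2 : YBDom.sp r hnd x y = sig r x y := rfl
      have h3 := hσ x y
      rw [YBDom.sp_inv r hnd hinv, h2] at h3
      have h4 := congrArg (fun w : Equiv.Perm X => w⁻¹ z) h3
      simp only [mul_inv_rev, Equiv.Perm.mul_apply] at h4
      simp only [Equiv.Perm.mul_apply, YBDom.aff_apply, h4, Finsupp.single_apply]
      have e1 : (y = (YBDom.sp r hnd x)⁻¹ z) ↔ (sig r x y = z) := by
        rw [Equiv.Perm.eq_inv_iff_eq, h2]
      have e2 : (tau r y x = (YBDom.sp r hnd (sig r x y))⁻¹ z) ↔ (x = z) := by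
        rw [Equiv.Perm.eq_inv_iff_eq, h1]
      simp only [e1, e2]
      ring))
  have key := YBDom.abstract_domain (G := YBGroup r) K (YBDom.sp r hnd) (ybι r) hσ
    (fun x y => by
      rw [YBDom.sp_inv r hnd hinv]
      exact YBDom.of_rel r x y)
    Φ (fun x => PresentedGroup.toGroup.of _) Ψ
    (fun x v y => by
      have : Ψ (ybι r x) = YBDom.aff (YBDom.sp r hnd x) x := PresentedGroup.toGroup.of _
      rw [this, YBDom.aff_apply])
    (PresentedGroup.closure_range_of _)
  have : NoZeroDivisors (MonoidAlgebra K (YBGroup r)) := by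
    refine ⟨fun {a b} hab => ?_⟩
    by_contra hcon
    push Not at hcon
    exact key a b hcon.1 hcon.2 hab
  have : Nontrivial (MonoidAlgebra K (YBGroup r)) := inferInstance
  exact NoZeroDivisors.to_isDomain _
end
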